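/- There exists an absolute constant C₅ > 0 with the following property. Let b ≥ 1, let m ≥ n, and let B₀ = absconv{z₁,…,z_m} ⊆ b·√n·B₂ⁿ be a centrally symmetric polytope in ℝⁿ. Let μ be an isotropic log-concave probability measure on ℝⁿ, let n/4 ≤ k ≤ n, and let T ∈ M_n(ℝ) satisfy s_k(T) ≥ 1. Then for every 0 < γ ≤ 1/( C₅·b·√(ln(1+m/n)) ), one has μ({x ∈ ℝⁿ : T(x) ∈ γ·√n·B₀}) ≤ e^{−k}. -/

import Mathlib

open MeasureTheory Set
open scoped ENNReal RealInnerProductSpace Pointwise BigOperators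

noncomputable section

abbrev Euc (n : ℕ) := EuclideanSpace ℝ (Fin n)

/-- The absolute convex hull of a set. -/
def absConv (n : ℕ) (A : Set (Euc n)) : Set (Euc n) := convexHull ℝ (A ∪ -A)

/-- A log-concave function on `ℝⁿ`. -/
def IsLogConcaveFn (n : ℕ) (f : Euc n → ℝ) : Prop :=
  ∀ x y : Euc n, ∀ a b : ℝ, 0 ≤ a → 0 ≤ b → a + b = 1 →
    f x ^ a * f y ^ b ≤ f (a • x + b • y)

/-- `f` is a log-concave density of `μ` with barycenter `0`, total mass `1`
and identity covariance. -/
def IsIsotropicDensity (n : ℕ) (μ : Measure (Euc n)) (f : Euc n → ℝ) : Prop :=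
  (∀ x, 0 ≤ f x) ∧ IsLogConcaveFn n f ∧
  μ = volume.withDensity (fun x => ENNReal.ofReal (f x)) ∧
  IsProbabilityMeasure μ ∧ (∫ x, x ∂μ) = 0 ∧
  ∀ y z : Euc n, (∫ x, ⟪x, y⟫ * ⟪x, z⟫ ∂μ) = ⟪y, z⟫

/-- An isotropic log-concave probability measure on `ℝⁿ`. -/
def IsIsotropicLogConcave (n : ℕ) (μ : Measure (Euc n)) : Prop :=
  ∃ f, IsIsotropicDensity n μ f

/-- A centrally symmetric convex body. -/
def IsSymmConvexBody (n : ℕ) (K : Set (Euc n)) : Prop :=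
  Convex ℝ K ∧ K = -K ∧ IsCompact K ∧ (0 : Euc n) ∈ interior K

/-- A convex body (not necessarily symmetric). -/
def IsConvexBody (n : ℕ) (K : Set (Euc n)) : Prop :=
  Convex ℝ K ∧ IsCompact K ∧ (interior K).Nonempty

/-- The operator norm of `T : X_K → X_L`, where `X_K` and `X_L` carry the gauges of `K`, `L`. -/
def bodyOpNorm (n : ℕ) (K L : Set (Euc n)) (T : Euc n →ₗ[ℝ] Euc n) : ℝ :=
  sSup ((fun x => gauge L (T x)) '' K)

/-- The Banach–Mazur distance between the normed spaces with unit balls `K` and `L`. -/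
def distBM (n : ℕ) (K L : Set (Euc n)) : ℝ :=
  sInf {d : ℝ | ∃ T : Euc n ≃ₗ[ℝ] Euc n,
    d = bodyOpNorm n K L T.toLinearMap * bodyOpNorm n L K T.symm.toLinearMap}

/-- The `ℓ₂ⁿ → ℓ₂ⁿ` operator norm of a linear map. -/
def eucOpNorm (n : ℕ) (T : Euc n →ₗ[ℝ] Euc n) : ℝ :=
  ‖LinearMap.toContinuousLinearMap T‖

/-- The standard orthonormal basis vectors of `ℝⁿ`, as a set. -/
def stdBasisSet (n : ℕ) : Set (Euc n) :=
  Set.range fun i : Fin n => (EuclideanSpace.single i (1 : ℝ) : Euc n)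

/-- The basis-enriched random polytope `absconv{e₁,…,eₙ, x₁/√n,…,x_m/√n}`. -/
def enrichedBody (n m : ℕ) (x : Fin m → Euc n) : Set (Euc n) :=
  absConv n (stdBasisSet n ∪ Set.range fun j => (Real.sqrt n)⁻¹ • x j)

/-- `s_k(T) ≥ 1`, via the Courant–Fischer characterization of singular values. -/
def SingValGe (n : ℕ) (T : Euc n →ₗ[ℝ] Euc n) (k : ℕ) : Prop :=
  ∃ F : Submodule ℝ (Euc n), k ≤ Module.finrank ℝ F ∧ ∀ x ∈ F, ‖x‖ ≤ ‖T x‖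

/-- A `(k,β)`-mixing operator. -/
def IsMixing (n : ℕ) (T : Euc n →ₗ[ℝ] Euc n) (k : ℕ) (β : ℝ) : Prop :=
  ∃ E : Submodule ℝ (Euc n), k ≤ Module.finrank ℝ E ∧
    ∀ x ∈ E, β * ‖x‖ ≤ ‖Submodule.orthogonalProjectionOnto Eᗮ (T x)‖

/-- The basis constant of the normed space with unit ball `K`. -/
def basisConstant (n : ℕ) (K : Set (Euc n)) : ℝ :=
  sInf {c : ℝ | 0 < c ∧ ∃ b : Module.Basis (Fin n) ℝ (Euc n),
    ∀ k : ℕ, k ≤ n → ∀ lam : Fin n → ℝ,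
      gauge K (∑ i ∈ Finset.univ.filter (fun i : Fin n => (i : ℕ) < k), lam i • b i) ≤
        c * gauge K (∑ i, lam i • b i)}

/-- The polar body. -/
def polarBody (n : ℕ) (B : Set (Euc n)) : Set (Euc n) :=
  {y | ∀ x ∈ B, ⟪x, y⟫ ≤ 1}

/-- The 1-summing norm of the identity `I : X_B* → ℓ₂ⁿ`. -/
def piOneId (n : ℕ) (B : Set (Euc n)) : ℝ :=
  sInf {α : ℝ | 0 < α ∧ ∀ N : ℕ, ∀ z : Fin N → Euc n,
    ∑ j, ‖z j‖ ≤ α * sSup ((fun y => ∑ j, |⟪y, z j⟫|) '' B)}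

/-- The normed space with unit ball `L` admits a `1`-unconditional basis. -/
def HasOneUncondBasis (n : ℕ) (L : Set (Euc n)) : Prop :=
  ∃ b : Module.Basis (Fin n) ℝ (Euc n), ∀ lam : Fin n → ℝ,
    gauge L (∑ i, lam i • b i) = gauge L (∑ i, |lam i| • b i)

open Real (exp exp_add norm_of_nonneg sq_sqrt)
open ENNReal (ofReal ofReal_mul ofReal_le_ofReal)
open Module (finrank)
open Filter.Eventually (of_forall)
open Finset (mul_sum sum_congr sum_le_sum)

set_option linter.all false
set_option linter.unusedSectionVars false

section

lemma bm_compact {A B : Set ℝ} (hA : IsCompact A) (hB : IsCompact B) (hAn : A.Nonempty)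
    (hBn : B.Nonempty) {C : Set ℝ} (h : ∀ x ∈ A, ∀ y ∈ B, x + y ∈ C) :
    volume A + volume B ≤ volume C := by
  obtain ⟨a, ha, haM⟩ := hA.exists_isGreatest hAn
  obtain ⟨b, hb, hbm⟩ := hB.exists_isLeast hBn
  have h1 : (fun x => x + b) '' A ∪ (fun y => a + y) '' B ⊆ C := by
    rintro _ (⟨x, hx, rfl⟩ | ⟨y, hy, rfl⟩)
    · exact h x hx b hb
    · exact h a ha y hy
  have e1 : volume ((fun x => x + b) '' A) = volume A := by simp
  have e2 : volume ((fun y => a + y) '' B) = volume B := by simp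
  have hm : MeasurableSet ((fun y => a + y) '' B) :=
    (hB.image (by fun_prop)).measurableSet
  rw [← e1, ← e2, ← measure_union₀ hm.nullMeasurableSet]
  · exact measure_mono h1
  · refine measure_mono_null (t := {a + b}) ?_ (by simp)
    rintro _ ⟨⟨x, hx, rfl⟩, ⟨y, hy, hxy⟩⟩
    have := haM hx; have := hbm hy
    simp only [mem_singleton_iff] at *
    linarith

lemma bm_meas {A B : Set ℝ} (hA : MeasurableSet A) (hB : MeasurableSet B) (hAn : A.Nonempty)
    (hBn : B.Nonempty) {C : Set ℝ} (h : ∀ x ∈ A, ∀ y ∈ B, x + y ∈ C) :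
    volume A + volume B ≤ volume C := by
  rw [hA.measure_eq_iSup_isCompact, hB.measure_eq_iSup_isCompact]
  obtain ⟨a, ha⟩ := hAn
  obtain ⟨b, hb⟩ := hBn
  have key : ∀ K, K ⊆ A → IsCompact K → ∀ L, L ⊆ B → IsCompact L →
      volume K + volume L ≤ volume C := by
    intro K hK hKc L hL hLc
    calc volume K + volume L ≤ volume (insert a K) + volume (insert b L) :=
          add_le_add (measure_mono (subset_insert _ _)) (measure_mono (subset_insert _ _))
      _ ≤ _ := bm_compact (hKc.insert a) (hLc.insert b) (insert_nonempty _ _)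
          (insert_nonempty _ _) (fun x hx y hy => h x (insert_subset ha hK hx) y
            (insert_subset hb hL hy))
  have : Nonempty {K // K ⊆ A ∧ IsCompact K} := ⟨∅, by simp⟩
  have h0 : ∀ K, K ⊆ A → IsCompact K → volume K + ⨆ L, ⨆ (_ : L ⊆ B), ⨆ (_ : IsCompact L), volume L ≤ volume C := by
    intro K hK hKc
    have : (⨆ L, ⨆ (_ : L ⊆ B), ⨆ (_ : IsCompact L), volume L)
        = ⨆ L : {L // L ⊆ B ∧ IsCompact L}, volume L.1 := by
      rw [iSup_subtype]; simp only [iSup_and]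
    rw [this]
    have : Nonempty {L // L ⊆ B ∧ IsCompact L} := ⟨∅, by simp⟩
    rw [ENNReal.add_iSup]
    exact iSup_le fun L => key K hK hKc L.1 L.2.1 L.2.2
  have e : (⨆ L, ⨆ (_ : L ⊆ A), ⨆ (_ : IsCompact L), volume L)
        = ⨆ L : {L // L ⊆ A ∧ IsCompact L}, volume L.1 := by
      rw [iSup_subtype]; simp only [iSup_and]
  rw [e, ENNReal.iSup_add]
  exact iSup_le fun L => h0 L.1 L.2.1 L.2.2

lemma pl_norm {f g h : ℝ → ℝ} (hf : Measurable f) (hg : Measurable g) (hh : Measurable h)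
    (f0 : ∀ x, 0 ≤ f x) (g0 : ∀ x, 0 ≤ g x) (h0 : ∀ x, 0 ≤ h x)
    (f1 : ∀ x, f x ≤ 1) (g1 : ∀ x, g x ≤ 1)
    (fs : ∀ s, 0 < s → s < 1 → ∃ x, s < f x) (gs : ∀ s, 0 < s → s < 1 → ∃ x, s < g x)
    (H : ∀ x y, f x * g y ≤ h ((1/2:ℝ) • (x + y)) ^ 2) :
    (∫⁻ x, ofReal (f x)) + ∫⁻ x, ofReal (g x)
      ≤ 2 * ∫⁻ x, ofReal (h x) := by
  rw [lintegral_eq_lintegral_meas_lt _ (.of_forall f0) hf.aemeasurable,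
    lintegral_eq_lintegral_meas_lt _ (.of_forall g0) hg.aemeasurable,
    lintegral_eq_lintegral_meas_lt _ (.of_forall h0) hh.aemeasurable]
  have mf : Measurable fun t => volume {a | t < f a} :=
    Antitone.measurable fun s t hst => measure_mono fun a (ha : t < f a) => hst.trans_lt ha
  rw [← lintegral_add_left mf, ← lintegral_const_mul' _ _ (by simp)]
  refine setLIntegral_mono' measurableSet_Ioi fun s (hs : 0 < s) => ?_
  rcases lt_or_ge s 1 with h1 | h1
  · have hb := bm_meas (measurableSet_lt measurable_const hf) (measurableSet_lt measurable_const hg)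
      (fs s hs h1) (gs s hs h1) (C := (2:ℝ) • {a | s < h a}) (fun x hx y hy => ?_)
    · refine hb.trans ?_
      rw [Measure.addHaar_smul]; simp
    · refine ⟨(1/2:ℝ) • (x + y), ?_, by simp⟩
      have hx : s < f x := hx
      have hy : s < g y := hy
      have := H x y
      show s < _
      by_contra hc
      push Not at hc
      nlinarith [h0 ((1/2:ℝ) • (x + y)), f0 x, g0 y, mul_lt_mul'' hx hy hs.le hs.le]
  · have e1 : {a | s < f a} = ∅ := by ext a; simpa using (f1 a).trans h1
    have e2 : {a | s < g a} = ∅ := by ext a; simpa using (g1 a).trans h1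
    simp [e1, e2]

/-- Prékopa–Leindler property. -/
def LC {E : Type*} [AddCommGroup E] [Module ℝ E] [MeasurableSpace E] (μ : Measure E) : Prop :=
  ∀ f g h : E → ℝ≥0∞, Measurable f → Measurable g → Measurable h →
    (∀ x y, f x * g y ≤ h ((1/2:ℝ) • (x + y)) ^ 2) → (∫⁻ x, f x ∂μ) * (∫⁻ x, g x ∂μ) ≤ (∫⁻ x, h x ∂μ) ^ 2

lemma pl_bdd {f g h : ℝ → ℝ≥0∞} (hf : Measurable f) (hg : Measurable g) (hh : Measurable h)
    (fb : ∃ N : ℝ≥0∞, N ≠ ∞ ∧ ∀ x, f x ≤ N) (gb : ∃ N : ℝ≥0∞, N ≠ ∞ ∧ ∀ x, g x ≤ N)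
    (H : ∀ x y, f x * g y ≤ h ((1/2:ℝ) • (x + y)) ^ 2) :
    (∫⁻ x, f x) * (∫⁻ x, g x) ≤ (∫⁻ x, h x) ^ 2 := by
  set F := ⨆ x, f x
  set G := ⨆ x, g x
  have Ft : F ≠ ∞ := by
    obtain ⟨N, hN, hb⟩ := fb; exact ne_top_of_le_ne_top hN (iSup_le hb)
  have Gt : G ≠ ∞ := by
    obtain ⟨N, hN, hb⟩ := gb; exact ne_top_of_le_ne_top hN (iSup_le hb)
  have fF : ∀ x, f x ≤ F := fun x => le_iSup f x
  have gG : ∀ x, g x ≤ G := fun x => le_iSup g x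
  rcases eq_or_ne F 0 with F0 | F0
  · have : ∀ x, f x = 0 := fun x => le_antisymm ((fF x).trans F0.le) bot_le
    simp [this]
  rcases eq_or_ne G 0 with G0 | G0
  · have : ∀ x, g x = 0 := fun x => le_antisymm ((gG x).trans G0.le) bot_le
    simp [this]
  have Fp := ENNReal.toReal_pos F0 Ft
  have Gp := ENNReal.toReal_pos G0 Gt
  set r := Real.sqrt (F.toReal * G.toReal)
  have rp : 0 < r := Real.sqrt_pos.2 (by positivity)
  have r2 : r ^ 2 = F.toReal * G.toReal := sq_sqrt (by positivity)
  have hfin : ∀ x, f x ≠ ∞ := fun x => ne_top_of_le_ne_top Ft (fF x)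
  have gfin : ∀ x, g x ≠ ∞ := fun x => ne_top_of_le_ne_top Gt (gG x)
  have P := pl_norm (f := fun x => (f x).toReal / F.toReal) (g := fun x => (g x).toReal / G.toReal)
    (h := fun x => (min (h x) (ofReal r)).toReal / r) (by fun_prop) (by fun_prop) (by fun_prop)
    (fun x => by positivity) (fun x => by positivity) (fun x => by positivity)
    (fun x => by rw [div_le_one Fp]; exact ENNReal.toReal_mono Ft (fF x))
    (fun x => by rw [div_le_one Gp]; exact ENNReal.toReal_mono Gt (gG x))
    (fun s s0 hs => by
      have : ofReal (s * F.toReal) < F := by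
        rw [ENNReal.ofReal_lt_iff_lt_toReal (by positivity) Ft]
        nlinarith
      obtain ⟨x, hx⟩ := lt_iSup_iff.1 this
      refine ⟨x, ?_⟩
      rw [lt_div_iff₀ Fp]
      exact (ENNReal.ofReal_lt_iff_lt_toReal (by positivity) (hfin x)).1 hx)
    (fun s s0 hs => by
      have : ofReal (s * G.toReal) < G := by
        rw [ENNReal.ofReal_lt_iff_lt_toReal (by positivity) Gt]
        nlinarith
      obtain ⟨x, hx⟩ := lt_iSup_iff.1 this
      refine ⟨x, ?_⟩
      rw [lt_div_iff₀ Gp]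
      exact (ENNReal.ofReal_lt_iff_lt_toReal (by positivity) (gfin x)).1 hx)
    (fun x y => by
      have h1 : f x * g y ≤ (min (h ((1/2:ℝ) • (x + y))) (ofReal r)) ^ 2 := by
        rcases min_choice (h ((1/2:ℝ) • (x + y))) (ofReal r) with e | e <;> rw [e]
        · exact H x y
        · rw [← ENNReal.ofReal_pow rp.le, r2, ofReal_mul Fp.le, ENNReal.ofReal_toReal Ft,
            ENNReal.ofReal_toReal Gt]
          exact mul_le_mul' (fF x) (gG y)
      have h2 := ENNReal.toReal_mono (ENNReal.pow_ne_top (ne_top_of_le_ne_top ENNReal.ofReal_ne_top (min_le_right _ _))) h1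
      rw [ENNReal.toReal_mul, ENNReal.toReal_pow] at h2
      rw [div_pow, r2, div_mul_div_comm]
      gcongr)
  have cf : (∫⁻ x, ofReal ((f x).toReal / F.toReal)) = (∫⁻ x, f x) / F := by
    rw [div_eq_mul_inv, ← lintegral_mul_const' _ _ (by simp [F0])]
    refine lintegral_congr fun x => ?_
    rw [ENNReal.ofReal_div_of_pos Fp, ENNReal.ofReal_toReal (hfin x), ENNReal.ofReal_toReal Ft, div_eq_mul_inv]
  have cg : (∫⁻ x, ofReal ((g x).toReal / G.toReal)) = (∫⁻ x, g x) / G := by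
    rw [div_eq_mul_inv, ← lintegral_mul_const' _ _ (by simp [G0])]
    refine lintegral_congr fun x => ?_
    rw [ENNReal.ofReal_div_of_pos Gp, ENNReal.ofReal_toReal (gfin x), ENNReal.ofReal_toReal Gt, div_eq_mul_inv]
  have ch : (∫⁻ x, ofReal ((min (h x) (ofReal r)).toReal / r)) ≤ (∫⁻ x, h x) / ofReal r := by
    rw [div_eq_mul_inv, ← lintegral_mul_const' _ _ (by simp [rp])]
    refine lintegral_mono fun x => ?_
    rw [ENNReal.ofReal_div_of_pos rp, ENNReal.ofReal_toReal (by simp), div_eq_mul_inv]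
    gcongr
    exact min_le_left _ _
  rw [cf, cg] at P
  have P2 := P.trans (mul_le_mul_right ch 2)
  set a := ∫⁻ x, f x
  set b := ∫⁻ x, g x
  set c := ∫⁻ x, h x
  rcases eq_or_ne c ∞ with ct | ct
  · simp [ct]
  have hrt : c / ofReal r ≠ ∞ := ENNReal.div_ne_top ct (by simp [rp])
  have sumt : a / F + b / G ≠ ∞ := ne_top_of_le_ne_top (by finiteness) P2
  have at' : a ≠ ∞ := fun h => by simp [h, ENNReal.top_div_of_ne_top Ft] at sumt
  have bt' : b ≠ ∞ := fun h => by simp [h, ENNReal.top_div_of_ne_top Gt] at sumt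
  have P3 := ENNReal.toReal_mono (by finiteness) P2
  rw [ENNReal.toReal_add (by finiteness) (by finiteness), ENNReal.toReal_div, ENNReal.toReal_div, ENNReal.toReal_mul,
    ENNReal.toReal_div, ENNReal.toReal_ofReal rp.le] at P3
  rw [← ENNReal.ofReal_toReal at', ← ENNReal.ofReal_toReal bt', ← ENNReal.ofReal_toReal ct,
    ← ofReal_mul (by positivity), ← ENNReal.ofReal_pow (by positivity)]
  refine ofReal_le_ofReal ?_
  have ap := a.toReal_nonneg
  have bp := b.toReal_nonneg
  set A := a.toReal
  set B := b.toReal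
  set Cc := c.toReal
  simp only [ENNReal.toReal_ofNat] at P3
  have k1 : A / F.toReal * (B / G.toReal) ≤ (Cc / r) ^ 2 := by
    have u : 0 ≤ A / F.toReal := by positivity
    have v : 0 ≤ B / G.toReal := by positivity
    nlinarith [sq_nonneg (A / F.toReal - B / G.toReal)]
  rw [div_pow, r2, div_mul_div_comm] at k1
  exact (div_le_div_iff_of_pos_right (by positivity)).1 k1

lemma LC_real : LC (volume : Measure ℝ) := by
  intro f g h hf hg hh H
  have key : ∀ N : ℕ, (∫⁻ x, min (f x) N) * (∫⁻ x, min (g x) N) ≤ (∫⁻ x, h x) ^ 2 := fun N =>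
    pl_bdd (by fun_prop) (by fun_prop) hh ⟨N, by simp, fun x => min_le_right _ _⟩
      ⟨N, by simp, fun x => min_le_right _ _⟩
      (fun x y => (mul_le_mul' (min_le_left _ _) (min_le_left _ _)).trans (H x y))
  have mono : ∀ f : ℝ → ℝ≥0∞, Monotone fun (N : ℕ) x => min (f x) (N : ℝ≥0∞) := fun f i j hij x =>
    min_le_min le_rfl (by exact_mod_cast hij)
  have lim : ∀ f : ℝ → ℝ≥0∞, Measurable f → Filter.Tendsto (fun N : ℕ => ∫⁻ x, min (f x) N) Filter.atTop
      (nhds (∫⁻ x, f x)) := by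
    intro f hf
    refine lintegral_tendsto_of_tendsto_of_monotone (fun n => by fun_prop) (.of_forall fun x i j hij => mono f hij x)
      (.of_forall fun x => ?_)
    have := (tendsto_const_nhds (x := f x)).min ENNReal.tendsto_nat_nhds_top
    simpa using this
  rcases eq_or_ne (∫⁻ x, f x) 0 with h0 | h0
  · simp [h0]
  rcases eq_or_ne (∫⁻ x, g x) 0 with h0' | h0'
  · simp [h0']
  exact le_of_tendsto (ENNReal.Tendsto.mul (lim f hf) (.inl h0) (lim g hg) (.inl h0')) (.of_forall key)

lemma LC.prod {E F : Type*} [AddCommGroup E] [Module ℝ E] [MeasurableSpace E]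
    [AddCommGroup F] [Module ℝ F] [MeasurableSpace F] {μ : Measure E} {ν : Measure F}
    [SFinite μ] [SFinite ν] (hμ : LC μ) (hν : LC ν) : LC (μ.prod ν) := by
  intro f g h hf hg hh H
  rw [lintegral_prod _ hf.aemeasurable, lintegral_prod _ hg.aemeasurable, lintegral_prod _ hh.aemeasurable]
  refine hμ _ _ _ hf.lintegral_prod_right' hg.lintegral_prod_right' hh.lintegral_prod_right' fun x y => ?_
  exact hν _ _ _ (by fun_prop) (by fun_prop) (by fun_prop) fun a b => H (x, a) (y, b)

lemma LC.map {E F : Type*} [AddCommGroup E] [Module ℝ E] [MeasurableSpace E]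
    [AddCommGroup F] [Module ℝ F] [MeasurableSpace F] {μ : Measure E} (hμ : LC μ) (T : E →ₗ[ℝ] F)
    (hT : Measurable T) : LC (μ.map T) := by
  intro f g h hf hg hh H
  rw [lintegral_map hf hT, lintegral_map hg hT, lintegral_map hh hT]
  refine hμ _ _ _ (hf.comp hT) (hg.comp hT) (hh.comp hT) fun x y => ?_
  simpa using H (T x) (T y)

lemma LC_pi (n : ℕ) : LC (volume : Measure (Fin n → ℝ)) := by
  induction n with
  | zero =>
    intro f g h hf hg hh H
    rw [volume_pi, Measure.pi_of_empty _ default]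
    simp only [lintegral_dirac]
    have e : (1/2:ℝ) • ((default : Fin 0 → ℝ) + default) = default := Subsingleton.elim _ _
    simpa only [e] using H default default
  | succ n ih =>
    have e := (volume_preserving_piFinSuccAbove (fun _ : Fin (n+1) => ℝ) 0).symm
    let T : (ℝ × (Fin n → ℝ)) →ₗ[ℝ] (Fin (n+1) → ℝ) :=
      { toFun := fun p => Fin.cons p.1 p.2
        map_add' := fun p q => by ext i; refine Fin.cases ?_ (fun j => ?_) i <;> simp
        map_smul' := fun p q => by ext i; refine Fin.cases ?_ (fun j => ?_) i <;> simp }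
    have hT : (T : (ℝ × (Fin n → ℝ)) → (Fin (n+1) → ℝ)) = (MeasurableEquiv.piFinSuccAbove (fun _ : Fin (n+1) => ℝ) 0).symm := by
      ext p i; simp [T, MeasurableEquiv.piFinSuccAbove]
    have := LC.map (LC.prod LC_real ih) (T := T) (hT ▸ e.measurable)
    rw [hT] at this
    exact e.map_eq ▸ this

lemma LC_volume (E : Type*) [NormedAddCommGroup E] [InnerProductSpace ℝ E] [FiniteDimensional ℝ E]
    [MeasurableSpace E] [BorelSpace E] : LC (volume : Measure E) := by
  have e := (stdOrthonormalBasis ℝ E).measurePreserving_repr_symm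
  have e2 := (EuclideanSpace.volume_preserving_symm_measurableEquiv_toLp (Fin (finrank ℝ E))).symm
  have h := (LC_pi (finrank ℝ E)).map 
    (((stdOrthonormalBasis ℝ E).repr.symm.toLinearEquiv.toLinearMap).comp 
      (WithLp.linearEquiv 2 ℝ (Fin (finrank ℝ E) → ℝ)).symm.toLinearMap)
      ((e.measurable.comp e2.measurable))
  have h2 : Measure.map (⇑(stdOrthonormalBasis ℝ E).repr.symm ∘ ⇑(MeasurableEquiv.toLp 2 (Fin (finrank ℝ E) → ℝ)).symm.symm) volume = (volume : Measure E) := by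
    rw [← Measure.map_map e.measurable e2.measurable, e2.map_eq, e.map_eq]
  exact h2 ▸ h

end

section

variable {E : Type*} [NormedAddCommGroup E] [InnerProductSpace ℝ E] [FiniteDimensional ℝ E]
    [MeasurableSpace E] [BorelSpace E]

section


def SLC (t : ℝ) (μ : Measure E) : Prop :=
  ∀ f g h : E → ℝ≥0∞, Measurable f → Measurable g → Measurable h →
    (∀ x y, f x * g y ≤ h ((1/2:ℝ) • (x + y)) ^ 2 * ofReal (exp (t / 4 * ‖x - y‖ ^ 2))) →
    (∫⁻ x, f x ∂μ) * (∫⁻ x, g x ∂μ) ≤ (∫⁻ x, h x ∂μ) ^ 2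

lemma LC.slc {μ : Measure E} (h : LC μ) : SLC 0 μ := by
  intro f g k hf hg hk H
  exact h f g k hf hg hk (by simpa using H)

lemma SLC.lc {μ : Measure E} (h : SLC 0 μ) : LC μ := by
  intro f g k hf hg hk H
  exact h f g k hf hg hk (by simpa using H)

lemma SLC.withDensity {μ : Measure E} {s r : ℝ} (hμ : SLC s μ) {w : E → ℝ≥0∞} (hw : Measurable w)
    (H : ∀ x y, w x * w y ≤ w ((1/2:ℝ) • (x + y)) ^ 2 * ofReal (exp (- (r / 4 * ‖x - y‖ ^ 2)))) :
    SLC (s + r) (μ.withDensity w) := by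
  intro f g h hf hg hh K
  rw [lintegral_withDensity_eq_lintegral_mul _ hw hf, lintegral_withDensity_eq_lintegral_mul _ hw hg,
    lintegral_withDensity_eq_lintegral_mul _ hw hh]
  refine hμ _ _ _ (hw.mul hf) (hw.mul hg) (hw.mul hh) fun x y => ?_
  simp only [Pi.mul_apply]
  calc w x * f x * (w y * g y) = (w x * w y) * (f x * g y) := by ring
    _ ≤ _ := mul_le_mul' (H x y) (K x y)
    _ = (w ((1/2:ℝ) • (x + y)) * h ((1/2:ℝ) • (x + y))) ^ 2 *
        (ofReal (exp (- (r / 4 * ‖x - y‖ ^ 2))) * ofReal (exp ((s + r) / 4 * ‖x - y‖ ^ 2))) := by ring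
    _ = _ := by
      rw [← ofReal_mul (by positivity), ← exp_add]
      congr 4; ring

lemma SLC.smul {μ : Measure E} {s : ℝ} (hμ : SLC s μ) (c : ℝ≥0∞) : SLC s (c • μ) := by
  intro f g h hf hg hh K
  simp only [lintegral_smul_measure, smul_eq_mul]
  calc _ = c ^ 2 * ((∫⁻ x, f x ∂μ) * (∫⁻ x, g x ∂μ)) := by ring
    _ ≤ c ^ 2 * (∫⁻ x, h x ∂μ) ^ 2 := by gcongr; exact hμ f g h hf hg hh K
    _ = _ := by ring

lemma SLC.map {F : Type*} [NormedAddCommGroup F] [InnerProductSpace ℝ F] [FiniteDimensional ℝ F]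
    [MeasurableSpace F] [BorelSpace F] {μ : Measure E} {t : ℝ} (ht : 0 ≤ t) (hμ : SLC t μ) (P : E →L[ℝ] F)
    (hP : ∀ x, ‖P x‖ ≤ ‖x‖) : SLC t (μ.map P) := by
  intro f g h hf hg hh H
  rw [lintegral_map hf P.measurable, lintegral_map hg P.measurable, lintegral_map hh P.measurable]
  refine hμ _ _ _ (hf.comp P.measurable) (hg.comp P.measurable) (hh.comp P.measurable) fun x y => ?_
  refine (H (P x) (P y)).trans ?_
  simp only [← map_add, ← map_sub, ← map_smul]
  gcongr
  exact hP _

lemma mid_sq (x y : E) : ‖x‖ ^ 2 + ‖y‖ ^ 2 = 2 * ‖(1/2:ℝ) • (x + y)‖ ^ 2 + ‖x - y‖ ^ 2 / 2 := by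
  have := parallelogram_law_with_norm ℝ x y
  rw [norm_smul, mul_pow]; norm_num
  linarith

lemma gtilt_mid (t : ℝ) (θ x y : E) :
    ofReal (exp (⟪θ, x⟫ - t / 2 * ‖x‖ ^ 2)) * ofReal (exp (⟪θ, y⟫ - t / 2 * ‖y‖ ^ 2))
     ≤ ofReal (exp (⟪θ, (1/2:ℝ) • (x + y)⟫ - t / 2 * ‖(1/2:ℝ) • (x + y)‖ ^ 2)) ^ 2 *
      ofReal (exp (- (t / 4 * ‖x - y‖ ^ 2))) := by
  rw [← ofReal_mul (by positivity), ← ENNReal.ofReal_pow (by positivity), ← ofReal_mul (by positivity),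
    ← exp_add, ← Real.exp_nat_mul, ← exp_add]
  refine le_of_eq ?_
  congr 2
  rw [inner_smul_right, inner_add_right]
  have := mid_sq x y
  push_cast
  linear_combination (-t/2) * this

lemma SLC.tilt {μ : Measure E} {s : ℝ} (hμ : SLC s μ) (t : ℝ) (θ : E) :
    SLC (s + t) (μ.withDensity fun x => ofReal (exp (⟪θ, x⟫ - t / 2 * ‖x‖ ^ 2))) :=
  hμ.withDensity (by fun_prop) (gtilt_mid t θ)

lemma SLC.restrict {μ : Measure E} {s : ℝ} (hμ : SLC s μ) {K : Set E} (hK : Convex ℝ K)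
    (hm : MeasurableSet K) : SLC s (μ.restrict K) := by
  rw [← withDensity_indicator_one hm]
  have := hμ.withDensity (r := 0) (w := K.indicator 1) (measurable_one.indicator hm) (fun x y => ?_)
  · simpa using this
  · simp only [zero_div, zero_mul, neg_zero, Real.exp_zero, ENNReal.ofReal_one, mul_one]
    by_cases hx : x ∈ K
    · by_cases hy : y ∈ K
      · have : (1/2:ℝ) • (x + y) ∈ K := by
          rw [smul_add]; exact hK hx hy (by norm_num) (by norm_num) (by norm_num)
        rw [indicator_of_mem hx, indicator_of_mem hy, indicator_of_mem this]; simp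
      · simp [hy]
    · simp [hx]

/-- exponential inequality from SLC -/
lemma SLC.exp_ineq {μ : Measure E} {t : ℝ} (hμ : SLC t μ) {u : E → ℝ} {G : E → E} (hu : Measurable u)
    (hG : Measurable G) {C ε : ℝ} (hε : 0 ≤ ε) (hC : 4 * C * ε < t)
    (hT : ∀ x y, u x - u y ≤ ⟪G ((1/2:ℝ) • (x + y)), x - y⟫ + C * ‖x - y‖ ^ 2) :
    (∫⁻ x, ofReal (exp (ε * u x)) ∂μ) * (∫⁻ x, ofReal (exp (-(ε * u x))) ∂μ) ≤
      (∫⁻ x, ofReal (exp (ε ^ 2 / (2 * (t - 4 * C * ε)) * ‖G x‖ ^ 2)) ∂μ) ^ 2 := by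
  refine hμ _ _ _ (by fun_prop) (by fun_prop) (by fun_prop) fun x y => ?_
  rw [← ofReal_mul (by positivity), ← ENNReal.ofReal_pow (by positivity), ← ofReal_mul (by positivity),
    ← exp_add, ← Real.exp_nat_mul, ← exp_add]
  refine ofReal_le_ofReal (Real.exp_le_exp.2 ?_)
  set m := (1/2:ℝ) • (x + y)
  have h1 := hT x y
  have h2 := real_inner_le_norm (G m) (x - y)
  set g := ‖G m‖
  set d := ‖x - y‖
  have ha : 0 < t - 4 * C * ε := by linarith
  push_cast
  have h3 : ε * u x + -(ε * u y) ≤ ε * (g * d + C * d ^ 2) := by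
    have := mul_le_mul_of_nonneg_left (h1.trans (add_le_add_left h2 _)) hε
    linarith
  have h4 : 2 * (ε ^ 2 / (2 * (t - 4 * C * ε)) * g ^ 2) + t / 4 * d ^ 2 - ε * (g * d + C * d ^ 2)
     = (ε * g - (t - 4 * C * ε) * d / 2) ^ 2 / (t - 4 * C * ε) := by
    obtain ⟨a, rfl⟩ : ∃ a, t = a + 4 * C * ε := ⟨t - 4 * C * ε, by ring⟩
    rw [add_sub_cancel_right] at ha ⊢
    field_simp; ring
  have h5 : 0 ≤ (ε * g - (t - 4 * C * ε) * d / 2) ^ 2 / (t - 4 * C * ε) := by positivity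
  linarith

lemma cosh_ge (x : ℝ) : 1 + x ^ 2 / 2 ≤ Real.cosh x := by
  have h1 : Real.cosh x = 1 + 2 * Real.sinh (x / 2) ^ 2 := by
    have := Real.cosh_two_mul (x / 2)
    rw [mul_div_cancel₀ x (by norm_num)] at this
    rw [this, Real.cosh_sq]; ring
  have h2 : (x / 2) ^ 2 ≤ Real.sinh (x / 2) ^ 2 := by
    rw [sq_le_sq]
    rw [Real.abs_sinh]
    exact Real.self_le_sinh_iff.2 (abs_nonneg _)
  rw [h1]; linarith

lemma bl_aux {p : Measure E} [IsProbabilityMeasure p] {u : E → ℝ} (hu : Measurable u) {M : ℝ}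
    (hM : ∀ᵐ x ∂p, |u x| ≤ M) (ε : ℝ) :
    1 + ε ^ 2 * (∫ x, u x ^ 2 ∂p - (∫ x, u x ∂p) ^ 2) ≤
      (∫ x, exp (ε * u x) ∂p) * (∫ x, exp (-(ε * u x)) ∂p) := by
  have hbd : ∀ φ : ℝ → ℝ, Continuous φ → Integrable (fun x => φ (u x)) p := by
    intro φ hφ
    obtain ⟨C, hC⟩ := (isCompact_Icc (a := -M) (b := M)).exists_bound_of_continuousOn hφ.continuousOn
    refine Integrable.of_bound (by have := hφ.measurable; fun_prop) C ?_
    filter_upwards [hM] with x hx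
    exact hC _ (abs_le.1 hx)
  have i1 := hbd (fun z => exp (ε * z)) (by fun_prop)
  have i2 := hbd (fun z => exp (-(ε * z))) (by fun_prop)
  have i3 := hbd (fun z => z) (by fun_prop)
  have i4 := hbd (fun z => z ^ 2) (by fun_prop)
  set m := ∫ x, u x ∂p
  set a := ∫ x, u x ^ 2 ∂p
  set A := ∫ x, exp (ε * u x) ∂p
  set B := ∫ x, exp (-(ε * u x)) ∂p
  have hin : ∀ y, 2 * (1 + ε ^ 2 / 2 * (a - 2 * u y * m + u y ^ 2)) ≤
      A * exp (-(ε * u y)) + B * exp (ε * u y) := by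
    intro y
    have e1 : ∫ x, (2 + ε ^ 2 * u x ^ 2 - 2 * ε ^ 2 * u y * u x + ε ^ 2 * u y ^ 2) ∂p =
       2 * (1 + ε ^ 2 / 2 * (a - 2 * u y * m + u y ^ 2)) := by
      rw [integral_add (by fun_prop) (by fun_prop), integral_sub (by fun_prop) (by fun_prop),
        integral_add (by fun_prop) (by fun_prop), integral_const_mul, integral_const_mul]
      simp; ring
    have e2 : ∫ x, (exp (ε * u x) * exp (-(ε * u y)) + exp (-(ε * u x)) * exp (ε * u y)) ∂p
      = A * exp (-(ε * u y)) + B * exp (ε * u y) := by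
      rw [integral_add (by fun_prop) (by fun_prop), integral_mul_const, integral_mul_const]
    rw [← e1, ← e2]
    refine integral_mono (by fun_prop) (by fun_prop) fun x => ?_
    simp only [← exp_add]
    have := cosh_ge (ε * (u x - u y))
    rw [Real.cosh_eq] at this
    rw [show ε * u x + -(ε * u y) = ε * (u x - u y) by ring,
      show -(ε * u x) + (ε * u y) = -(ε * (u x - u y)) by ring]
    linarith
  have := integral_mono (μ := p) (by fun_prop) (by fun_prop) hin
  rw [integral_add (by fun_prop) (by fun_prop), integral_const_mul, integral_const_mul,
    integral_const_mul] at this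
  rw [integral_add (by fun_prop) (by fun_prop), integral_const_mul, integral_add (by fun_prop) (by fun_prop),
    integral_sub (by fun_prop) (by fun_prop), integral_mul_const, integral_const_mul] at this
  simp at this
  change 2 * (1 + ε ^ 2 / 2 * (a - 2 * m * m + a)) ≤ A * B + B * A at this
  linarith

end

section


lemma lim_aux {V g c : ℝ} (hg : 0 ≤ g) (hc : 0 ≤ c)
    (h : ∀ ε : ℝ, 0 < ε → ε < 1 → ε * c < 1 → 1 + ε * V ≤ (1 + ε * g / 2 + ε ^ 2 * c) ^ 2) : V ≤ g := by
  by_contra! hV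
  set K := 2 * c + (g / 2 + c) ^ 2
  have hK : 0 ≤ K := by positivity
  set ε := min (1 / (2 * (c + 1))) ((V - g) / (2 * (K + 1) * (1 + (V - g)))) with hε
  have e0 : 0 < ε := lt_min (by positivity) (div_pos (by linarith) (by have : 0 < V - g := by linarith
                                                                       positivity))
  have e1 : ε ≤ 1 / (2 * (c + 1)) := min_le_left _ _
  have e2 : ε ≤ (V - g) / (2 * (K + 1) * (1 + (V - g))) := min_le_right _ _
  rw [le_div_iff₀ (by positivity)] at e1
  rw [le_div_iff₀ (by have : 0 < V - g := by linarith
                      positivity)] at e2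
  have e3 : ε < 1 := by nlinarith
  have e4 : ε * K < V - g := by
    have : 0 < V - g := by linarith
    have h1 : 0 ≤ ε * K * (V - g) := by positivity
    have h2 : 0 ≤ ε * (V - g) := by positivity
    linarith
  have := h ε e0 e3 (by linarith)
  have e5 : (1 + ε * g / 2 + ε ^ 2 * c) ^ 2 ≤ 1 + ε * g + ε ^ 2 * K := by
    have : ε * g / 2 + ε ^ 2 * c ≤ ε * (g / 2 + c) := by
      have : 0 ≤ ε * c * (1 - ε) := mul_nonneg (by positivity) (by linarith)
      linarith
    have h3 : 0 ≤ ε * g / 2 + ε ^ 2 * c := by positivity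
    have := pow_le_pow_left₀ h3 this 2
    simp only [K]; linarith
  nlinarith

lemma int_bdd {F : Type*} [NormedAddCommGroup F] {p : Measure E} [IsFiniteMeasure p] {f : E → F}
    (hf : AEStronglyMeasurable f p) {M : ℝ} (h : ∀ᵐ x ∂p, ‖f x‖ ≤ M) : Integrable f p :=
  Integrable.of_bound hf M h

lemma SLC.bl {p : Measure E} [IsProbabilityMeasure p] {t : ℝ} (ht : 0 < t) (hp : SLC t p) {u : E → ℝ} {G : E → E}
    (hu : Measurable u) (hG : Measurable G) {M B : ℝ} (hM : ∀ᵐ x ∂p, |u x| ≤ M) (hB : ∀ᵐ x ∂p, ‖G x‖ ≤ B)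
    (hT : ∀ x y, u x - u y = ⟪G ((1/2:ℝ) • (x + y)), x - y⟫) :
    ∫ x, u x ^ 2 ∂p - (∫ x, u x ∂p) ^ 2 ≤ (1 / t) * ∫ x, ‖G x‖ ^ 2 ∂p := by
  have iG : Integrable (fun x => ‖G x‖ ^ 2) p := by
    refine int_bdd (by fun_prop) (M := B ^ 2) ?_
    filter_upwards [hB] with x hx
    rw [norm_of_nonneg (by positivity)]; gcongr
  refine lim_aux (c := B ^ 2 / t + (B ^ 2 / (2 * t)) ^ 2)
    (mul_nonneg (by positivity) (integral_nonneg fun _ => by positivity)) (by positivity) fun ε e0 e1 e2 => ?_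
  have hs := sq_sqrt e0.le
  have h1 := bl_aux hu hM (Real.sqrt ε)
  rw [hs] at h1
  refine h1.trans ?_
  have iu : ∀ c : ℝ, Integrable (fun x => exp (c * u x)) p := fun c => by
    refine int_bdd (by fun_prop) (M := exp (|c| * M)) ?_
    filter_upwards [hM] with x hx
    rw [norm_of_nonneg (by positivity)]
    refine Real.exp_le_exp.2 ((le_abs_self _).trans ?_)
    rw [abs_mul]; gcongr
  have hexp := hp.exp_ineq hu hG (C := 0) (ε := Real.sqrt ε) (by positivity) (by simpa using ht)
    (fun x y => by simpa using (hT x y).le)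
  simp only [mul_zero, zero_mul, sub_zero, hs] at hexp
  have ie : Integrable (fun x => exp (ε / (2 * t) * ‖G x‖ ^ 2)) p := by
    refine int_bdd (by fun_prop) (M := exp (ε / (2 * t) * B ^ 2)) ?_
    filter_upwards [hB] with x hx
    rw [norm_of_nonneg (by positivity)]; gcongr
  have iu2 : Integrable (fun x => exp (-(Real.sqrt ε * u x))) p := by
    simpa only [neg_mul] using iu (-Real.sqrt ε)
  rw [← ofReal_integral_eq_lintegral_ofReal (iu _) (by filter_upwards with x; positivity),
    ← ofReal_integral_eq_lintegral_ofReal iu2 (by filter_upwards with x; positivity),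
    ← ofReal_integral_eq_lintegral_ofReal ie (by filter_upwards with x; positivity),
    ← ofReal_mul (integral_nonneg fun _ => by positivity), ← ENNReal.ofReal_pow (integral_nonneg fun _ => by positivity),
    ENNReal.ofReal_le_ofReal_iff (by positivity)] at hexp
  refine hexp.trans ?_
  refine pow_le_pow_left₀ (integral_nonneg fun _ => by positivity) ?_ 2
  have : ∫ x, exp (ε / (2 * t) * ‖G x‖ ^ 2) ∂p ≤
      ∫ x, (1 + ε / (2 * t) * ‖G x‖ ^ 2 + (ε / (2 * t) * B ^ 2) ^ 2) ∂p := by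
    refine integral_mono_ae ie (by fun_prop) ?_
    filter_upwards [hB] with x hx
    set y := ε / (2 * t) * ‖G x‖ ^ 2
    have y0 : 0 ≤ y := by positivity
    have y1 : y ≤ ε / (2 * t) * B ^ 2 := by simp only [y]; gcongr
    have y2 : ε / (2 * t) * B ^ 2 ≤ 1 := by
      have : ε / (2 * t) * B ^ 2 = ε * (B ^ 2 / t) / 2 := by field_simp
      have h3 : 0 ≤ ε * (B ^ 2 / (2 * t)) ^ 2 := by positivity
      rw [this]; linarith
    have h4 := Real.abs_exp_sub_one_sub_id_le (x := y) (by rw [abs_of_nonneg y0]; linarith)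
    have h5 := (abs_le.1 h4).2
    have : y ^ 2 ≤ (ε / (2 * t) * B ^ 2) ^ 2 := pow_le_pow_left₀ y0 y1 2
    linarith
  refine this.trans ?_
  rw [integral_add (by fun_prop) (by fun_prop), integral_add (by fun_prop) (by fun_prop), integral_const_mul]
  simp only [integral_const, probReal_univ, smul_eq_mul, one_mul]
  have h6 : ε ^ 2 * (B ^ 2 / t + (B ^ 2 / (2 * t)) ^ 2) = ε ^ 2 * (B ^ 2 / t) + (ε / (2 * t) * B ^ 2) ^ 2 := by
    field_simp
  have h7 : 0 ≤ ε ^ 2 * (B ^ 2 / t) := by positivity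
  rw [h6]
  have h8 : ε / (2 * t) * ∫ a, ‖G a‖ ^ 2 ∂p = ε * (1 / t * ∫ x, ‖G x‖ ^ 2 ∂p) / 2 := by field_simp
  linarith

end

section

variable {W : Type*} [NormedAddCommGroup W] [NormedSpace ℝ W] [CompleteSpace W]

/-- bounded support -/
def BS (μ : Measure E) (R : ℝ) : Prop := ∀ᵐ x ∂μ, ‖x‖ ≤ R

def exL (x : E) : (ℝ × E) →L[ℝ] ℝ :=
  (innerSL ℝ x).comp (ContinuousLinearMap.snd ℝ ℝ E) - (‖x‖ ^ 2 / 2) • ContinuousLinearMap.fst ℝ ℝ E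

lemma exL_apply (x : E) (q : ℝ × E) : exL x q = ⟪q.2, x⟫ - q.1 / 2 * ‖x‖ ^ 2 := by
  simp [exL, real_inner_comm]; ring

def tl (μ : Measure E) (q : ℝ × E) : Measure E := μ.tilted (fun x => exL x q)

def MM (μ : Measure E) (φ : E → W) (q : ℝ × E) : W := ∫ x, φ x ∂(tl μ q)

@[fun_prop]
lemma continuous_exL : Continuous (fun x : E => exL x) := by unfold exL; fun_prop

lemma BS.bdd {F : Type*} [NormedAddCommGroup F] {μ : Measure E} {R : ℝ} (h : BS μ R) {f : E → F} (hf : Continuous f) :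
    ∃ C, 0 ≤ C ∧ ∀ᵐ x ∂μ, ‖f x‖ ≤ C := by
  obtain ⟨C, hC⟩ := (isCompact_closedBall (0 : E) R).exists_bound_of_continuousOn hf.continuousOn
  refine ⟨max C 0, le_max_right _ _, ?_⟩
  filter_upwards [h] with x hx
  exact (hC x (by simpa using hx)).trans (le_max_left _ _)

lemma BS.int {F : Type*} [NormedAddCommGroup F] {μ : Measure E} [IsFiniteMeasure μ] {R : ℝ} (h : BS μ R) {f : E → F}
    (hf : Continuous f) : Integrable f μ := by
  obtain ⟨C, _, hC⟩ := h.bdd hf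
  exact Integrable.of_bound hf.aestronglyMeasurable C hC

lemma BS.int_exp {μ : Measure E} [IsFiniteMeasure μ] {R : ℝ} (h : BS μ R) (q : ℝ × E) :
    Integrable (fun x => exp (exL x q)) μ := h.int (by fun_prop)

lemma BS.tl {μ : Measure E} {R : ℝ} (h : BS μ R) (q : ℝ × E) : BS (tl μ q) R :=
  (tilted_absolutelyContinuous μ _).ae_le h

lemma BS.tl_prob {μ : Measure E} [IsProbabilityMeasure μ] {R : ℝ} (h : BS μ R) (q : ℝ × E) :
    IsProbabilityMeasure (_root_.tl μ q) := isProbabilityMeasure_tilted (h.int_exp q)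

lemma BS.tl_tl {μ : Measure E} [IsProbabilityMeasure μ] {R : ℝ} (h : BS μ R) (q q' : ℝ × E) :
    _root_.tl (_root_.tl μ q) q' = _root_.tl μ (q + q') := by
  unfold _root_.tl
  rw [tilted_tilted (h.int_exp q)]
  congr 1; ext x; simp

lemma MM_eq (μ : Measure E) (φ : E → W) (q : ℝ × E) :
    MM μ φ q = (∫ x, exp (exL x q) ∂μ)⁻¹ • ∫ x, exp (exL x q) • φ x ∂μ := by
  rw [MM, tl, integral_tilted, ← integral_smul]
  congr 1; ext x; rw [smul_smul]; congr 1; ring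

lemma BS.Zpos {μ : Measure E} [IsProbabilityMeasure μ] {R : ℝ} (h : BS μ R) (q : ℝ × E) :
    0 < ∫ x, exp (exL x q) ∂μ := integral_exp_pos (h.int_exp q)

lemma hasFDerivAt_N {μ : Measure E} [IsProbabilityMeasure μ] {R : ℝ} (h : BS μ R) {φ : E → W} (hφ : Continuous φ)
    (q : ℝ × E) : HasFDerivAt (fun q => ∫ x, exp (exL x q) • φ x ∂μ)
      (∫ x, exp (exL x q) • (exL x).smulRight (φ x) ∂μ) q := by
  obtain ⟨C, hC0, hC⟩ := h.bdd (f := fun x => exL x) (by fun_prop)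
  obtain ⟨D, hD0, hD⟩ := h.bdd hφ
  have c1 : ∀ q : ℝ × E, Continuous fun x => exp (exL x q) • φ x := fun q => by fun_prop
  have c2 : ∀ q : ℝ × E, Continuous fun x => exp (exL x q) • (exL x).smulRight (φ x) := fun q => by
    refine Continuous.smul (Real.continuous_exp.comp (continuous_exL.clm_apply continuous_const)) ?_
    exact (ContinuousLinearMap.smulRightL ℝ (ℝ × E) W).continuous₂.comp (continuous_exL.prodMk hφ)
  refine hasFDerivAt_integral_of_dominated_of_fderiv_le (F := fun q x => exp (exL x q) • φ x)
    (F' := fun q x => exp (exL x q) • (exL x).smulRight (φ x)) (s := Metric.ball q 1)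
    (bound := fun _ => exp (C * (‖q‖ + 1)) * (C * D)) (Metric.ball_mem_nhds _ one_pos) ?_ ?_ ?_ ?_ ?_ ?_
  · exact of_forall fun q => (c1 q).aestronglyMeasurable
  · exact h.int (c1 q)
  · exact (h.int (c2 q)).aestronglyMeasurable
  · filter_upwards [hC, hD] with x h1 h2 q' hq'
    rw [norm_smul, norm_of_nonneg (by positivity)]
    gcongr
    · calc exL x q' ≤ ‖exL x q'‖ := Real.le_norm_self _
        _ ≤ ‖exL x‖ * ‖q'‖ := ContinuousLinearMap.le_opNorm _ _
        _ ≤ _ := by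
          gcongr
          have := norm_le_norm_add_norm_sub' q' q
          rw [mem_ball_iff_norm] at hq'
          linarith
    · rw [ContinuousLinearMap.norm_smulRight_apply]; gcongr
  · exact integrable_const _
  · filter_upwards with x q' _
    have h1 : HasFDerivAt (fun q => exp (exL x q)) (exp (exL x q') • exL x) q' :=
      (exL x).hasFDerivAt.exp
    have h2 := h1.smul_const (φ x)
    refine h2.congr_fderiv ?_
    refine ContinuousLinearMap.ext fun v => ?_
    simp [smul_smul]

/-- covariance under the tilted measure -/
def cv (μ : Measure E) (q : ℝ × E) (f : E → ℝ) (φ : E → W) : W :=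
  MM μ (fun x => f x • φ x) q - MM μ f q • MM μ φ q

lemma hasFDerivAt_MM {μ : Measure E} [IsProbabilityMeasure μ] {R : ℝ} (h : BS μ R) {φ : E → W} (hφ : Continuous φ)
    (q : ℝ × E) : ∃ L : (ℝ × E) →L[ℝ] W, HasFDerivAt (MM μ φ) L q ∧ ∀ v, L v = cv μ q (fun x => exL x v) φ := by
  have h1 := hasFDerivAt_N h hφ q
  have h2 := hasFDerivAt_N h (φ := fun _ => (1:ℝ)) continuous_const q
  simp only [smul_eq_mul, mul_one] at h2
  have hZ := h.Zpos q
  have h3 := ((hasFDerivAt_inv hZ.ne').comp q h2).smul h1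
  refine ⟨_, h3.congr_of_eventuallyEq (of_forall fun q => MM_eq μ φ q), fun v => ?_⟩
  have c2 : ∀ q : ℝ × E, Continuous fun x => exp (exL x q) • (exL x).smulRight (φ x) := fun q => by
    refine Continuous.smul (Real.continuous_exp.comp (continuous_exL.clm_apply continuous_const)) ?_
    exact (ContinuousLinearMap.smulRightL ℝ (ℝ × E) W).continuous₂.comp (continuous_exL.prodMk hφ)
  have c3 : ∀ q : ℝ × E, Continuous fun x => exp (exL x q) • (exL x).smulRight (1:ℝ) := fun q => by
    refine Continuous.smul (Real.continuous_exp.comp (continuous_exL.clm_apply continuous_const)) ?_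
    exact (ContinuousLinearMap.smulRightL ℝ (ℝ × E) ℝ).continuous₂.comp (continuous_exL.prodMk continuous_const)
  simp only [_root_.add_apply, _root_.smul_apply, ContinuousLinearMap.smulRight_apply,
    ContinuousLinearMap.comp_apply, Function.comp]
  rw [ContinuousLinearMap.integral_apply (h.int (c2 q)), ContinuousLinearMap.integral_apply (h.int (c3 q))]
  simp only [_root_.smul_apply, ContinuousLinearMap.smulRight_apply, smul_eq_mul, mul_one, cv, MM_eq]
  set Z := ∫ x, exp (exL x q) ∂μ
  rw [sub_eq_add_neg]
  congr 1
  simp only [smul_smul, ← neg_smul]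
  congr 1
  simp
  field_simp

end

section


lemma int_gauss {b : ℝ} (hb : 0 < b) : Integrable (fun x : E => exp (-b * ‖x‖ ^ 2)) := by
  have h := (GaussianFourier.integrable_cexp_neg_mul_sq_norm_add (b := (b:ℂ)) (by simpa using hb) 0 (0:E)).re
  refine h.congr (of_forall fun x => ?_)
  simp only [zero_mul, add_zero]
  have : (-(b:ℂ) * (‖x‖:ℂ) ^ 2) = ((-b * ‖x‖ ^ 2 : ℝ) : ℂ) := by push_cast; ring
  rw [this, ← Complex.ofReal_exp]; rfl

variable (E) in
/-- standard gaussian -/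
def ga : Measure E := volume.tilted (fun x => -(1/2:ℝ) * ‖x‖ ^ 2)

instance ga_prob : IsProbabilityMeasure (ga E) := isProbabilityMeasure_tilted (int_gauss (by norm_num))

lemma ga_int_exp (c : ℝ) : Integrable (fun g : E => exp (c * ‖g‖)) (ga E) := by
  rw [ga, integrable_tilted_iff (int_gauss (by norm_num))]
  refine Integrable.mono' ((int_gauss (E := E) (b := 1/4) (by norm_num)).const_mul (exp (c ^ 2)))
    (by fun_prop) (of_forall fun x => ?_)
  rw [smul_eq_mul, norm_of_nonneg (by positivity), ← exp_add, ← exp_add]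
  refine Real.exp_le_exp.mpr ?_
  linarith [sq_nonneg (c - ‖x‖ / 2)]

/-- exponentially bounded -/
def EB (F : E → ℝ) : Prop := ∃ C c : ℝ, 0 ≤ C ∧ 0 ≤ c ∧ ∀ g, |F g| ≤ C * exp (c * ‖g‖)

lemma EB.int {F : E → ℝ} (h : EB F) (hF : Measurable F) : Integrable F (ga E) := by
  obtain ⟨C, c, _, _, hC⟩ := h
  exact Integrable.mono' ((ga_int_exp c).const_mul C) hF.aestronglyMeasurable (of_forall hC)

lemma EB.mul {F G : E → ℝ} (h : EB F) (h' : EB G) : EB (fun g => F g * G g) := by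
  obtain ⟨C, c, hC, hc, h1⟩ := h
  obtain ⟨D, d, hD, hd, h2⟩ := h'
  refine ⟨C * D, c + d, by positivity, by positivity, fun g => ?_⟩
  rw [abs_mul, add_mul, exp_add]
  calc _ ≤ (C * exp (c * ‖g‖)) * (D * exp (d * ‖g‖)) := by gcongr; exacts [h1 g, h2 g]
    _ = _ := by ring

lemma EB.inner (v : E) : EB (fun g => ⟪g, v⟫) := by
  refine ⟨‖v‖, 1, norm_nonneg _, zero_le_one, fun g => ?_⟩
  calc _ ≤ ‖g‖ * ‖v‖ := abs_real_inner_le_norm _ _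
    _ ≤ _ := by
      rw [mul_comm, one_mul]; gcongr; linarith [Real.add_one_le_exp ‖g‖]

lemma ga_ibp {H H' : E → ℝ} {v : E} (hH : EB H) (hH' : EB H') (mH : Measurable H) (mH' : Measurable H')
    (h : ∀ x, HasLineDerivAt ℝ H (H' x) x v) : ∫ g, H' g ∂(ga E) = ∫ g, ⟪g, v⟫ * H g ∂(ga E) := by
  have i1 := hH'.int mH'
  have i2 := ((EB.inner v).mul hH).int ((by fun_prop : Measurable fun g : E => ⟪g, v⟫).mul mH)
  have i3 := hH.int mH
  rw [ga, integrable_tilted_iff (int_gauss (by norm_num))] at i1 i2 i3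
  rw [ga, integral_tilted, integral_tilted]
  set Z := ∫ x : E, exp (-(1/2:ℝ) * ‖x‖ ^ 2)
  have key := integral_bilinear_hasLineDerivAt_right_eq_neg_left_of_integrable (μ := (volume : Measure E))
    (f := fun x : E => exp (-(1/2:ℝ) * ‖x‖ ^ 2))
    (f' := fun x : E => -(⟪x, v⟫ * exp (-(1/2:ℝ) * ‖x‖ ^ 2))) (g := H) (g' := H') (v := v)
    (B := ContinuousLinearMap.mul ℝ ℝ) (by
      refine i2.neg.congr (of_forall fun x => ?_)
      simp; ring) (by simpa using i1) (by simpa using i3) ?_ (fun x _ => h x)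
  · simp only [ContinuousLinearMap.mul_apply'] at key
    have e1 : ∀ x : E, (exp (-(1/2:ℝ) * ‖x‖ ^ 2) / Z) • H' x
      = Z⁻¹ * (exp (-(1/2:ℝ) * ‖x‖ ^ 2) * H' x) := fun x => by rw [smul_eq_mul]; ring
    have e2 : ∀ x : E, (exp (-(1/2:ℝ) * ‖x‖ ^ 2) / Z) • (⟪x, v⟫ * H x)
      = - (Z⁻¹ * (-(⟪x, v⟫ * exp (-(1/2:ℝ) * ‖x‖ ^ 2)) * H x)) := fun x => by rw [smul_eq_mul]; ring
    simp only [e1, e2, integral_neg, integral_const_mul, key]; ring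
  · intro x _
    have h1 : HasFDerivAt (fun x : E => -(1/2:ℝ) * ‖x‖ ^ 2) (-(1/2:ℝ) • (2 • (innerSL ℝ x))) x :=
      ((hasStrictFDerivAt_norm_sq x).hasFDerivAt).const_mul _
    have h2 := (h1.exp).hasLineDerivAt v
    convert h2 using 1
    simp; ring

lemma ga_charFun (t : E) : charFun (ga E) t = Complex.exp (-(‖t‖:ℂ) ^ 2 / 2) := by
  rw [charFun_apply, ga, integral_tilted]
  have h1 := GaussianFourier.integral_cexp_neg_mul_sq_norm_add (b := (1/2:ℂ)) (by norm_num) Complex.I t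
  have h0 := GaussianFourier.integral_cexp_neg_mul_sq_norm (V := E) (b := (1/2:ℂ)) (by norm_num)
  have hZ : ((∫ x : E, exp (-(1/2:ℝ) * ‖x‖ ^ 2) : ℝ) : ℂ) = ∫ x : E, Complex.exp (-(1/2:ℂ) * (‖x‖:ℂ) ^ 2) := by
    rw [← integral_complex_ofReal]; congr 1; ext x; push_cast; rfl
  have hp : 0 < ∫ x : E, exp (-(1/2:ℝ) * ‖x‖ ^ 2) := integral_exp_pos (int_gauss (by norm_num))
  set Z := ∫ x : E, exp (-(1/2:ℝ) * ‖x‖ ^ 2)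
  have : ∀ x : E, (exp (-(1/2:ℝ) * ‖x‖ ^ 2) / Z) • Complex.exp (⟪x, t⟫ * Complex.I)
      = (Z:ℂ)⁻¹ * Complex.exp (-(1/2:ℂ) * (‖x‖:ℂ) ^ 2 + Complex.I * ⟪t, x⟫) := fun x => by
    rw [Complex.exp_add, Complex.real_smul, real_inner_comm]; push_cast; ring_nf
  simp only [this]
  rw [integral_const_mul, h1, ← h0, ← hZ, ← mul_assoc, inv_mul_cancel₀ (by exact_mod_cast hp.ne'), one_mul]
  congr 1; rw [Complex.I_sq]; ring

lemma ga_conv {a b c : ℝ} (hc : a ^ 2 + b ^ 2 = c ^ 2) :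
    ((ga E).prod (ga E)).map (fun p => a • p.1 + b • p.2) = (ga E).map (fun g => c • g) := by
  have : IsProbabilityMeasure (((ga E).prod (ga E)).map (fun p => a • p.1 + b • p.2)) :=
    Measure.isProbabilityMeasure_map (by fun_prop)
  have : IsProbabilityMeasure ((ga E).map (fun g => c • g)) := Measure.isProbabilityMeasure_map (by fun_prop)
  refine Measure.ext_of_charFun (funext fun t => ?_)
  rw [charFun_map_smul, ga_charFun, charFun_apply, integral_map (by fun_prop) (by fun_prop)]
  have : ∀ p : E × E, Complex.exp (⟪a • p.1 + b • p.2, t⟫ * Complex.I)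
    = Complex.exp (⟪p.1, a • t⟫ * Complex.I) * Complex.exp (⟪p.2, b • t⟫ * Complex.I) := fun p => by
    rw [← Complex.exp_add, inner_add_left, real_inner_smul_left, real_inner_smul_left, real_inner_smul_right,
      real_inner_smul_right]; push_cast; ring_nf
  simp only [this]
  rw [integral_prod_mul (fun x => Complex.exp (⟪x, a • t⟫ * Complex.I))
    (fun x => Complex.exp (⟪x, b • t⟫ * Complex.I)), ← charFun_apply, ← charFun_apply, ga_charFun, ga_charFun,
    ← Complex.exp_add]
  congr 1
  simp only [norm_smul, Real.norm_eq_abs]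
  norm_cast
  rw [← add_div, mul_pow, mul_pow, mul_pow, sq_abs, sq_abs, sq_abs, ← hc]; ring

end

section


/-- growth bound -/
def GB {V : Type*} [Norm V] (F : ℝ × E → V) : Prop := ∀ T : ℝ, ∃ C c : ℝ, 0 ≤ C ∧ 0 ≤ c ∧
  ∀ q : ℝ × E, 0 ≤ q.1 → q.1 ≤ T → ‖F q‖ ≤ C * exp (c * ‖q.2‖)

lemma GB.dom {V : Type*} [Norm V] {F : ℝ × E → V} (h : GB F) (T : ℝ) : ∃ C c : ℝ, 0 ≤ C ∧ 0 ≤ c ∧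
    ∀ t, 0 ≤ t → t ≤ T → ∀ g : E, ‖F (t, √t • g)‖ ≤ C * exp (c * ‖g‖) := by
  obtain ⟨C, c, hC, hc, h⟩ := h T
  refine ⟨C, c * √T, hC, by positivity, fun t ht hT g => (h (t, √t • g) ht hT).trans ?_⟩
  rw [norm_smul, norm_of_nonneg (Real.sqrt_nonneg _), ← mul_assoc]
  gcongr

lemma GB.EB {F : ℝ × E → ℝ} (h : GB F) {t : ℝ} (ht : 0 ≤ t) : EB (fun g => F (t, √t • g)) := by
  obtain ⟨C, c, hC, hc, h⟩ := h.dom t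
  exact ⟨C, c, hC, hc, fun g => h t ht le_rfl g⟩

lemma GB.int {F : ℝ × E → ℝ} (h : GB F) (hF : Continuous F) {t : ℝ} (ht : 0 ≤ t) :
    Integrable (fun g => F (t, √t • g)) (ga E) := (h.EB ht).int (by fun_prop)

lemma GB.contOn {F : ℝ × E → ℝ} (h : GB F) (hF : Continuous F) :
    ContinuousOn (fun t => ∫ g, F (t, √t • g) ∂(ga E)) (Ici 0) := by
  intro t ht
  obtain ⟨C, c, hC, hc, h⟩ := h.dom (t + 1)
  refine continuousWithinAt_of_dominated (bound := fun g => C * exp (c * ‖g‖)) ?_ ?_ ?_ ?_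
  · exact of_forall fun t => by fun_prop
  · filter_upwards [self_mem_nhdsWithin, mem_nhdsWithin_of_mem_nhds (Iio_mem_nhds (lt_add_one t))] with s hs hs'
    exact of_forall fun g => h s hs (le_of_lt hs') g
  · exact (ga_int_exp c).const_mul C
  · exact of_forall fun g => by fun_prop

lemma heat {ι : Type*} [Fintype ι] (e : OrthonormalBasis ι ℝ E) {U : ℝ × E → ℝ} {U' : ℝ × E → (ℝ × E) →L[ℝ] ℝ}
    {U2 : ι → ℝ × E → ℝ} (h1 : ∀ q, HasFDerivAt U (U' q) q)
    (h2 : ∀ i q, HasDerivAt (fun r : ℝ => U' (q + r • ((0:ℝ), e i)) (0, e i)) (U2 i q) 0)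
    (c1 : Continuous U') (c2 : ∀ i, Continuous (U2 i)) (b0 : GB U) (b1 : GB U') (b2 : ∀ i, GB (U2 i))
    {t : ℝ} (ht : 0 < t) :
    HasDerivAt (fun t => ∫ g, U (t, √t • g) ∂(ga E))
      (∫ g, (U' (t, √t • g) (1, 0) + (1/2) * ∑ i, U2 i (t, √t • g)) ∂(ga E)) t := by
  have c0 : Continuous U := continuous_iff_continuousAt.2 fun q => (h1 q).continuousAt
  obtain ⟨C, c, hC, hc, hb⟩ := b1.dom (t + 1)
  have st : 0 < √t := Real.sqrt_pos.2 ht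
  have key := hasDerivAt_integral_of_dominated_loc_of_deriv_le (μ := ga E) (F := fun t g => U (t, √t • g))
    (F' := fun t g => U' (t, √t • g) (1, (1 / (2 * √t)) • g)) (x₀ := t) (s := Ioo (t/2) (t+1))
    (bound := fun g => (C * (1 + 1 / (2 * √(t/2)))) * exp ((c + 1) * ‖g‖))
    (Ioo_mem_nhds (by linarith) (by linarith)) (of_forall fun t => by fun_prop)
    (b0.int c0 ht.le) (by
      refine Continuous.aestronglyMeasurable ?_
      exact (c1.comp (by fun_prop)).clm_apply (by fun_prop))
    (of_forall fun g s hs => ?_) ((ga_int_exp _).const_mul _)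
    (of_forall fun g s hs => ?_)
  · refine key.2.congr_deriv (Eq.symm ?_)
    have i1 : Integrable (fun g => U' (t, √t • g) (1, 0)) (ga E) := by
      refine Integrable.mono' ((ga_int_exp c).const_mul C) ?_ (of_forall fun g => ?_)
      · exact ((c1.comp (by fun_prop : Continuous fun g : E => (t, √t • g))).clm_apply
          continuous_const).aestronglyMeasurable
      · refine ((U' (t, √t • g)).le_opNorm _).trans ?_
        have : ‖((1:ℝ), (0:E))‖ = 1 := by simp [Prod.norm_def]
        rw [this, mul_one]; exact hb t ht.le (by linarith) g
    have eb : ∀ i, EB (fun g => U' (t, √t • g) (0, e i)) := fun i => by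
      refine ⟨C, c, hC, hc, fun g => ?_⟩
      refine ((U' (t, √t • g)).le_opNorm _).trans ?_
      have : ‖((0:ℝ), e i)‖ = 1 := by simp [Prod.norm_def]
      rw [this, mul_one]; exact hb t ht.le (by linarith) g
    have mb : ∀ i, Continuous (fun g => U' (t, √t • g) (0, e i)) := fun i =>
      (c1.comp (by fun_prop : Continuous fun g : E => (t, √t • g))).clm_apply continuous_const
    have i2 : ∀ i, Integrable (fun g => U2 i (t, √t • g)) (ga E) := fun i => (b2 i).int (c2 i) ht.le
    have i3 : ∀ i, Integrable (fun g => ⟪g, e i⟫ * U' (t, √t • g) (0, e i)) (ga E) := fun i =>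
      ((EB.inner (e i)).mul (eb i)).int ((by fun_prop : Measurable fun g : E => ⟪g, e i⟫).mul (mb i).measurable)
    have dec : ∀ g : E, U' (t, √t • g) (1, (1 / (2 * √t)) • g)
        = U' (t, √t • g) (1, 0) + ∑ i, (1 / (2 * √t)) * (⟪g, e i⟫ * U' (t, √t • g) (0, e i)) := fun g => by
      have : ((1:ℝ), (1 / (2 * √t)) • g) = (1, 0) + ∑ i, ((1 / (2 * √t)) * ⟪g, e i⟫) • ((0:ℝ), e i) := by
        have h0 : g = ∑ i, ⟪g, e i⟫ • e i := by
          conv_lhs => rw [← e.sum_repr g]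
          congr 1; ext i; rw [e.repr_apply_apply, real_inner_comm]
        ext1
        · simp [Prod.fst_sum]
        · simp only [Prod.snd_add, Prod.snd_sum, Prod.smul_snd, zero_add, mul_smul, ← Finset.smul_sum]
          rw [← h0]
      rw [this, map_add, map_sum]
      congr 1; refine sum_congr rfl fun i _ => ?_
      rw [map_smul, smul_eq_mul]; ring
    change _ = ∫ g, U' (t, √t • g) (1, (1 / (2 * √t)) • g) ∂(ga E)
    simp only [dec]
    rw [integral_add i1 ((integrable_finsetSum _ fun i _ => i2 i).const_mul _),
      integral_add i1 (integrable_finsetSum _ fun i _ => (i3 i).const_mul _), integral_const_mul,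
      integral_finsetSum _ fun i _ => i2 i, integral_finsetSum _ fun i _ => (i3 i).const_mul _, mul_sum]
    congr 1
    refine sum_congr rfl fun i _ => ?_
    rw [integral_const_mul, ← ga_ibp (H' := fun g => √t * U2 i (t, √t • g)) (eb i) ?_ (mb i).measurable
      (by have := c2 i; fun_prop) ?_, integral_const_mul]
    · field_simp
    · refine EB.mul ⟨√t, 0, st.le, le_rfl, fun g => ?_⟩ ((b2 i).EB ht.le)
      simp [abs_of_pos st]
    · intro g
      have := h2 i (t, √t • g)
      unfold HasLineDerivAt
      have h3 : HasDerivAt (fun r : ℝ => √t * r) √t 0 := by simpa using (hasDerivAt_id (0:ℝ)).const_mul √t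
      have h4 := HasDerivAt.comp_of_eq (h₂ := fun r : ℝ => U' ((t, √t • g) + r • ((0:ℝ), e i)) (0, e i))
        (0:ℝ) this h3 (by simp)
      rw [mul_comm]
      refine h4.congr_of_eventuallyEq (of_forall fun r => ?_)
      simp [smul_add, smul_smul]
  · rw [mem_Ioo] at hs
    have s0 : 0 < √(t/2) := Real.sqrt_pos.2 (by linarith)
    refine ((U' (s, √s • g)).le_opNorm _).trans ?_
    calc _ ≤ (C * exp (c * ‖g‖)) * (1 + (1 / (2 * √(t/2))) * ‖g‖) := by
          gcongr
          · exact hb s (by linarith) (by linarith) g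
          · rw [Prod.norm_def, norm_smul, norm_one, norm_of_nonneg (by positivity)]
            refine max_le (by linarith [show 0 ≤ (1 / (2 * √(t/2))) * ‖g‖ by positivity]) ?_
            have : (1 / (2 * √s)) * ‖g‖ ≤ (1 / (2 * √(t/2))) * ‖g‖ := by
              gcongr; linarith
            linarith
      _ ≤ _ := by
        rw [add_mul, exp_add, one_mul]
        have e1 : 1 + (1 / (2 * √(t/2))) * ‖g‖ ≤ (1 + 1 / (2 * √(t/2))) * exp ‖g‖ := by
          have := Real.add_one_le_exp ‖g‖
          rw [add_mul]; gcongr <;> linarith [norm_nonneg g]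
        calc _ ≤ (C * exp (c * ‖g‖)) * ((1 + 1 / (2 * √(t/2))) * exp ‖g‖) := by gcongr
          _ = _ := by ring
  · rw [mem_Ioo] at hs
    have s0 : s ≠ 0 := by linarith
    have p1 : HasDerivAt (fun t : ℝ => (t, √t • g)) (1, (1 / (2 * √s)) • g) s :=
      (hasDerivAt_id s).prodMk ((Real.hasDerivAt_sqrt s0).smul_const g)
    exact (h1 (s, √s • g)).comp_hasDerivAt s p1

end

section

variable {W : Type*} [NormedAddCommGroup W] [NormedSpace ℝ W] [FiniteDimensional ℝ W]

def NN (μ : Measure E) (φ : E → W) (q : ℝ × E) : W := ∫ x, exp (exL x q) • φ x ∂μ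

def Zq (μ : Measure E) (q : ℝ × E) : ℝ := ∫ x, exp (exL x q) ∂μ

def EE (μ : Measure E) (t : ℝ) (F : ℝ × E → ℝ) : ℝ := ∫ g, Zq μ (t, √t • g) * F (t, √t • g) ∂(ga E)

variable {μ : Measure E} [IsProbabilityMeasure μ] {R : ℝ}

lemma BS.int_smul (h : BS μ R) {φ : E → W} (hφ : Continuous φ) (q : ℝ × E) :
    Integrable (fun x => exp (exL x q) • φ x) μ := h.int (by fun_prop)

lemma cont_sR {φ : E → W} (hφ : Continuous φ) : Continuous (fun x => (exL x).smulRight (φ x)) :=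
  (ContinuousLinearMap.smulRightL ℝ (ℝ × E) W).continuous₂.comp (continuous_exL.prodMk hφ)

lemma fd_NN (h : BS μ R) {φ : E → W} (hφ : Continuous φ) (q : ℝ × E) :
    HasFDerivAt (NN μ φ) (NN μ (fun x => (exL x).smulRight (φ x)) q) q := by
  have : CompleteSpace W := FiniteDimensional.complete ℝ W
  exact hasFDerivAt_N h hφ q

lemma cont_NN (h : BS μ R) {φ : E → W} (hφ : Continuous φ) : Continuous (NN μ φ) :=
  continuous_iff_continuousAt.2 fun q => (fd_NN h hφ q).continuousAt

lemma NN_apply (h : BS μ R) {φ : E → W} (hφ : Continuous φ) (q v : ℝ × E) :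
    NN μ (fun x => (exL x).smulRight (φ x)) q v = NN μ (fun x => exL x v • φ x) q := by
  unfold NN
  rw [ContinuousLinearMap.integral_apply (h.int_smul (cont_sR hφ) q)]
  rfl

lemma ld_NN (h : BS μ R) {φ : E → W} (hφ : Continuous φ) (q v : ℝ × E) :
    HasDerivAt (fun r : ℝ => NN μ φ (q + r • v)) (NN μ (fun x => exL x v • φ x) q) 0 := by
  rw [← NN_apply h hφ]
  exact (fd_NN h hφ q).hasLineDerivAt v

lemma Zq_eq : Zq μ = NN μ (fun _ => (1:ℝ)) := by ext q; simp [Zq, NN]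

lemma Zq_pos (h : BS μ R) (q : ℝ × E) : 0 < Zq μ q := h.Zpos q

lemma MM_NN (φ : E → W) (q : ℝ × E) : MM μ φ q = (Zq μ q)⁻¹ • NN μ φ q := MM_eq μ φ q

lemma NN_MM (h : BS μ R) (φ : E → W) (q : ℝ × E) : NN μ φ q = Zq μ q • MM μ φ q := by
  rw [MM_NN, smul_inv_smul₀ (Zq_pos h q).ne']

lemma cont_Zq (h : BS μ R) : Continuous (Zq μ) := by rw [Zq_eq]; exact cont_NN h continuous_const

lemma cont_MM (h : BS μ R) {φ : E → W} (hφ : Continuous φ) : Continuous (MM μ φ) := by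
  have : MM μ φ = fun q => (Zq μ q)⁻¹ • NN μ φ q := funext fun q => MM_NN φ q
  rw [this]
  exact ((cont_Zq h).inv₀ fun q => (Zq_pos h q).ne').smul (cont_NN h hφ)

lemma bdd_MM (h : BS μ R) {φ : E → W} (hφ : Continuous φ) : ∃ D, 0 ≤ D ∧ ∀ q, ‖MM μ φ q‖ ≤ D := by
  obtain ⟨D, hD0, hD⟩ := h.bdd hφ
  refine ⟨D, hD0, fun q => ?_⟩
  have := h.tl_prob q
  have h1 : ∀ᵐ x ∂(tl μ q), ‖φ x‖ ≤ D := (tilted_absolutelyContinuous μ _).ae_le hD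
  simpa [MM] using norm_integral_le_of_norm_le_const h1

lemma GB_Zq (h : BS μ R) : GB (Zq μ) := by
  refine fun T => ⟨1, |R|, zero_le_one, abs_nonneg _, fun q h0 _ => ?_⟩
  rw [norm_of_nonneg (Zq_pos h q).le, one_mul]
  have : ∀ᵐ x ∂μ, ‖exp (exL x q)‖ ≤ exp (|R| * ‖q.2‖) := by
    filter_upwards [h] with x hx
    rw [norm_of_nonneg (by positivity), Real.exp_le_exp, exL_apply]
    have h1 := real_inner_le_norm q.2 x
    have h2 : ‖q.2‖ * ‖x‖ ≤ ‖q.2‖ * |R| := by gcongr; exact hx.trans (le_abs_self R)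
    have h3 : 0 ≤ q.1 / 2 * ‖x‖ ^ 2 := by positivity
    linarith
  have h2 := norm_integral_le_of_norm_le_const this
  simp only [probReal_univ, mul_one] at h2
  exact (Real.le_norm_self _).trans h2

lemma GB_of_le (h : BS μ R) {V : Type*} [Norm V] {F : ℝ × E → V} {D : ℝ} (hD : 0 ≤ D)
    (hF : ∀ q, ‖F q‖ ≤ D * Zq μ q) : GB F := by
  intro T
  obtain ⟨C, c, hC, hc, h1⟩ := GB_Zq h T
  refine ⟨D * C, c, by positivity, hc, fun q h0 hT => (hF q).trans ?_⟩
  rw [mul_assoc]; gcongr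
  exact (Real.le_norm_self _).trans (h1 q h0 hT)

lemma GB_ZF (h : BS μ R) {F : ℝ × E → ℝ} {D : ℝ} (hF : ∀ q, |F q| ≤ D) : GB (fun q => Zq μ q * F q) := by
  refine GB_of_le h ((abs_nonneg _).trans (hF 0)) fun q => ?_
  rw [norm_mul, norm_of_nonneg (Zq_pos h q).le, mul_comm]
  exact mul_le_mul_of_nonneg_right (hF q) (Zq_pos h q).le

lemma EE_contOn (h : BS μ R) {F : ℝ × E → ℝ} {D : ℝ} (hF : ∀ q, |F q| ≤ D) (cF : Continuous F) :
    ContinuousOn (fun t => EE μ t F) (Ici 0) := (GB_ZF h hF).contOn ((cont_Zq h).mul cF)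

lemma EE_int (h : BS μ R) {F : ℝ × E → ℝ} {D : ℝ} (hF : ∀ q, |F q| ≤ D) (cF : Continuous F) {t : ℝ} (ht : 0 ≤ t) :
    Integrable (fun g => Zq μ (t, √t • g) * F (t, √t • g)) (ga E) :=
  (GB_ZF h hF).int ((cont_Zq h).mul cF) ht

lemma cont_bdd {V : Type*} [NormedAddCommGroup V] {f : W → V} (hf : Continuous f) (D : ℝ) :
    ∃ C, 0 ≤ C ∧ ∀ w, ‖w‖ ≤ D → ‖f w‖ ≤ C := by
  have : ProperSpace W := FiniteDimensional.proper ℝ W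
  obtain ⟨C, hC⟩ := (isCompact_closedBall (0 : W) D).exists_bound_of_continuousOn hf.continuousOn
  exact ⟨max C 0, le_max_right _ _, fun w hw => (hC w (by simpa using hw)).trans (le_max_left _ _)⟩

def itoD {ι : Type*} [Fintype ι] (μ : Measure E) (e : OrthonormalBasis ι ℝ E) (φ : E → W) (Φ : W → ℝ) (q : ℝ × E) : ℝ :=
  (1/2) * ∑ i, fderiv ℝ (fderiv ℝ Φ) (MM μ φ q) (cv μ q (fun x => exL x (0, e i)) φ) (cv μ q (fun x => exL x (0, e i)) φ)

lemma cont_cv (h : BS μ R) {f : E → ℝ} {φ : E → W} (hf : Continuous f) (hφ : Continuous φ) :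
    Continuous (fun q => cv μ q f φ) :=
  (cont_MM h (hf.smul hφ)).sub ((cont_MM h hf).smul (cont_MM h hφ))

lemma bdd_cv (h : BS μ R) {f : E → ℝ} {φ : E → W} (hf : Continuous f) (hφ : Continuous φ) :
    ∃ D, 0 ≤ D ∧ ∀ q, ‖cv μ q f φ‖ ≤ D := by
  obtain ⟨D1, p1, h1⟩ := bdd_MM h (hf.smul hφ)
  obtain ⟨D2, p2, h2⟩ := bdd_MM h hf
  obtain ⟨D3, p3, h3⟩ := bdd_MM h hφ
  refine ⟨D1 + D2 * D3, by positivity, fun q => (norm_sub_le _ _).trans ?_⟩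
  rw [norm_smul]; gcongr; exacts [h1 q, h2 q, h3 q]

lemma itoD_cont (h : BS μ R) {ι : Type*} [Fintype ι] (e : OrthonormalBasis ι ℝ E) {φ : E → W} (hφ : Continuous φ)
    {Φ : W → ℝ} (hΦ : ContDiff ℝ 2 Φ) : Continuous (itoD μ e φ Φ) := by
  have d1 : ContDiff ℝ 1 (fderiv ℝ Φ) := hΦ.fderiv_right (by norm_num)
  have d2 : Continuous (fderiv ℝ (fderiv ℝ Φ)) := d1.continuous_fderiv (by norm_num)
  have c1 := cont_MM h hφ
  have c2 : ∀ i, Continuous (fun q => cv μ q (fun x => exL x (0, e i)) φ) := fun i => cont_cv h (by fun_prop) hφ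
  unfold itoD
  refine continuous_const.mul (continuous_finsetSum _ fun i _ => ?_)
  exact ((d2.comp c1).clm_apply (c2 i)).clm_apply (c2 i)

lemma D2_bdd (h : BS μ R) {φ : E → W} (hφ : Continuous φ)
    {Φ : W → ℝ} (hΦ : ContDiff ℝ 2 Φ) {f : E → ℝ} (hf : Continuous f) :
    ∃ D, 0 ≤ D ∧ ∀ q, ‖fderiv ℝ (fderiv ℝ Φ) (MM μ φ q) (cv μ q f φ) (cv μ q f φ)‖ ≤ D := by
  have d1 : ContDiff ℝ 1 (fderiv ℝ Φ) := hΦ.fderiv_right (by norm_num)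
  have d2 : Continuous (fderiv ℝ (fderiv ℝ Φ)) := d1.continuous_fderiv (by norm_num)
  obtain ⟨D0, p0, h0⟩ := bdd_MM h hφ
  obtain ⟨D1, p1, h1⟩ := cont_bdd (V := W →L[ℝ] W →L[ℝ] ℝ) d2 D0
  obtain ⟨D2, p2, h2⟩ := bdd_cv h hf hφ
  refine ⟨D1 * D2 * D2, by positivity, fun q => ?_⟩
  refine (ContinuousLinearMap.le_opNorm₂ _ _ _).trans ?_
  gcongr; exacts [h1 _ (h0 q), h2 q, h2 q]

lemma itoD_bdd (h : BS μ R) {ι : Type*} [Fintype ι] (e : OrthonormalBasis ι ℝ E) {φ : E → W} (hφ : Continuous φ)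
    {Φ : W → ℝ} (hΦ : ContDiff ℝ 2 Φ) : ∃ D, 0 ≤ D ∧ ∀ q, |itoD μ e φ Φ q| ≤ D := by
  choose D p hD using fun i => D2_bdd h hφ hΦ (f := fun x => exL x (0, e i)) (by fun_prop)
  refine ⟨(1/2) * ∑ i, D i, mul_nonneg (by norm_num) (Finset.sum_nonneg fun i _ => p i), fun q => ?_⟩
  rw [itoD, abs_mul, abs_of_pos (by norm_num : (0:ℝ) < 1/2)]
  gcongr
  exact (Finset.abs_sum_le_sum_abs _ _).trans (sum_le_sum fun i _ => hD i q)

lemma bdd_NN (h : BS μ R) {f : E → W} (hf : Continuous f) : ∃ D, 0 ≤ D ∧ ∀ q, ‖NN μ f q‖ ≤ D * Zq μ q := by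
  obtain ⟨D, p, hD⟩ := bdd_MM h hf
  refine ⟨D, p, fun q => ?_⟩
  rw [NN_MM h, norm_smul, norm_of_nonneg (Zq_pos h q).le, mul_comm]
  exact mul_le_mul_of_nonneg_right (hD q) (Zq_pos h q).le

lemma aux_op {V W : Type*} [NormedAddCommGroup V] [NormedSpace ℝ V] [NormedAddCommGroup W] [NormedSpace ℝ W]
    (D : W →L[ℝ] ℝ) (N' : V →L[ℝ] W) (Z' : V →L[ℝ] ℝ) (m : W) (z c : ℝ) (hz : 0 < z) :
    ‖z • D.comp (z⁻¹ • (N' - Z'.smulRight m)) + c • Z'‖ ≤ ‖D‖ * (‖N'‖ + ‖Z'‖ * ‖m‖) + |c| * ‖Z'‖ := by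
  have : z • D.comp (z⁻¹ • (N' - Z'.smulRight m)) = D.comp (N' - Z'.smulRight m) := by
    rw [ContinuousLinearMap.comp_smul, smul_inv_smul₀ hz.ne']
  rw [this]
  refine (norm_add_le _ _).trans ?_
  rw [norm_smul, Real.norm_eq_abs]
  gcongr
  refine (D.opNorm_comp_le _).trans ?_
  gcongr
  refine (norm_sub_le _ _).trans ?_
  rw [ContinuousLinearMap.norm_smulRight_apply]

lemma ito (h : BS μ R) {ι : Type*} [Fintype ι] (e : OrthonormalBasis ι ℝ E) {φ : E → W} (hφ : Continuous φ)
    {Φ : W → ℝ} (hΦ : ContDiff ℝ 2 Φ) {t : ℝ} (ht : 0 < t) :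
    HasDerivAt (fun t => EE μ t (fun q => Φ (MM μ φ q))) (EE μ t (itoD μ e φ Φ)) t := by
  have d0 : Differentiable ℝ Φ := hΦ.differentiable (by norm_num)
  have d1 : ContDiff ℝ 1 (fderiv ℝ Φ) := hΦ.fderiv_right (by norm_num)
  have d1' : Differentiable ℝ (fderiv ℝ Φ) := d1.differentiable (by norm_num)
  have d2 : Continuous (fderiv ℝ (fderiv ℝ Φ)) := d1.continuous_fderiv (by norm_num)
  have zp : ∀ q, Zq μ q ≠ 0 := fun q => (Zq_pos h q).ne'
  have cM := cont_MM h hφ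
  obtain ⟨D0, pD0, hD0⟩ := bdd_MM h hφ
  obtain ⟨C0, pC0, hC0⟩ := cont_bdd hΦ.continuous D0
  obtain ⟨C1, pC1, hC1⟩ := cont_bdd (V := W →L[ℝ] ℝ) d1.continuous D0
  -- derivatives of Z and M
  let Z' : ℝ × E → (ℝ × E) →L[ℝ] ℝ := fun q => NN μ (fun x => (exL x).smulRight (1:ℝ)) q
  let N' : ℝ × E → (ℝ × E) →L[ℝ] W := fun q => NN μ (fun x => (exL x).smulRight (φ x)) q
  have hZ : ∀ q, HasFDerivAt (Zq μ) (Z' q) q := fun q => by rw [Zq_eq]; exact fd_NN h continuous_const q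
  have hN : ∀ q, HasFDerivAt (NN μ φ) (N' q) q := fun q => fd_NN h hφ q
  have cZ' : Continuous Z' := cont_NN h (cont_sR continuous_const)
  have cN' : Continuous N' := cont_NN h (cont_sR hφ)
  let M' : ℝ × E → (ℝ × E) →L[ℝ] W := fun q => (Zq μ q)⁻¹ • (N' q - (Z' q).smulRight (MM μ φ q))
  have hM : ∀ q, HasFDerivAt (MM μ φ) (M' q) q := fun q => by
    have h3 := ((hasFDerivAt_inv (zp q)).comp q (hZ q)).smul (hN q)
    refine (h3.congr_of_eventuallyEq (of_forall fun q => MM_NN φ q)).congr_fderiv ?_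
    refine ContinuousLinearMap.ext fun v => ?_
    simp only [M', _root_.add_apply, _root_.smul_apply, _root_.sub_apply, ContinuousLinearMap.smulRight_apply,
      ContinuousLinearMap.comp_apply, Function.comp, smul_sub, MM_NN, smul_smul, sub_eq_add_neg, ← neg_smul]
    congr 2
    simp
    simp only [smul_smul]
    congr 1
    field_simp [zp q]
  have cM' : Continuous M' := by
    refine ((cont_Zq h).inv₀ zp).smul (cN'.sub ?_)
    exact (ContinuousLinearMap.smulRightL ℝ (ℝ × E) W).continuous₂.comp (cZ'.prodMk cM)
  let U' : ℝ × E → (ℝ × E) →L[ℝ] ℝ := fun q =>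
    Zq μ q • (fderiv ℝ Φ (MM μ φ q)).comp (M' q) + Φ (MM μ φ q) • Z' q
  have hU : ∀ q, HasFDerivAt (fun q => Zq μ q * Φ (MM μ φ q)) (U' q) q := fun q =>
    (hZ q).mul ((d0 _).hasFDerivAt.comp q (hM q))
  have cU' : Continuous U' := by
    refine ((cont_Zq h).smul ?_).add ((hΦ.continuous.comp cM).smul cZ')
    exact ((d1.continuous).comp cM).clm_comp cM'
  have ZM : ∀ q v, Zq μ q • M' q v = N' q v - Z' q v • MM μ φ q := fun q v => by
    simp only [M', _root_.smul_apply, _root_.sub_apply, ContinuousLinearMap.smulRight_apply]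
    rw [smul_inv_smul₀ (zp q)]
  have Z'v : ∀ q v, Z' q v = NN μ (fun x => exL x v) q := fun q v => by
    have := NN_apply h (φ := fun _ => (1:ℝ)) continuous_const q v
    simpa using this
  have N'v : ∀ q v, N' q v = NN μ (fun x => exL x v • φ x) q := fun q v => NN_apply h hφ q v
  have Mcv : ∀ q v, M' q v = cv μ q (fun x => exL x v) φ := fun q v => by
    have := ZM q v
    rw [Z'v, N'v, NN_MM h, NN_MM h, smul_eq_mul, mul_smul, ← smul_sub] at this
    exact smul_right_injective _ (zp q) this
  have U'v : ∀ q v, U' q v = fderiv ℝ Φ (MM μ φ q) (NN μ (fun x => exL x v • φ x) q - NN μ (fun x => exL x v) q • MM μ φ q)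
      + Φ (MM μ φ q) * NN μ (fun x => exL x v) q := fun q v => by
    rw [← N'v, ← Z'v, ← ZM, map_smul]
    simp [U', smul_eq_mul]
  -- second derivative
  let D2 : ι → ℝ × E → ℝ := fun i q => fderiv ℝ (fderiv ℝ Φ) (MM μ φ q) (cv μ q (fun x => exL x (0, e i)) φ)
      (cv μ q (fun x => exL x (0, e i)) φ)
  let U2 : ι → ℝ × E → ℝ := fun i q => Zq μ q * D2 i q + (fderiv ℝ Φ (MM μ φ q)
      (NN μ (fun x => exL x (0, e i) • exL x (0, e i) • φ x) q
        - NN μ (fun x => exL x (0, e i) • exL x (0, e i)) q • MM μ φ q)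
      + Φ (MM μ φ q) * NN μ (fun x => exL x (0, e i) • exL x (0, e i)) q)
  have cx : ∀ v : ℝ × E, Continuous fun x : E => exL x v := fun v => by fun_prop
  have hU2 : ∀ i q, HasDerivAt (fun r : ℝ => U' (q + r • ((0:ℝ), e i)) (0, e i)) (U2 i q) 0 := by
    intro i q
    obtain ⟨v, hv⟩ : ∃ v : ℝ × E, v = (0, e i) := ⟨_, rfl⟩
    simp only [U'v, ← hv]
    have l1 : HasDerivAt (fun r : ℝ => NN μ (fun x => exL x v • φ x) (q + r • v))
      (NN μ (fun x => exL x v • exL x v • φ x) q) 0 := ld_NN h ((cx v).smul hφ) q v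
    have l2 := ld_NN h (cx v) q v
    have l3 : HasDerivAt (fun r : ℝ => MM μ φ (q + r • v)) (M' q v) 0 := (hM q).hasLineDerivAt v
    have f1 : HasDerivAt (fun r : ℝ => Φ (MM μ φ (q + r • v))) (fderiv ℝ Φ (MM μ φ q) (M' q v)) 0 :=
      HasFDerivAt.comp_hasDerivAt_of_eq 0 (d0 (MM μ φ q)).hasFDerivAt l3 (by simp)
    have f2 : HasDerivAt (fun r : ℝ => fderiv ℝ Φ (MM μ φ (q + r • v))) (fderiv ℝ (fderiv ℝ Φ) (MM μ φ q) (M' q v)) 0 :=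
      HasFDerivAt.comp_hasDerivAt_of_eq 0 (d1' (MM μ φ q)).hasFDerivAt l3 (by simp)
    have l4 := (f2.clm_apply (l1.sub (l2.smul l3))).add (f1.mul l2)
    refine l4.congr_deriv ?_
    simp only [zero_smul, add_zero, Pi.smul_apply', Pi.sub_apply]
    have e1 : NN μ (fun x => exL x v • φ x) q - NN μ (fun x => exL x v) q • MM μ φ q
      = Zq μ q • M' q v := by rw [ZM, Z'v, N'v]
    have e2 := congrArg (fderiv ℝ (fderiv ℝ Φ) (MM μ φ q) (M' q v)) e1
    simp only [U2, D2, ← hv, ← Mcv]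
    simp only [map_sub, map_add, map_smul, smul_eq_mul] at e2 ⊢
    linear_combination e2
  have cD2 : ∀ i, Continuous (D2 i) := fun i => by
    have c2 : Continuous (fun q => cv μ q (fun x => exL x (0, e i)) φ) := cont_cv h (cx _) hφ
    exact ((d2.comp cM).clm_apply c2).clm_apply c2
  have cU2 : ∀ i, Continuous (U2 i) := fun i => by
    have k1 := cont_NN h ((cx (0, e i)).smul ((cx (0, e i)).smul hφ))
    have k2 := cont_NN h ((cx (0, e i)).smul (cx (0, e i)))
    refine ((cont_Zq h).mul (cD2 i)).add (Continuous.add ?_ ((hΦ.continuous.comp cM).mul k2))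
    exact (d1.continuous.comp cM).clm_apply (k1.sub (k2.smul cM))
  have bU' : GB U' := by
    obtain ⟨A1, p1, h1⟩ := bdd_NN h (W := (ℝ × E) →L[ℝ] ℝ) (cont_sR (φ := fun _ => (1:ℝ)) continuous_const)
    obtain ⟨A2, p2, h2⟩ := bdd_NN h (W := (ℝ × E) →L[ℝ] W) (cont_sR hφ)
    refine GB_of_le h (D := C1 * (A2 + A1 * D0) + C0 * A1) (by positivity) fun q => ?_
    refine (aux_op (fderiv ℝ Φ (MM μ φ q)) (N' q) (Z' q) (MM μ φ q) (Zq μ q) (Φ (MM μ φ q)) (Zq_pos h q)).trans ?_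
    have k1 := hC1 _ (hD0 q)
    have k2 := hC0 _ (hD0 q)
    have k4 := h1 q
    have k6 := h2 q
    have k5 := (Zq_pos h q).le
    calc _ ≤ C1 * (A2 * Zq μ q + A1 * Zq μ q * D0) + C0 * (A1 * Zq μ q) := by
          gcongr
          · exact hD0 q
          · exact k2
      _ = _ := by ring
  have bU2 : ∀ i, GB (U2 i) := fun i => by
    obtain ⟨A1, p1, h1⟩ := bdd_NN h ((cx (0, e i)).smul ((cx (0, e i)).smul hφ))
    obtain ⟨A2, p2, h2⟩ := bdd_NN h ((cx (0, e i)).smul (cx (0, e i)))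
    obtain ⟨A3, p3, h3⟩ := D2_bdd h hφ hΦ (cx (0, e i))
    refine GB_of_le h (D := A3 + (C1 * (A1 + A2 * D0) + C0 * A2)) (by positivity) fun q => ?_
    have k0 := (Zq_pos h q).le
    calc ‖U2 i q‖ ≤ Zq μ q * A3 + (C1 * (A1 * Zq μ q + A2 * Zq μ q * D0) + C0 * (A2 * Zq μ q)) := by
          refine (norm_add_le _ _).trans (add_le_add ?_ ((norm_add_le _ _).trans (add_le_add ?_ ?_)))
          · rw [norm_mul, norm_of_nonneg k0]; gcongr; exact h3 q
          · refine (ContinuousLinearMap.le_opNorm _ _).trans ?_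
            have k1 := hC1 _ (hD0 q)
            gcongr
            refine (norm_sub_le _ _).trans ?_
            rw [norm_smul]
            gcongr; exacts [h1 q, h2 q, hD0 q]
          · rw [norm_mul]; gcongr; exacts [hC0 _ (hD0 q), h2 q]
      _ = _ := by ring
  have bU : GB (fun q => Zq μ q * Φ (MM μ φ q)) := GB_ZF h (D := C0) fun q => hC0 _ (hD0 q)
  refine (heat e hU hU2 cU' cU2 bU bU' bU2 ht).congr_deriv ?_
  unfold EE
  congr 1; ext g
  set q : ℝ × E := (t, √t • g)
  have nx : ∀ x : E, ∑ i, exL x (0, e i) * exL x (0, e i) = -2 * exL x (1, 0) := fun x => by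
    simp only [exL_apply]
    have := e.sum_sq_norm_inner_right x
    simp only [Real.norm_eq_abs, sq_abs] at this
    simp only [zero_div, zero_mul, sub_zero, inner_zero_left, zero_sub]
    rw [← this]; simp only [pow_two]; ring
  have s1 : ∑ i, NN μ (fun x => exL x (0, e i) • exL x (0, e i)) q = -2 * NN μ (fun x => exL x (1, 0)) q := by
    unfold NN
    rw [← integral_finsetSum _ fun i _ => h.int (by fun_prop), ← integral_const_mul]
    congr 1; ext x
    rw [← Finset.smul_sum]; simp only [smul_eq_mul]; rw [nx]; ring
  have s2 : ∑ i, NN μ (fun x => exL x (0, e i) • exL x (0, e i) • φ x) q = (-2:ℝ) • NN μ (fun x => exL x (1, 0) • φ x) q := by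
    unfold NN
    rw [← integral_finsetSum _ fun i _ => h.int (by fun_prop), ← integral_smul]
    congr 1; ext x
    simp only [smul_smul]
    rw [← Finset.sum_smul, ← mul_sum, nx]; congr 1; ring
  simp only [U2, Finset.sum_add_distrib, ← map_sum, Finset.sum_sub_distrib, ← Finset.sum_smul, ← mul_sum, s1, s2,
    U'v, itoD, D2]
  simp only [map_sub, map_smul, smul_eq_mul]
  ring

end

section

variable {W : Type*} [NormedAddCommGroup W] [NormedSpace ℝ W] [FiniteDimensional ℝ W]
variable {μ : Measure E} [IsProbabilityMeasure μ] {R : ℝ}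

lemma cmp_le {f f' H H' : ℝ → ℝ} {t : ℝ} (ht : 0 ≤ t) (cf : ContinuousOn f (Icc 0 t)) (cH : ContinuousOn H (Icc 0 t))
    (df : ∀ s ∈ Ioo 0 t, HasDerivAt f (f' s) s) (dH : ∀ s ∈ Ioo 0 t, HasDerivAt H (H' s) s)
    (le : ∀ s ∈ Ioo 0 t, f' s ≤ H' s) : f t - f 0 ≤ H t - H 0 := by
  have : AntitoneOn (fun s => f s - H s) (Icc 0 t) := by
    refine antitoneOn_of_hasDerivWithinAt_nonpos (f' := fun s => f' s - H' s) (convex_Icc 0 t) (cf.sub cH) ?_ ?_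
    · intro s hs; rw [interior_Icc] at hs ⊢; exact ((df s hs).sub (dH s hs)).hasDerivWithinAt
    · intro s hs; rw [interior_Icc] at hs; linarith [le s hs]
  have := this (left_mem_Icc.2 ht) (right_mem_Icc.2 ht) ht
  simp only at this; linarith

lemma EE_zero (F : ℝ × E → ℝ) : EE μ 0 F = F 0 := by
  have : (0:ℝ×E) = (0,0) := rfl
  simp [EE, Zq, ← this]

lemma itoD_add_aux (h : BS μ R) {φ : E → W} (hφ : Continuous φ) {Φ : W → ℝ} (hΦ : ContDiff ℝ 2 Φ) {t : ℝ} (ht : 0 ≤ t)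
    {H H' : ℝ → ℝ} (cH : ContinuousOn H (Icc 0 t)) (dH : ∀ s ∈ Ioo 0 t, HasDerivAt H (H' s) s)
    {ι : Type*} [Fintype ι] (e : OrthonormalBasis ι ℝ E)
    (le : ∀ s ∈ Ioo 0 t, EE μ s (itoD μ e φ Φ) ≤ H' s) :
    EE μ t (fun q => Φ (MM μ φ q)) ≤ Φ (MM μ φ 0) + (H t - H 0) := by
  obtain ⟨D0, pD0, hD0⟩ := bdd_MM h hφ
  obtain ⟨C0, pC0, hC0⟩ := cont_bdd hΦ.continuous D0
  have c := (EE_contOn h (F := fun q => Φ (MM μ φ q)) (fun q => hC0 _ (hD0 q)) (hΦ.continuous.comp (cont_MM h hφ))).mono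
    (Icc_subset_Ici_self (a := t))
  have := cmp_le ht c cH (fun s hs => ito h e hφ hΦ hs.1) dH le
  rw [EE_zero] at this
  linarith

lemma ito_int (h : BS μ R) {φ : E → W} (hφ : Continuous φ) {Φ : W → ℝ} (hΦ : ContDiff ℝ 2 Φ) {t : ℝ} (ht : 0 ≤ t)
    {ι : Type*} [Fintype ι] (e : OrthonormalBasis ι ℝ E) :
    EE μ t (fun q => Φ (MM μ φ q)) = Φ (MM μ φ 0) + ∫ s in (0:ℝ)..t, EE μ s (itoD μ e φ Φ) := by
  obtain ⟨D0, pD0, hD0⟩ := bdd_MM h hφ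
  obtain ⟨C0, pC0, hC0⟩ := cont_bdd hΦ.continuous D0
  have c := (EE_contOn h (F := fun q => Φ (MM μ φ q)) (fun q => hC0 _ (hD0 q)) (hΦ.continuous.comp (cont_MM h hφ))).mono
    (Icc_subset_Ici_self (a := t))
  obtain ⟨D1, pD1, hD1⟩ := itoD_bdd h e hφ hΦ
  have c2 := (EE_contOn h hD1 (itoD_cont h e hφ hΦ)).mono (Icc_subset_Ici_self (a := t))
  have := intervalIntegral.integral_eq_sub_of_hasDerivAt_of_le ht c (fun s hs => ito h e hφ hΦ hs.1)
    (c2.intervalIntegrable_of_Icc ht)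
  rw [this, EE_zero]; ring

lemma EE_M (h : BS μ R) {φ : E → ℝ} (hφ : Continuous φ) {t : ℝ} (ht : 0 ≤ t) : EE μ t (MM μ φ) = ∫ x, φ x ∂μ := by
  have hid : ContDiff ℝ 2 (fun w : ℝ => w) := contDiff_id
  have := ito_int h hφ hid ht (stdOrthonormalBasis ℝ E)
  have z : itoD μ (stdOrthonormalBasis ℝ E) φ (fun w : ℝ => w) = fun _ => 0 := by
    ext q
    have : fderiv ℝ (fun w : ℝ => w) = fun _ => ContinuousLinearMap.id ℝ ℝ := by ext1 w; exact fderiv_fun_id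
    simp [itoD, this]
  rw [z] at this
  simp only [EE] at this ⊢
  rw [this]
  simp [MM, tl]

lemma EE_one (h : BS μ R) {t : ℝ} (ht : 0 ≤ t) : EE μ t (fun _ => 1) = 1 := by
  have := EE_M h (φ := fun _ => (1:ℝ)) continuous_const ht
  have e : MM μ (fun _ => (1:ℝ)) = fun _ => 1 := by
    ext q; have := h.tl_prob q; simp [MM]
  rw [e] at this; simpa using this

lemma EE_add (h : BS μ R) {F G : ℝ × E → ℝ} {D D' : ℝ} (hF : ∀ q, |F q| ≤ D) (cF : Continuous F) (hG : ∀ q, |G q| ≤ D')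
    (cG : Continuous G) {t : ℝ} (ht : 0 ≤ t) : EE μ t (fun q => F q + G q) = EE μ t F + EE μ t G := by
  unfold EE; rw [← integral_add (EE_int h hF cF ht) (EE_int h hG cG ht)]; congr 1; ext g; ring

lemma EE_cmul (c : ℝ) (F : ℝ × E → ℝ) (t : ℝ) : EE μ t (fun q => c * F q) = c * EE μ t F := by
  unfold EE; rw [← integral_const_mul]; congr 1; ext g; ring

lemma EE_const (h : BS μ R) (c : ℝ) {t : ℝ} (ht : 0 ≤ t) : EE μ t (fun _ => c) = c := by
  have := EE_cmul (μ := μ) c (fun _ => 1) t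
  rw [EE_one h ht] at this; simpa using this

lemma EE_mono' (h : BS μ R) {F G : ℝ × E → ℝ} {t : ℝ} (ht : 0 ≤ t)
    (iF : Integrable (fun g => Zq μ (t, √t • g) * F (t, √t • g)) (ga E))
    (iG : Integrable (fun g => Zq μ (t, √t • g) * G (t, √t • g)) (ga E)) (le : ∀ θ, F (t, θ) ≤ G (t, θ)) :
    EE μ t F ≤ EE μ t G :=
  integral_mono iF iG fun g => mul_le_mul_of_nonneg_left (le _) (Zq_pos h _).le

lemma EE_mono (h : BS μ R) {F G : ℝ × E → ℝ} {D D' : ℝ} (hF : ∀ q, |F q| ≤ D) (cF : Continuous F) (hG : ∀ q, |G q| ≤ D')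
    (cG : Continuous G) {t : ℝ} (ht : 0 ≤ t) (le : ∀ θ, F (t, θ) ≤ G (t, θ)) : EE μ t F ≤ EE μ t G :=
  EE_mono' h ht (EE_int h hF cF ht) (EE_int h hG cG ht) le

lemma EE_nonneg (h : BS μ R) {F : ℝ × E → ℝ} {t : ℝ} (le : ∀ θ, 0 ≤ F (t, θ)) : 0 ≤ EE μ t F :=
  integral_nonneg fun g => mul_nonneg (Zq_pos h _).le (le _)

lemma Zq_tl (h : BS μ R) (q q' : ℝ × E) : Zq (tl μ q) q' = Zq μ (q + q') / Zq μ q := by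
  unfold Zq tl
  rw [integral_tilted]
  rw [div_eq_inv_mul, ← integral_const_mul]
  congr 1; ext x
  rw [map_add, exp_add, smul_eq_mul]; ring

lemma EE_tl (h : BS μ R) (q : ℝ × E) (s : ℝ) (F : ℝ × E → ℝ) :
    Zq μ q * EE (tl μ q) s (fun q' => F (q + q')) = ∫ g', Zq μ (q + (s, √s • g')) * F (q + (s, √s • g')) ∂(ga E) := by
  unfold EE
  rw [← integral_const_mul]; congr 1; ext g
  rw [Zq_tl h]; have := (Zq_pos h q).ne'; field_simp

lemma tower (h : BS μ R) {F : ℝ × E → ℝ} {D : ℝ} (hF : ∀ q, |F q| ≤ D) (cF : Continuous F) {r s : ℝ} (hr : 0 ≤ r) (hs : 0 ≤ s) :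
    EE μ r (fun q => EE (tl μ q) s (fun q' => F (q + q'))) = EE μ (r + s) F := by
  set K : ℝ × E → ℝ := fun q => Zq μ q * F q with hK
  have cK : Continuous K := (cont_Zq h).mul cF
  have e0 : EE μ r (fun q => EE (tl μ q) s (fun q' => F (q + q')))
      = ∫ g, ∫ g', K (r + s, √r • g + √s • g') ∂(ga E) ∂(ga E) := by
    unfold EE
    congr 1; ext g
    exact EE_tl h _ s F
  have sq : √r ^ 2 + √s ^ 2 = √(r+s) ^ 2 := by rw [sq_sqrt hr, sq_sqrt hs, sq_sqrt (by positivity)]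
  have gc := ga_conv (E := E) sq
  have iK := EE_int h hF cF (add_nonneg hr hs)
  have cc : Continuous fun θ : E => K (r + s, θ) := by fun_prop
  have m1 : Measurable (fun p : E × E => √r • p.1 + √s • p.2) := by fun_prop
  have iK2 : Integrable (fun p : E × E => K (r+s, √r • p.1 + √s • p.2)) ((ga E).prod (ga E)) := by
    have : Integrable (fun θ => K (r+s, θ)) (((ga E).prod (ga E)).map (fun p : E × E => √r • p.1 + √s • p.2)) := by
      rw [gc, integrable_map_measure (by exact cc.aestronglyMeasurable) (by fun_prop)]
      exact iK
    rw [integrable_map_measure (by exact cc.aestronglyMeasurable) (by fun_prop)] at this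
    exact this
  rw [e0, ← integral_prod (fun p : E × E => K (r+s, √r • p.1 + √s • p.2)) iK2]
  have e1 := integral_map (μ := (ga E).prod (ga E)) m1.aemeasurable (f := fun θ => K (r+s, θ)) cc.aestronglyMeasurable
  have e2 := integral_map (μ := ga E) (φ := fun g : E => √(r+s) • g) (by fun_prop) (f := fun θ => K (r+s, θ)) cc.aestronglyMeasurable
  rw [← e1, gc, e2]; rfl

lemma EE_tl_abs (h : BS μ R) {F : ℝ × E → ℝ} {D : ℝ} (hF : ∀ q, |F q| ≤ D) (cF : Continuous F) (q : ℝ × E) {s : ℝ} (hs : 0 ≤ s) :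
    |EE (tl μ q) s (fun q' => F (q + q'))| ≤ D := by
  have := h.tl_prob q
  have h2 := h.tl q
  have c1 : Continuous fun q' => F (q + q') := by fun_prop
  have hD : |D| ≤ |D| := le_rfl
  rw [abs_le]
  constructor
  · have := EE_mono h2 (F := fun _ => -D) (G := fun q' => F (q + q')) (D := |D|) (fun _ => by rw [abs_neg])
      continuous_const (fun q' => hF (q+q')) c1 hs (fun θ => (abs_le.1 (hF _)).1)
    rwa [EE_const h2 _ hs] at this
  · have := EE_mono h2 (G := fun _ => D) (F := fun q' => F (q + q')) (D' := |D|) (fun q' => hF (q+q')) c1 (fun _ => hD)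
      continuous_const hs (fun θ => (abs_le.1 (hF _)).2)
    rwa [EE_const h2 _ hs] at this

lemma tower_int (h : BS μ R) {F : ℝ × E → ℝ} {D : ℝ} (hF : ∀ q, |F q| ≤ D) (cF : Continuous F) {r d : ℝ} (hr : 0 ≤ r) (hd : 0 ≤ d) :
    Integrable (fun g => Zq μ (r, √r • g) * ∫ s in (0:ℝ)..d, EE (tl μ (r, √r • g)) s (fun q' => F ((r, √r • g) + q'))) (ga E) ∧
    EE μ r (fun q => ∫ s in (0:ℝ)..d, EE (tl μ q) s (fun q' => F (q + q'))) = ∫ s in (0:ℝ)..d, EE μ (r + s) F := by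
  set K : ℝ × E → ℝ := fun q => Zq μ q * F q with hK
  have cK : Continuous K := (cont_Zq h).mul cF
  let J : E × ℝ → ℝ := fun p => Zq μ (r, √r • p.1) * EE (tl μ (r, √r • p.1)) p.2 (fun q' => F ((r, √r • p.1) + q'))
  have eJ : J = fun p => ∫ g', K (r + p.2, √r • p.1 + √p.2 • g') ∂(ga E) := by
    ext p; exact EE_tl h _ p.2 F
  have mJ : StronglyMeasurable J := by
    rw [eJ]
    have : Continuous fun x : (E × ℝ) × E => K (r + x.1.2, √r • x.1.1 + √x.1.2 • x.2) := by fun_prop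
    exact this.stronglyMeasurable.integral_prod_right
  have iZ : Integrable (fun g => Zq μ (r, √r • g) * D) (ga E) :=
    EE_int h (F := fun _ => D) (D := |D|) (fun _ => le_rfl) continuous_const hr
  have iJ : Integrable J ((ga E).prod (volume.restrict (Ioc 0 d))) := by
    have i2 := iZ.mul_prod (integrable_const (1:ℝ) (μ := volume.restrict (Ioc 0 d)))
    refine i2.mono' mJ.aestronglyMeasurable ?_
    have : ∀ᵐ p : E × ℝ ∂((ga E).prod (volume.restrict (Ioc 0 d))), p.2 ∈ Ioc 0 d :=
      Measure.quasiMeasurePreserving_snd.ae (ae_restrict_mem measurableSet_Ioc)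
    filter_upwards [this] with p hp
    rw [norm_mul, norm_of_nonneg (Zq_pos h _).le, mul_one]
    exact mul_le_mul_of_nonneg_left (EE_tl_abs h hF cF _ hp.1.le) (Zq_pos h _).le
  have e1 : ∀ g, Zq μ (r, √r • g) * ∫ s in (0:ℝ)..d, EE (tl μ (r, √r • g)) s (fun q' => F ((r, √r • g) + q')) = ∫ s in Ioc 0 d, J (g, s) := by
    intro g; rw [intervalIntegral.integral_of_le hd, ← integral_const_mul]
  refine ⟨?_, ?_⟩
  · simp only [e1]; exact iJ.integral_prod_left
  · rw [EE]; simp only [e1]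
    rw [integral_integral_swap (f := fun g s => J (g, s)) iJ, intervalIntegral.integral_of_le hd]
    refine setIntegral_congr_fun measurableSet_Ioc fun s hs => ?_
    rw [← tower h hF cF hr hs.1.le]; rfl

end

section

variable {E : Type*} [NormedAddCommGroup E] [InnerProductSpace ℝ E] [FiniteDimensional ℝ E]
variable {W : Type*} [NormedAddCommGroup W] [NormedSpace ℝ W]

/-- continuous trace -/
def trC : (E →L[ℝ] E) →L[ℝ] ℝ :=
  LinearMap.toContinuousLinearMap ((LinearMap.trace ℝ E) ∘ₗ (ContinuousLinearMap.coeLM ℝ))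

lemma trC_eq {ι : Type*} [Fintype ι] (e : OrthonormalBasis ι ℝ E) (A : E →L[ℝ] E) : trC A = ∑ i, ⟪e i, A (e i)⟫ := by
  simp [trC, LinearMap.trace_eq_sum_inner _ e]

lemma trC_comm (A B : E →L[ℝ] E) : trC (A * B) = trC (B * A) := by
  simp only [trC, LinearMap.coe_toContinuousLinearMap', LinearMap.comp_apply]
  exact LinearMap.trace_mul_comm ℝ (A : E →ₗ[ℝ] E) (B : E →ₗ[ℝ] E)

open Polynomial in
structure NC (E : Type*) [NormedAddCommGroup E] [InnerProductSpace ℝ E] [FiniteDimensional ℝ E]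
    (p : ℝ[X]) (L : (E →L[ℝ] E) → (E →L[ℝ] E) → (E →L[ℝ] E)) (dd : ℝ → ℝ → ℝ) : Prop where
  der : ∀ (X : ℝ → E →L[ℝ] E) (X' : E →L[ℝ] E) (s : ℝ), HasDerivAt X X' s →
    HasDerivAt (fun s => aeval (X s) p) (L (X s) X') s
  tr : ∀ A B D, Commute A D → trC (L A B * D) = trC (aeval A (derivative p) * B * D)
  dif : ∀ x y, (x - y) * dd x y = p.eval x - p.eval y
  diag : ∀ x, dd x x = (derivative p).eval x
  ev : ∀ (A B : E →L[ℝ] E) (u v : E) (x y : ℝ), A.IsSymmetric → A u = x • u → A v = y • v →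
    ⟪u, L A B v⟫ = dd x y * ⟪u, B v⟫

open Polynomial in
lemma aeval_ev (A : E →L[ℝ] E) {v : E} {y : ℝ} (h : A v = y • v) (p : ℝ[X]) : aeval A p v = p.eval y • v := by
  induction p using Polynomial.induction_on with
  | C a => simp [Algebra.algebraMap_eq_smul_one]
  | add p q hp hq => simp [hp, hq, add_smul]
  | monomial n a ih =>
    rw [pow_succ, ← mul_assoc, map_mul, aeval_X, mul_apply_eq_comp, h, map_smul, ih, smul_smul]
    congr 1; simp; ring

open Polynomial in
lemma aeval_symm (A : E →L[ℝ] E) (hA : A.IsSymmetric) (p : ℝ[X]) : (aeval A p).IsSymmetric := by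
  induction p using Polynomial.induction_on with
  | C a => intro u v; simp [Algebra.algebraMap_eq_smul_one, inner_smul_left, inner_smul_right]
  | add p q hp hq => intro u v; have := hp u v; have := hq u v; simp_all [inner_add_left, inner_add_right]
  | monomial n a ih =>
    intro u v
    have e1 : aeval A (C a * X ^ (n+1)) = aeval A (C a * X ^ n) * A := by rw [pow_succ, ← mul_assoc, map_mul, aeval_X]
    have e2 : aeval A (C a * X ^ (n+1)) = A * aeval A (C a * X ^ n) := by rw [pow_succ', ← mul_assoc, mul_comm (C a), mul_assoc, map_mul, aeval_X]
    have h1 := hA u (aeval A (C a * X ^ n) v)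
    have h2 := ih (A u) v
    simp only [ContinuousLinearMap.coe_coe] at h1 h2 ⊢
    calc _ = ⟪(aeval A (C a * X ^ n)) (A u), v⟫ := by rw [e1]; rfl
      _ = ⟪A u, (aeval A (C a * X ^ n)) v⟫ := h2
      _ = _ := by rw [e2]; exact h1

open Polynomial in
lemma NC.mulX {p : ℝ[X]} {L dd} (h : NC E p L dd) :
    NC E (p * X) (fun A B => L A B * A + aeval A p * B) (fun x y => dd x y * y + p.eval x) where
  der Y Y' s hY := by
    simp only [map_mul, aeval_X]
    exact (h.der Y Y' s hY).mul hY
  tr A B D hD := by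
    have h1 := h.tr A B (A * D) ((Commute.refl A).mul_right hD)
    have h2 : Commute A (aeval A (derivative p)) := by
      have := (Polynomial.commute_X (derivative p)).map (aeval A : ℝ[X] →ₐ[ℝ] _)
      simpa using this
    simp only [map_add, derivative_mul, derivative_X, mul_one, map_mul, aeval_X, add_mul]
    congr 1
    rw [mul_assoc, h1, hD.eq, ← mul_assoc, trC_comm, ← h2.eq]
    simp only [mul_assoc]
  dif x y := by have := h.dif x y; simp only [eval_mul, eval_X]; linear_combination y * this
  diag x := by simp [h.diag]
  ev A B u v x y hA hu hv := by
    rw [_root_.add_apply, mul_apply_eq_comp, mul_apply_eq_comp, inner_add_right, hv, map_smul, inner_smul_right,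
      h.ev A B u v x y hA hu hv]
    have := aeval_symm A hA p u (B v)
    simp only [ContinuousLinearMap.coe_coe] at this
    rw [← this, aeval_ev A hu, inner_smul_left]
    simp; ring

open Polynomial in
lemma NC.exists (E : Type*) [NormedAddCommGroup E] [InnerProductSpace ℝ E] [FiniteDimensional ℝ E] (p : ℝ[X]) :
    ∃ L dd, NC E p L dd := by
  induction p using Polynomial.induction_on with
  | C a =>
    refine ⟨fun _ _ => 0, fun _ _ => 0, ⟨fun Y Y' s _ => ?_, by simp, by simp, by simp, by simp⟩⟩
    simp only [aeval_C]; exact hasDerivAt_const _ _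
  | add p q hp hq =>
    obtain ⟨L, d, h⟩ := hp
    obtain ⟨L', d', h'⟩ := hq
    refine ⟨fun A B => L A B + L' A B, fun x y => d x y + d' x y, ⟨fun Y Y' s hY => ?_, fun A B D hD => ?_, fun x y => ?_, fun x => ?_,
      fun A B u v x y hA hu hv => ?_⟩⟩
    · simp only [map_add]; exact (h.der Y Y' s hY).add (h'.der Y Y' s hY)
    · simp only [add_mul, map_add, h.tr A B D hD, h'.tr A B D hD]
    · rw [mul_add, h.dif, h'.dif]; simp; ring
    · simp [h.diag, h'.diag]
    · simp [inner_add_right, h.ev A B u v x y hA hu hv, h'.ev A B u v x y hA hu hv]; ring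
  | monomial n a ih =>
    obtain ⟨L, d, h⟩ := ih
    rw [pow_succ, ← mul_assoc]
    exact ⟨_, _, h.mulX⟩

lemma D2_curve {Φ : W → ℝ} (hΦ : ContDiff ℝ 2 Φ) (w c : W) {g' : ℝ → ℝ} {g2 : ℝ}
    (h1 : ∀ s : ℝ, HasDerivAt (fun s : ℝ => Φ (w + s • c)) (g' s) s) (h2 : HasDerivAt g' g2 0) :
    fderiv ℝ (fderiv ℝ Φ) w c c = g2 := by
  have d0 : Differentiable ℝ Φ := hΦ.differentiable (by norm_num)
  have d1 : ContDiff ℝ 1 (fderiv ℝ Φ) := hΦ.fderiv_right (by norm_num)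
  have d1' : Differentiable ℝ (fderiv ℝ Φ) := d1.differentiable (by norm_num)
  have l : ∀ s : ℝ, HasDerivAt (fun s : ℝ => w + s • c) c s := fun s => by
    simpa using ((hasDerivAt_id s).smul_const c).const_add w
  have e : g' = fun s => fderiv ℝ Φ (w + s • c) c := by
    ext s
    exact (h1 s).unique ((d0 _).hasFDerivAt.comp_hasDerivAt s (l s))
  have f2 : HasDerivAt (fun s : ℝ => fderiv ℝ Φ (w + s • c)) (fderiv ℝ (fderiv ℝ Φ) w c) 0 :=
    HasFDerivAt.comp_hasDerivAt_of_eq 0 (d1' w).hasFDerivAt (l 0) (by simp)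
  rw [e] at h2
  have := (f2.clm_apply (hasDerivAt_const (0:ℝ) c)).unique h2
  simpa using this

/-- rank one -/
abbrev ro (x y : E) : E →L[ℝ] E := InnerProductSpace.rankOne ℝ x y

open Polynomial in
def Phi (p : ℝ[X]) (w : (E →L[ℝ] E) × E) : ℝ := trC (aeval (w.1 - ro w.2 w.2) p)

lemma cd_ro : ContDiff ℝ 2 (fun w : (E →L[ℝ] E) × E => ro w.2 w.2) := by
  rw [contDiff_clm_apply_iff]
  intro z
  simp only [ro, InnerProductSpace.rankOne_apply]
  exact (contDiff_snd.inner ℝ contDiff_const).smul contDiff_snd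

open Polynomial in
lemma cd_Phi (p : ℝ[X]) : ContDiff ℝ 2 (Phi (E := E) p) := by
  unfold Phi
  refine ContDiff.comp (g := fun A : E →L[ℝ] E => trC A) (ContinuousLinearMap.contDiff (E := E →L[ℝ] E) (trC (E := E))) ?_
  have h0 : ContDiff ℝ 2 (fun w : (E →L[ℝ] E) × E => w.1 - ro w.2 w.2) := contDiff_fst.sub cd_ro
  induction p using Polynomial.induction_on with
  | C a => simp only [aeval_C]; exact contDiff_const
  | add p q hp hq => simp only [map_add]; exact hp.add hq
  | monomial n a ih =>
    simp only [pow_succ, ← mul_assoc]; simp only [map_mul _ _ X, aeval_X]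
    exact ih.mul h0

open Polynomial in
lemma D2_Phi (p : ℝ[X]) {L dd} (hnc : NC E (derivative p) L dd) (Q : E →L[ℝ] E) (b : E) (DQ : E →L[ℝ] E) (d : E)
    {ι : Type*} [Fintype ι] (f : OrthonormalBasis ι ℝ E) (lam : ι → ℝ) (hA : (Q - ro b b).IsSymmetric)
    (hf : ∀ i, (Q - ro b b) (f i) = lam i • f i) :
    fderiv ℝ (fderiv ℝ (Phi p)) (Q, b) (DQ, d) (DQ, d) =
      ∑ i, ∑ j, dd (lam i) (lam j) * (⟪f i, (DQ - ro b d - ro d b) (f j)⟫ * ⟪f j, (DQ - ro b d - ro d b) (f i)⟫)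
      - 2 * ∑ i, (derivative p).eval (lam i) * ⟪f i, d⟫ ^ 2 := by
  obtain ⟨L1, dd1, h1⟩ := NC.exists E p
  set A := Q - ro b b with hAd
  set B := DQ - ro b d - ro d b with hBd
  let Y : ℝ → E →L[ℝ] E := fun s => A + s • B - (s ^ 2) • ro d d
  let Y' : ℝ → E →L[ℝ] E := fun s => B - (2 * s) • ro d d
  have hY : ∀ s, HasDerivAt Y (Y' s) s := fun s => by
    have a1 : HasDerivAt (fun s : ℝ => s • B) B s := by simpa using (hasDerivAt_id s).smul_const B
    have a2 : HasDerivAt (fun s : ℝ => s ^ 2 • ro d d) ((2 * s) • ro d d) s := by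
      simpa using (hasDerivAt_pow 2 s).smul_const (ro d d)
    exact (a1.const_add A).sub a2
  have hY2 : HasDerivAt Y' (-((2:ℝ) • ro d d)) 0 := by
    have a2 : HasDerivAt (fun s : ℝ => (2 * s) • ro d d) ((2:ℝ) • ro d d) 0 := by
      have : HasDerivAt (fun s : ℝ => 2 * s) 2 0 := by simpa using (hasDerivAt_id (0:ℝ)).const_mul 2
      exact this.smul_const (ro d d)
    exact a2.const_sub B
  have eY : ∀ s : ℝ, Phi p ((Q, b) + s • (DQ, d)) = trC (aeval (Y s) p) := fun s => by
    have : (((Q, b) + s • (DQ, d)).1 - ro ((Q, b) + s • (DQ, d)).2 ((Q, b) + s • (DQ, d)).2) = Y s := by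
      ext x
      simp only [Y, hAd, hBd, Prod.fst_add, Prod.smul_fst, Prod.snd_add, Prod.smul_snd, _root_.add_apply, _root_.sub_apply,
        _root_.smul_apply, InnerProductSpace.rankOne_apply, inner_add_left, inner_smul_left]
      simp
      module
    unfold Phi; rw [this]
  have k1 : ∀ s : ℝ, HasDerivAt (fun s : ℝ => Phi p ((Q, b) + s • (DQ, d))) (trC (aeval (Y s) (derivative p) * Y' s)) s := fun s => by
    simp only [eY]
    have := h1.tr (Y s) (Y' s) 1 (Commute.one_right _)
    rw [mul_one, mul_one] at this
    rw [← this]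
    exact trC.hasFDerivAt.comp_hasDerivAt s (h1.der Y (Y' s) s (hY s))
  have Y0 : Y 0 = A := by simp [Y]
  have Y0' : Y' 0 = B := by simp [Y']
  have k2 := trC.hasFDerivAt.comp_hasDerivAt (0:ℝ) ((hnc.der Y (Y' 0) 0 (hY 0)).mul hY2)
  rw [D2_curve (cd_Phi p) (Q, b) (DQ, d) k1 k2, Y0, Y0', map_add, trC_eq f, trC_eq f, sub_eq_add_neg]
  congr 1
  · refine sum_congr rfl fun i _ => ?_
    rw [mul_apply_eq_comp]
    have : B (f i) = ∑ j, ⟪f j, B (f i)⟫ • f j := (f.sum_repr' _).symm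
    conv_lhs => rw [this]
    rw [map_sum, inner_sum]
    refine sum_congr rfl fun j _ => ?_
    rw [map_smul, inner_smul_right, hnc.ev A B _ _ _ _ hA (hf i) (hf j)]; ring
  · rw [mul_sum, ← Finset.sum_neg_distrib]
    refine sum_congr rfl fun i _ => ?_
    have := aeval_symm A hA (derivative p) (f i) ((-((2:ℝ) • ro d d)) (f i))
    simp only [ContinuousLinearMap.coe_coe] at this
    rw [mul_apply_eq_comp, ← this, aeval_ev A (hf i), inner_smul_left, _root_.neg_apply, _root_.smul_apply,
      InnerProductSpace.rankOne_apply, inner_neg_right, inner_smul_right, inner_smul_right, real_inner_comm d]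
    simp; ring

end

section


def bar (p : Measure E) : E := ∫ x, x ∂p
def cov (p : Measure E) : E →L[ℝ] E := (∫ x, ro x x ∂p) - ro (bar p) (bar p)
def ph (x : E) : (E →L[ℝ] E) × E := (ro x x, x)
/-- third moment vector -/
def V3 (p : Measure E) (v w : E) : E := ∫ x, (⟪x - bar p, v⟫ * ⟪x - bar p, w⟫) • (x - bar p) ∂p
def u3 (p : Measure E) (e v w : E) : ℝ := ⟪e, V3 p v w⟫

@[fun_prop]
lemma cont_ro : Continuous (fun x : E => ro x x) :=
  (InnerProductSpace.rankOne ℝ (E := E) (F := E)).continuous.clm_apply continuous_id |> fun h => by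
    simpa [ro] using h

@[fun_prop]
lemma cont_ph : Continuous (ph : E → _) := cont_ro.prodMk continuous_id

lemma ro_symm (b : E) : (ro b b).IsSymmetric := fun x y => by
  simp [InnerProductSpace.rankOne_apply, inner_smul_left, inner_smul_right, real_inner_comm, mul_comm]

lemma cov_symm (p : Measure E) : (cov p).IsSymmetric := by
  have h1 : (∫ x, ro x x ∂p : E →L[ℝ] E).IsSymmetric := by
    by_cases hi : Integrable (fun x : E => ro x x) p
    · intro v w
      simp only [ContinuousLinearMap.coe_coe]
      rw [ContinuousLinearMap.integral_apply hi, ContinuousLinearMap.integral_apply hi, real_inner_comm,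
        ← integral_inner (hi.apply_continuousLinearMap v), ← integral_inner (hi.apply_continuousLinearMap w)]
      congr 1; ext x
      simp [InnerProductSpace.rankOne_apply, inner_smul_right, real_inner_comm, mul_comm]
    · rw [integral_undef hi]; intro v w; simp
  intro v w
  have a := h1 v w
  have b := ro_symm (bar p) v w
  simp only [cov, ContinuousLinearMap.coe_coe, _root_.sub_apply, inner_sub_left, inner_sub_right] at *
  rw [a, b]

section
variable {p : Measure E} [IsProbabilityMeasure p] {R : ℝ}

lemma inner_bar (h : BS p R) (v : E) : ⟪bar p, v⟫ = ∫ x, ⟪x, v⟫ ∂p := by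
  simp only [real_inner_comm v]
  exact (integral_inner (h.int continuous_id) v).symm

lemma inner_Q (h : BS p R) (v w : E) : ⟪v, (∫ x, ro x x ∂p) w⟫ = ∫ x, ⟪x, v⟫ * ⟪x, w⟫ ∂p := by
  have hi : Integrable (fun x : E => ro x x) p := h.int cont_ro
  rw [ContinuousLinearMap.integral_apply hi, ← integral_inner (hi.apply_continuousLinearMap w)]
  congr 1; ext x
  simp [InnerProductSpace.rankOne_apply, inner_smul_right, real_inner_comm, mul_comm]

lemma cov_raw (h : BS p R) (v w : E) : ⟪v, cov p w⟫ = ∫ x, ⟪x, v⟫ * ⟪x, w⟫ ∂p - ⟪bar p, v⟫ * ⟪bar p, w⟫ := by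
  rw [cov, _root_.sub_apply, inner_sub_right, inner_Q h]
  simp [InnerProductSpace.rankOne_apply, inner_smul_right, real_inner_comm, mul_comm]

lemma cov_inner (h : BS p R) (v w : E) : ⟪v, cov p w⟫ = ∫ x, ⟪x - bar p, v⟫ * ⟪x - bar p, w⟫ ∂p := by
  rw [cov_raw h]
  have e : ∀ x : E, ⟪x - bar p, v⟫ * ⟪x - bar p, w⟫ = ⟪x, v⟫ * ⟪x, w⟫ - ⟪bar p, w⟫ * ⟪x, v⟫ - ⟪bar p, v⟫ * ⟪x, w⟫
      + ⟪bar p, v⟫ * ⟪bar p, w⟫ := fun x => by simp only [inner_sub_left]; ring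
  simp only [e]
  rw [integral_add (h.int (by fun_prop)) (h.int (by fun_prop)), integral_sub (h.int (by fun_prop)) (h.int (by fun_prop)),
    integral_sub (h.int (by fun_prop)) (h.int (by fun_prop)), integral_const_mul, integral_const_mul, ← inner_bar h, ← inner_bar h]
  simp; ring

lemma u3_eq (h : BS p R) (e v w : E) : u3 p e v w = ∫ x, ⟪x - bar p, e⟫ * ⟪x - bar p, v⟫ * ⟪x - bar p, w⟫ ∂p := by
  rw [u3, V3, ← integral_inner (h.int (by fun_prop))]
  congr 1; ext x
  rw [inner_smul_right, real_inner_comm e]; ring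

lemma u3_raw (h : BS p R) (e v w : E) : u3 p e v w = ∫ x, ⟪x, e⟫ * ⟪x, v⟫ * ⟪x, w⟫ ∂p
    - ⟪bar p, e⟫ * ∫ x, ⟪x, v⟫ * ⟪x, w⟫ ∂p - ⟪bar p, v⟫ * ∫ x, ⟪x, e⟫ * ⟪x, w⟫ ∂p - ⟪bar p, w⟫ * ∫ x, ⟪x, e⟫ * ⟪x, v⟫ ∂p
    + 2 * (⟪bar p, e⟫ * ⟪bar p, v⟫ * ⟪bar p, w⟫) := by
  rw [u3_eq h]
  have e' : ∀ x : E, ⟪x - bar p, e⟫ * ⟪x - bar p, v⟫ * ⟪x - bar p, w⟫ = ⟪x, e⟫ * ⟪x, v⟫ * ⟪x, w⟫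
    - ⟪bar p, e⟫ * (⟪x, v⟫ * ⟪x, w⟫) - ⟪bar p, v⟫ * (⟪x, e⟫ * ⟪x, w⟫) - ⟪bar p, w⟫ * (⟪x, e⟫ * ⟪x, v⟫)
    + ((⟪bar p, e⟫ * ⟪bar p, v⟫) * ⟪x, w⟫ + (⟪bar p, e⟫ * ⟪bar p, w⟫) * ⟪x, v⟫ + (⟪bar p, v⟫ * ⟪bar p, w⟫) * ⟪x, e⟫
      - ⟪bar p, e⟫ * ⟪bar p, v⟫ * ⟪bar p, w⟫) := fun x => by simp only [inner_sub_left]; ring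
  simp only [e']
  rw [integral_add (h.int (by fun_prop)) (h.int (by fun_prop)), integral_sub (h.int (by fun_prop)) (h.int (by fun_prop)),
    integral_sub (h.int (by fun_prop)) (h.int (by fun_prop)), integral_sub (h.int (by fun_prop)) (h.int (by fun_prop)),
    integral_sub (h.int (by fun_prop)) (h.int (by fun_prop)), integral_add (h.int (by fun_prop)) (h.int (by fun_prop)),
    integral_add (h.int (by fun_prop)) (h.int (by fun_prop))]
  simp only [integral_const_mul, ← inner_bar h]
  simp; ring

lemma u3_perm (h : BS p R) (e v w : E) : u3 p e v w = u3 p v e w ∧ u3 p e v w = u3 p e w v := by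
  simp only [u3_eq h]
  constructor <;> (congr 1; ext x; ring)

end

def ev (p : Measure E) (i : Fin (finrank ℝ E)) : ℝ := (cov_symm p).eigenvalues rfl i
def eb (p : Measure E) : OrthonormalBasis (Fin (finrank ℝ E)) ℝ E := (cov_symm p).eigenvectorBasis rfl
lemma cov_eb (p : Measure E) (i) : cov p (eb p i) = ev p i • eb p i := (cov_symm p).apply_eigenvectorBasis rfl i
def trf (ψ : ℝ → ℝ) (p : Measure E) : ℝ := ∑ i, ψ (ev p i)

lemma ev_eq {p : Measure E} [IsProbabilityMeasure p] {R : ℝ} (h : BS p R) (i) : ev p i = ∫ x, ⟪x - bar p, eb p i⟫ ^ 2 ∂p := by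
  have := cov_inner h (eb p i) (eb p i)
  rw [cov_eb, inner_smul_right] at this
  simp only [real_inner_self_eq_norm_sq, (eb p).orthonormal.1 i] at this
  simpa [sq] using this

lemma ev_nonneg {p : Measure E} [IsProbabilityMeasure p] {R : ℝ} (h : BS p R) (i) : 0 ≤ ev p i := by
  rw [ev_eq h]; exact integral_nonneg fun x => by positivity

lemma ev_le {p : Measure E} [IsProbabilityMeasure p] {R : ℝ} (h : BS p R) (i) : ev p i ≤ R ^ 2 := by
  have := cov_raw h (eb p i) (eb p i)
  rw [cov_eb, inner_smul_right] at this
  simp only [real_inner_self_eq_norm_sq, (eb p).orthonormal.1 i] at this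
  have h2 : ∫ x, ⟪x, eb p i⟫ * ⟪x, eb p i⟫ ∂p ≤ ∫ x, R ^ 2 ∂p := by
    refine integral_mono_ae (h.int (by fun_prop)) (h.int (by fun_prop)) ?_
    filter_upwards [h] with x hx
    have h1 := abs_real_inner_le_norm x (eb p i)
    rw [(eb p).orthonormal.1 i, mul_one] at h1
    rw [← abs_mul_abs_self, ← sq]
    have := abs_nonneg ⟪x, eb p i⟫
    exact pow_le_pow_left₀ this (h1.trans hx) 2
  simp at h2 this
  linarith [mul_self_nonneg ⟪bar p, eb p i⟫]

lemma trf_poly (P : Polynomial ℝ) (p : Measure E) : trf (fun x => P.eval x) p = trC (Polynomial.aeval (cov p) P) := by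
  rw [trC_eq (eb p), trf]
  refine sum_congr rfl fun i _ => ?_
  rw [aeval_ev _ (cov_eb p i), inner_smul_right, real_inner_self_eq_norm_sq, (eb p).orthonormal.1 i]; simp

section
variable {μ : Measure E} [IsProbabilityMeasure μ] {R : ℝ}

lemma MM_ph (h : BS μ R) (q : ℝ × E) : MM μ ph q = (∫ x, ro x x ∂(tl μ q), bar (tl μ q)) := by
  have := h.tl_prob q
  exact integral_pair ((h.tl q).int cont_ro) ((h.tl q).int continuous_id)

lemma Phi_MM (h : BS μ R) (P : Polynomial ℝ) (q : ℝ × E) : Phi P (MM μ ph q) = trf (fun x => P.eval x) (tl μ q) := by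
  rw [MM_ph h, trf_poly]; rfl

lemma parse {ι ι' : Type*} [Fintype ι] [Fintype ι'] (e : OrthonormalBasis ι ℝ E) (f : OrthonormalBasis ι' ℝ E) (G : E) :
    ∑ m, ⟪e m, G⟫ ^ 2 = ∑ m, ⟪f m, G⟫ ^ 2 := by
  have h := (e.sum_sq_norm_inner_right G).trans (f.sum_sq_norm_inner_right G).symm
  simpa using h

lemma itoD_Phi (h : BS μ R) {ι : Type*} [Fintype ι] (e : OrthonormalBasis ι ℝ E) (P : Polynomial ℝ) {L dd}
    (hnc : NC E (Polynomial.derivative P) L dd) (q : ℝ × E) :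
    itoD μ e ph (Phi P) q = (1/2) * (∑ i, ∑ j, ∑ m, dd (ev (tl μ q) i) (ev (tl μ q) j) *
      (u3 (tl μ q) (eb (tl μ q) m) (eb (tl μ q) i) (eb (tl μ q) j)) ^ 2
      - 2 * ∑ i, (Polynomial.derivative P).eval (ev (tl μ q) i) * (ev (tl μ q) i) ^ 2) := by
  have := h.tl_prob q
  have hp := h.tl q
  unfold itoD
  have ec : ∀ m, ∃ DQ d, cv μ q (fun x => exL x (0, e m)) ph = (DQ, d) ∧ (∀ v, ⟪v, d⟫ = ⟪v, cov (tl μ q) (e m)⟫) ∧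
     ∀ v w, ⟪v, (DQ - ro (bar (tl μ q)) d - ro d (bar (tl μ q))) w⟫ = u3 (tl μ q) (e m) v w := by
    intro m
    have e0 : ∀ x : E, exL x (0, e m) = ⟪x, e m⟫ := fun x => by rw [exL_apply]; simp [real_inner_comm]
    simp only [e0]
    refine ⟨_, _, rfl, ?_, ?_⟩
    · intro v
      simp only [cv]; simp only [MM_ph h]
      simp only [MM, ph, Prod.smul_mk]
      rw [integral_pair (hp.int (by fun_prop)) (hp.int (by fun_prop)), cov_raw hp]
      simp only [Prod.mk_sub_mk, Prod.smul_snd, Prod.snd_sub, inner_sub_right, inner_smul_right, ← inner_bar hp]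
      rw [← integral_inner (hp.int (by fun_prop))]
      simp only [inner_smul_right, real_inner_comm v]
      congr 1
      · congr 1; ext x; rw [mul_comm]
      · rw [real_inner_comm (bar _) v]; ring
    · intro v w
      have c1 : Continuous fun x : E => ⟪x, e m⟫ • ro x x := by fun_prop
      simp only [cv]; simp only [MM_ph h]
      simp only [MM, ph, Prod.smul_mk]
      rw [integral_pair (hp.int c1) (hp.int (by fun_prop))]
      simp only [Prod.smul_mk, Prod.mk_sub_mk, ← inner_bar hp, u3_raw hp, _root_.sub_apply, inner_sub_right, _root_.smul_apply, inner_smul_right,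
        InnerProductSpace.rankOne_apply, inner_sub_left, inner_smul_left, inner_Q hp]
      have i1 : ⟪v, (∫ x, ⟪x, e m⟫ • ro x x ∂(tl μ q)) w⟫ = ∫ x, ⟪x, e m⟫ * ⟪x, v⟫ * ⟪x, w⟫ ∂(tl μ q) := by
        rw [ContinuousLinearMap.integral_apply (hp.int c1), ← integral_inner ((hp.int c1).apply_continuousLinearMap w)]
        congr 1; ext x
        simp [InnerProductSpace.rankOne_apply, inner_smul_right, real_inner_comm]; ring
      have i2 : ∀ z, ⟪z, ∫ x, ⟪x, e m⟫ • x ∂(tl μ q)⟫ = ∫ x, ⟪x, e m⟫ * ⟪x, z⟫ ∂(tl μ q) := fun z => by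
        rw [← integral_inner (hp.int (by fun_prop))]
        congr 1; ext x; simp [inner_smul_right, real_inner_comm]
      rw [i1, i2 v, real_inner_comm w (∫ x, ⟪x, e m⟫ • x ∂(tl μ q)), i2 w, real_inner_comm (bar _) v]
      simp
      ring
  choose DQ d h1 h2 h3 using ec
  congr 1
  have hA : ((∫ x, ro x x ∂(tl μ q)) - ro (bar (tl μ q)) (bar (tl μ q))).IsSymmetric := cov_symm (tl μ q)
  simp only [h1, MM_ph h]
  have := fun m => D2_Phi P hnc (∫ x, ro x x ∂(tl μ q)) (bar (tl μ q)) (DQ m) (d m) (eb (tl μ q)) (ev (tl μ q)) hA (cov_eb (tl μ q))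
  simp only [this, h3, h2]
  rw [Finset.sum_sub_distrib, ← mul_sum]
  congr 1
  · rw [Finset.sum_comm]
    refine sum_congr rfl fun i _ => ?_
    rw [Finset.sum_comm]
    refine sum_congr rfl fun j _ => ?_
    simp only [← mul_sum]
    congr 1
    have : ∀ x, u3 (tl μ q) (e x) (eb (tl μ q) j) (eb (tl μ q) i) = u3 (tl μ q) (e x) (eb (tl μ q) i) (eb (tl μ q) j) :=
      fun x => (u3_perm hp _ _ _).2
    simp only [this, ← sq]
    exact parse _ _ _
  · congr 1
    rw [Finset.sum_comm]
    refine sum_congr rfl fun i _ => ?_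
    rw [← mul_sum]
    congr 1
    have : ∀ x, ⟪eb (tl μ q) i, cov (tl μ q) (e x)⟫ = ⟪e x, cov (tl μ q) (eb (tl μ q) i)⟫ := fun x => by
      rw [real_inner_comm]; exact (cov_symm (tl μ q)) _ _
    simp only [this]
    rw [cov_eb]
    simp only [inner_smul_right, mul_pow, ← mul_sum]
    have := e.sum_sq_norm_inner_right (eb (tl μ q) i)
    rw [(eb (tl μ q)).orthonormal.1 i] at this
    simp only [Real.norm_eq_abs, sq_abs] at this
    rw [this]; ring
end

end

section


lemma LC.tl_slc {μ : Measure E} [IsProbabilityMeasure μ] {R : ℝ} {t : ℝ} (h : BS μ R) (hμ : SLC t μ) (q : ℝ × E) :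
    SLC (t + q.1) (tl μ q) := by
  have h1 := (hμ.tilt q.1 q.2).smul (ofReal (Zq μ q))⁻¹
  have : tl μ q = (ofReal (Zq μ q))⁻¹ • μ.withDensity fun x => ofReal (exp (⟪q.2, x⟫ - q.1 / 2 * ‖x‖ ^ 2)) := by
    rw [tl, Measure.tilted, ← withDensity_smul _ (by fun_prop)]
    congr 1; ext x
    simp only [Pi.smul_apply, smul_eq_mul, exL_apply]
    rw [ENNReal.ofReal_div_of_pos (by simpa [Zq, exL_apply] using Zq_pos h q), ENNReal.div_eq_inv_mul]
    congr 3; simp [Zq, exL_apply]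
  rw [this]; exact h1

section
variable {ι : Type*} [Fintype ι]
def Uf (f : OrthonormalBasis ι ℝ E) (c : ι → ι → ℝ) (v : E) : E := ∑ j, (∑ m, c j m * ⟪v, f m⟫) • f j
def qf (f : OrthonormalBasis ι ℝ E) (c : ι → ι → ℝ) (b x : E) : ℝ := ⟪Uf f c (x - b), x - b⟫

@[fun_prop]
lemma cont_Uf (f : OrthonormalBasis ι ℝ E) (c : ι → ι → ℝ) : Continuous (Uf f c) := by
  unfold Uf; fun_prop

@[fun_prop]
lemma cont_qf (f : OrthonormalBasis ι ℝ E) (c : ι → ι → ℝ) (b : E) : Continuous (qf f c b) := by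
  unfold qf; fun_prop

lemma Uf_add (f : OrthonormalBasis ι ℝ E) (c : ι → ι → ℝ) (v w : E) : Uf f c (v + w) = Uf f c v + Uf f c w := by
  simp only [Uf, inner_add_left, mul_add, Finset.sum_add_distrib, add_smul]

lemma Uf_smul (f : OrthonormalBasis ι ℝ E) (c : ι → ι → ℝ) (r : ℝ) (v : E) : Uf f c (r • v) = r • Uf f c v := by
  simp only [Uf, inner_smul_left, Finset.smul_sum, smul_smul, mul_sum]
  refine sum_congr rfl fun j _ => ?_
  congr 1
  refine sum_congr rfl fun m _ => ?_
  simp; ring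

lemma Uf_inner (f : OrthonormalBasis ι ℝ E) (c : ι → ι → ℝ) (v w : E) : ⟪Uf f c v, w⟫ = ∑ j, ∑ m, c j m * ⟪v, f m⟫ * ⟪w, f j⟫ := by
  simp only [Uf, sum_inner, inner_smul_left]
  refine sum_congr rfl fun j _ => ?_
  rw [real_inner_comm]; simp [Finset.sum_mul]

lemma Uf_symm (f : OrthonormalBasis ι ℝ E) (c : ι → ι → ℝ) (hc : ∀ i j, c i j = c j i) (v w : E) :
    ⟪Uf f c v, w⟫ = ⟪Uf f c w, v⟫ := by
  rw [Uf_inner, Uf_inner, Finset.sum_comm]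
  refine sum_congr rfl fun j _ => sum_congr rfl fun m _ => ?_
  rw [hc]; ring

lemma Uf_norm (f : OrthonormalBasis ι ℝ E) (c : ι → ι → ℝ) (v : E) : ‖Uf f c v‖ ^ 2 = ∑ j, (∑ m, c j m * ⟪v, f m⟫) ^ 2 := by
  rw [← f.sum_sq_norm_inner_right]
  refine sum_congr rfl fun j _ => ?_
  rw [real_inner_comm, Uf_inner]
  classical
  have h : ∀ j', ⟪f j, f j'⟫ = if j = j' then (1:ℝ) else 0 := fun j' => orthonormal_iff_ite.1 f.orthonormal j j'
  simp only [h]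
  simp

lemma qf_bl (f : OrthonormalBasis ι ℝ E) (c : ι → ι → ℝ) (hc : ∀ i j, c i j = c j i) (b : E) (k : ℝ) {p : Measure E} [IsProbabilityMeasure p] {R T : ℝ}
    (h : BS p R) (hT : 0 < T) (hp : SLC T p) :
    ∫ x, (qf f c b x - k) ^ 2 ∂p - (∫ x, (qf f c b x - k) ∂p) ^ 2 ≤ (4 / T) * ∫ x, ‖Uf f c (x - b)‖ ^ 2 ∂p := by
  obtain ⟨M, _, hM⟩ := h.bdd (f := fun x => qf f c b x - k) (by fun_prop)
  obtain ⟨B, _, hB⟩ := h.bdd (f := fun x => (2:ℝ) • Uf f c (x - b)) (by fun_prop)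
  have := hp.bl hT (u := fun x => qf f c b x - k) (G := fun x => (2:ℝ) • Uf f c (x - b)) (Continuous.measurable (by fun_prop)) (Continuous.measurable (by fun_prop)) hM hB ?_
  · refine this.trans (le_of_eq ?_)
    simp only [norm_smul, mul_pow, integral_const_mul]
    norm_num; ring
  · intro x y
    have e : (1/2:ℝ) • (x + y) - b = (1/2:ℝ) • ((x - b) + (y - b)) := by module
    have e2 : x - y = (x - b) - (y - b) := by abel
    rw [e, e2]
    simp only [qf]
    generalize x - b = x
    generalize y - b = y
    rw [Uf_smul, Uf_add, smul_smul, inner_smul_left, inner_add_left, inner_sub_right, inner_sub_right, Uf_symm f c hc y x]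
    simp
end

lemma cov_amgm {p : Measure E} [IsProbabilityMeasure p] {R : ℝ} (h : BS p R) {y z : E → ℝ} (hy : Continuous y) (hz : Continuous z)
    {α β : ℝ} (hα : 0 < α) (hβ : 0 < β) :
    ∫ x, y x * z x ∂p ≤ α * ∫ x, y x ^ 2 ∂p + (1 / (4 * α)) * (∫ x, z x ^ 2 ∂p - (∫ x, z x ∂p) ^ 2)
      + β * (∫ x, y x ∂p) ^ 2 + (1 / (4 * β)) * ∫ x, z x ^ 2 ∂p := by
  set a := ∫ x, y x ∂p
  set m := ∫ x, z x ∂p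
  have h0 : 0 ≤ ∫ x, (2 * α * (y x - a) - (z x - m)) ^ 2 ∂p := integral_nonneg fun x => by positivity
  have h1 : 0 ≤ ∫ x, (z x - m) ^ 2 ∂p := integral_nonneg fun x => by positivity
  have e0 : ∀ x, (2 * α * (y x - a) - (z x - m)) ^ 2 = (4 * α ^ 2) * y x ^ 2 - (4 * α) * (y x * z x) + z x ^ 2
     + ((-8 * α ^ 2 * a + 4 * α * m) * y x + (4 * α * a - 2 * m) * z x + (2 * α * a - m) ^ 2) := fun x => by ring
  have e1 : ∀ x, (z x - m) ^ 2 = z x ^ 2 - (2 * m) * z x + m ^ 2 := fun x => by ring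
  simp only [e0, e1] at h0 h1
  rw [integral_add (h.int (by fun_prop)) (h.int (by fun_prop)), integral_add (h.int (by fun_prop)) (h.int (by fun_prop)),
    integral_sub (h.int (by fun_prop)) (h.int (by fun_prop)), integral_add (h.int (by fun_prop)) (h.int (by fun_prop)),
    integral_add (h.int (by fun_prop)) (h.int (by fun_prop))] at h0
  rw [integral_add (h.int (by fun_prop)) (h.int (by fun_prop)), integral_sub (h.int (by fun_prop)) (h.int (by fun_prop))] at h1
  simp only [integral_const_mul, integral_const, probReal_univ, smul_eq_mul, one_mul] at h0 h1
  change 0 ≤ _ - 2 * m * m + _ at h1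
  change 0 ≤ 4 * α ^ 2 * _ - _ + _ + ((-8 * α ^ 2 * a + 4 * α * m) * a + (4 * α * a - 2 * m) * m + _) at h0
  set I1 := ∫ x, y x ^ 2 ∂p
  set I2 := ∫ x, z x ^ 2 ∂p
  set I3 := ∫ x, y x * z x ∂p
  have h2 : I3 - a * m ≤ α * I1 + (1 / (4 * α)) * (I2 - m ^ 2) := by
    have h3 : 4 * α * (I3 - a * m) ≤ 4 * α ^ 2 * I1 + (I2 - m ^ 2) := by linarith [sq_nonneg (α * a)]
    have : α * I1 + (1 / (4 * α)) * (I2 - m ^ 2) = (4 * α ^ 2 * I1 + (I2 - m ^ 2)) / (4 * α) := by field_simp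
    rw [this, le_div_iff₀ (by positivity)]; linarith
  have h3 : a * m ≤ β * a ^ 2 + (1 / (4 * β)) * I2 := by
    have h4 : 4 * β * (a * m) ≤ 4 * β ^ 2 * a ^ 2 + I2 := by linarith [sq_nonneg (2 * β * a - m)]
    have : β * a ^ 2 + (1 / (4 * β)) * I2 = (4 * β ^ 2 * a ^ 2 + I2) / (4 * β) := by field_simp
    rw [this, le_div_iff₀ (by positivity)]; linarith
  linarith

open Classical in
def cc (p : Measure E) (i j m : Fin (finrank ℝ E)) : ℝ :=
  if ev p j ≤ ev p i ∧ ev p m ≤ ev p i then u3 p (eb p i) (eb p j) (eb p m) else 0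
def SS (p : Measure E) (i : Fin (finrank ℝ E)) : ℝ := ∑ j, ∑ m, cc p i j m ^ 2

section
variable {p : Measure E} [IsProbabilityMeasure p] {R : ℝ}

lemma cc_symm (h : BS p R) (i j m) : cc p i j m = cc p i m j := by
  unfold cc; rw [(u3_perm h _ _ _).2]; simp only [and_comm]

lemma SS_nonneg (i) : 0 ≤ SS p i := Finset.sum_nonneg fun _ _ => Finset.sum_nonneg fun _ _ => by positivity

lemma eb_cov (h : BS p R) (j m) : ∫ x, ⟪x - bar p, eb p j⟫ * ⟪x - bar p, eb p m⟫ ∂p = if j = m then ev p m else 0 := by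
  rw [← cov_inner h, cov_eb, inner_smul_right, orthonormal_iff_ite.1 (eb p).orthonormal j m]; simp

lemma SS_cov (h : BS p R) (i) (k : ℝ) : ∫ x, ⟪x - bar p, eb p i⟫ * (qf (eb p) (cc p i) (bar p) x - k) ∂p = SS p i := by
  have e : ∀ x : E, ⟪x - bar p, eb p i⟫ * (qf (eb p) (cc p i) (bar p) x - k) = ∑ j, ∑ m, cc p i j m * (⟪x - bar p, eb p i⟫ * ⟪x - bar p, eb p j⟫ * ⟪x - bar p, eb p m⟫)
     - k * (⟪x, eb p i⟫ - ⟪bar p, eb p i⟫) := fun x => by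
    rw [mul_sub, qf, Uf_inner, mul_sum, ← inner_sub_left]
    congr 1
    · refine sum_congr rfl fun j _ => ?_
      rw [mul_sum]
      refine sum_congr rfl fun m _ => ?_
      ring
    · ring
  simp only [e]
  rw [integral_sub (h.int (by fun_prop)) (h.int (by fun_prop)), integral_const_mul, integral_sub (h.int (by fun_prop)) (h.int (by fun_prop)), ← inner_bar h]
  simp only [integral_const, probReal_univ, smul_eq_mul, one_mul, sub_self, mul_zero, sub_zero]
  rw [integral_finsetSum _ fun j _ => h.int (by fun_prop)]
  refine sum_congr rfl fun j _ => ?_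
  rw [integral_finsetSum _ fun j _ => h.int (by fun_prop)]
  refine sum_congr rfl fun m _ => ?_
  rw [integral_const_mul, ← u3_eq h]
  unfold cc; split_ifs
  · ring
  · simp

lemma Uf_int (h : BS p R) (i) : ∫ x, ‖Uf (eb p) (cc p i) (x - bar p)‖ ^ 2 ∂p ≤ ev p i * SS p i := by
  simp only [Uf_norm]
  rw [integral_finsetSum _ fun j _ => h.int (by fun_prop), SS, mul_sum]
  refine sum_le_sum fun j _ => ?_
  have e : ∀ x : E, (∑ m, cc p i j m * ⟪x - bar p, eb p m⟫) ^ 2 = ∑ m, ∑ m', (cc p i j m * cc p i j m') * (⟪x - bar p, eb p m⟫ * ⟪x - bar p, eb p m'⟫) := fun x => by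
    rw [sq, Finset.sum_mul_sum]
    refine sum_congr rfl fun j _ => sum_congr rfl fun m _ => ?_
    ring
  simp only [e]
  rw [integral_finsetSum _ fun j _ => h.int (by fun_prop), mul_sum]
  refine sum_le_sum fun m _ => ?_
  rw [integral_finsetSum _ fun j _ => h.int (by fun_prop)]
  simp only [integral_const_mul, eb_cov h]
  simp only [mul_ite, mul_zero, Finset.sum_ite_eq, Finset.mem_univ, if_true]
  unfold cc; split_ifs with hh
  · nlinarith [hh.2, mul_self_nonneg (u3 p (eb p i) (eb p j) (eb p m))]
  · simp

lemma SS_le (h : BS p R) {t : ℝ} (ht : 0 < t) (hp : SLC t p) (i) : SS p i ≤ 4 * ev p i ^ 2 / t := by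
  have h0 := SS_nonneg (p := p) i
  have hl := ev_nonneg h i
  by_cases hz : ev p i = 0
  · have h1 : ∀ j m, cc p i j m ^ 2 = 0 := fun j m => by
      unfold cc; split_ifs with hh
      · have : ev p j = 0 := le_antisymm (hz ▸ hh.1) (ev_nonneg h j)
        have hj := ev_eq h j
        rw [this, eq_comm, integral_eq_zero_iff_of_nonneg (fun x => by positivity) (h.int (by fun_prop))] at hj
        rw [(u3_perm h _ _ _).1, u3_eq h]
        have : ∫ x, ⟪x - bar p, eb p j⟫ * ⟪x - bar p, eb p i⟫ * ⟪x - bar p, eb p m⟫ ∂p = ∫ x, (0:ℝ) ∂p := by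
          refine integral_congr_ae ?_
          filter_upwards [hj] with x hx
          have : ⟪x - bar p, eb p j⟫ = 0 := by simpa using hx
          simp [this]
        rw [this]; simp
      · simp
    rw [SS]; simp [h1, hz]
  · have hl : 0 < ev p i := lt_of_le_of_ne hl (Ne.symm hz)
    set k := ∫ x, qf (eb p) (cc p i) (bar p) x ∂p
    have a2 := qf_bl (eb p) (cc p i) (cc_symm h i) (bar p) k h ht hp
    have a3 := Uf_int h i
    have a4 : ∫ x, (qf (eb p) (cc p i) (bar p) x - k) ∂p = 0 := by
      rw [integral_sub (h.int (by fun_prop)) (h.int (by fun_prop))]; simp [k]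
    have h0' : 0 ≤ ∫ x, (4 * ev p i / t * ⟪x - bar p, eb p i⟫ - (qf (eb p) (cc p i) (bar p) x - k)) ^ 2 ∂p := integral_nonneg fun x => by positivity
    have e0 : ∀ x : E, (4 * ev p i / t * ⟪x - bar p, eb p i⟫ - (qf (eb p) (cc p i) (bar p) x - k)) ^ 2 = (4 * ev p i / t) ^ 2 * ⟪x - bar p, eb p i⟫ ^ 2
      - (2 * (4 * ev p i / t)) * (⟪x - bar p, eb p i⟫ * (qf (eb p) (cc p i) (bar p) x - k)) + (qf (eb p) (cc p i) (bar p) x - k) ^ 2 := fun x => by ring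
    simp only [e0] at h0'
    rw [integral_add (h.int (by fun_prop)) (h.int (by fun_prop)), integral_sub (h.int (by fun_prop)) (h.int (by fun_prop)), integral_const_mul,
      integral_const_mul, SS_cov h, ← ev_eq h] at h0'
    rw [a4] at a2
    set Q := ∫ x, (qf (eb p) (cc p i) (bar p) x - k) ^ 2 ∂p
    have a7 : Q ≤ 4 / t * (ev p i * SS p i) := by
      have := mul_le_mul_of_nonneg_left a3 (by positivity : 0 ≤ 4 / t)
      linarith
    have a8 : 4 * ev p i / t * SS p i ≤ (4 * ev p i / t) ^ 2 * ev p i := by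
      have : 4 / t * (ev p i * SS p i) = 4 * ev p i / t * SS p i := by ring
      linarith
    have a9 : SS p i ≤ 4 * ev p i / t * ev p i := by
      have hpos : 0 < 4 * ev p i / t := by positivity
      nlinarith
    calc _ ≤ _ := a9
      _ = _ := by ring
end

end

section


section
variable {p : Measure E} [IsProbabilityMeasure p] {R : ℝ}

lemma D2_sq (x c : ℝ) : fderiv ℝ (fderiv ℝ (fun x : ℝ => x ^ 2)) x c c = 2 * c ^ 2 := by
  refine D2_curve (by fun_prop) x c (g' := fun s => 2 * (x + s * c) * c) (fun s => ?_) ?_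
  · have : HasDerivAt (fun s : ℝ => x + s • c) c s := by simpa using ((hasDerivAt_id s).smul_const c).const_add x
    exact (this.pow 2).congr_deriv (by simp)
  · have : HasDerivAt (fun s : ℝ => x + s * c) c 0 := by simpa using ((hasDerivAt_id (0:ℝ)).mul_const c).const_add x
    exact ((this.const_mul 2).mul_const c).congr_deriv (by ring)

lemma cv_lin (h : BS p R) (q : ℝ × E) (b v e : E) :
    cv p q (fun x => exL x (0, e)) (fun x => ⟪x - b, v⟫) = ⟪e, cov (tl p q) v⟫ := by
  have := h.tl_prob q
  have hq := h.tl q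
  have e0 : ∀ x : E, exL x (0, e) = ⟪x, e⟫ := fun x => by rw [exL_apply]; simp [real_inner_comm]
  simp only [cv, MM, e0, smul_eq_mul, inner_sub_left, mul_sub]
  rw [integral_sub (hq.int (by fun_prop)) (hq.int (by fun_prop)), integral_sub (hq.int (by fun_prop)) (hq.int (by fun_prop)), cov_raw hq,
    integral_mul_const, ← inner_bar hq, ← inner_bar hq]
  simp; ring

lemma itoD_lin (h : BS p R) (b v : E) (q : ℝ × E) :
    itoD p (stdOrthonormalBasis ℝ E) (fun x => ⟪x - b, v⟫) (fun x : ℝ => x ^ 2) q = ‖cov (tl p q) v‖ ^ 2 := by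
  simp only [itoD, D2_sq, cv_lin h]
  rw [← mul_sum, ← (stdOrthonormalBasis ℝ E).sum_sq_norm_inner_right]
  simp

lemma covn_cont (h : BS p R) (v : E) : Continuous (fun q => ‖cov (tl p q) v‖ ^ 2) := by
  have := itoD_cont h (stdOrthonormalBasis ℝ E) (φ := fun x => ⟪x - 0, v⟫) (by fun_prop) (Φ := fun x : ℝ => x ^ 2) (by fun_prop)
  exact (funext fun q => itoD_lin h 0 v q) ▸ this

lemma covn_bdd (h : BS p R) (v : E) : ∃ D, ∀ q, |‖cov (tl p q) v‖ ^ 2| ≤ D := by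
  obtain ⟨D, _, hD⟩ := itoD_bdd h (stdOrthonormalBasis ℝ E) (φ := fun x => ⟪x - 0, v⟫) (by fun_prop) (Φ := fun x : ℝ => x ^ 2) (by fun_prop)
  exact ⟨D, fun q => by rw [← itoD_lin h 0 v q]; exact hD q⟩

lemma bar_c (h : BS p R) (v : E) : ∫ x, ⟪x - bar p, v⟫ ∂p = 0 := by
  simp only [inner_sub_left]
  rw [integral_sub (h.int (by fun_prop)) (h.int (by fun_prop)), ← inner_bar h]; simp

lemma tl_zero : tl p 0 = p := by
  simp [tl]

lemma VV (h : BS p R) {d : ℝ} (hd : 0 ≤ d) (v : E) :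
    EE p d (fun q => (MM p (fun x => ⟪x - bar p, v⟫) q) ^ 2) = ∫ s in (0:ℝ)..d, EE p s (fun q => ‖cov (tl p q) v‖ ^ 2) := by
  have := ito_int h (φ := fun x => ⟪x - bar p, v⟫) (by fun_prop) (Φ := fun x : ℝ => x ^ 2) (by fun_prop) hd (stdOrthonormalBasis ℝ E)
  have e : itoD p (stdOrthonormalBasis ℝ E) (fun x => ⟪x - bar p, v⟫) (fun x : ℝ => x ^ 2) = fun q => ‖cov (tl p q) v‖ ^ 2 :=
    funext fun q => itoD_lin h _ v q
  rw [this, e, MM, tl_zero, bar_c h]; simp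

lemma look (h : BS p R) {t d K : ℝ} (ht : 0 < t) (hp : SLC t p) (hd : 0 ≤ d) (hK0 : 0 < K) (i) (hK : ev p i ≤ K) :
    SS p i ≤ 8 * K ^ 2 / (t + d) + 8 * K / t * ∫ s in (0:ℝ)..d, EE p s (fun q => ‖cov (tl p q) (eb p i)‖ ^ 2) := by
  rw [← VV h hd]
  set k := ∫ x, qf (eb p) (cc p i) (bar p) x ∂p with hk
  set y : E → ℝ := fun x => ⟪x - bar p, eb p i⟫ with hy
  set z : E → ℝ := fun x => qf (eb p) (cc p i) (bar p) x - k with hz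
  set w : E → ℝ := fun x => ‖Uf (eb p) (cc p i) (x - bar p)‖ ^ 2 with hw
  have cy : Continuous y := by fun_prop
  have cz : Continuous z := by fun_prop
  have cw : Continuous w := by fun_prop
  have hT : 0 < t + d := by linarith
  set α := 4 * K / (t + d)
  set β := 4 * K / t
  have hα : 0 < α := by positivity
  have hβ : 0 < β := by positivity
  set S := SS p i
  have S0 : 0 ≤ S := SS_nonneg i
  set G : ℝ × E → ℝ := fun q => MM p (fun x => α * y x ^ 2 + (1 / (4 * α)) * (4 / (t + d)) * w x + (1 / (4 * β)) * z x ^ 2) q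
      + β * (MM p y q) ^ 2
  have pt : ∀ θ : E, MM p (fun x => y x * z x) (d, θ) ≤ G (d, θ) := fun θ => by
    have := h.tl_prob (d, θ)
    have hq := h.tl (d, θ)
    have sq := LC.tl_slc h hp (d, θ)
    have a1 := cov_amgm hq cy cz hα hβ
    have a2 := qf_bl (eb p) (cc p i) (cc_symm h i) (bar p) k hq hT sq
    simp only [G, MM]
    rw [integral_add (hq.int (by fun_prop)) (hq.int (by fun_prop)), integral_add (hq.int (by fun_prop)) (hq.int (by fun_prop)),
      integral_const_mul, integral_const_mul, integral_const_mul]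
    have a3 := mul_le_mul_of_nonneg_left a2 (by positivity : 0 ≤ 1 / (4 * α))
    simp only [← mul_assoc] at a3
    linarith
  obtain ⟨D1, _, b1⟩ := bdd_MM h (φ := fun x => y x * z x) (by fun_prop)
  have cf : Continuous (fun x => α * y x ^ 2 + (1 / (4 * α)) * (4 / (t + d)) * w x + (1 / (4 * β)) * z x ^ 2) := by fun_prop
  obtain ⟨D2, _, b2⟩ := bdd_MM h cf
  obtain ⟨D3, p3, b3⟩ := bdd_MM h cy
  have c3 := cont_MM h cy
  have b3' : ∀ q, |(MM p y q) ^ 2| ≤ D3 ^ 2 := fun q => by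
    rw [abs_pow]; exact pow_le_pow_left₀ (abs_nonneg _) (b3 q) 2
  have b4 : ∀ q, |β * (MM p y q) ^ 2| ≤ β * D3 ^ 2 := fun q => by
    rw [abs_mul, abs_of_pos hβ]; exact mul_le_mul_of_nonneg_left (b3' q) hβ.le
  have hG : ∀ q, |G q| ≤ D2 + β * D3 ^ 2 := fun q => (abs_add_le _ _).trans (add_le_add (b2 q) (b4 q))
  have cG : Continuous G := by
    have := cont_MM h cf
    simp only [G]; fun_prop
  have m := EE_mono h (F := fun q => MM p (fun x => y x * z x) q) (G := G) b1 (cont_MM h (by fun_prop)) hG cG hd pt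
  rw [EE_M h (by fun_prop), SS_cov h i k, EE_add h b2 (cont_MM h cf) b4 (by fun_prop) hd, EE_M h cf hd, EE_cmul,
    integral_add (h.int (by fun_prop)) (h.int (by fun_prop)), integral_add (h.int (by fun_prop)) (h.int (by fun_prop)),
      integral_const_mul, integral_const_mul, integral_const_mul, ← ev_eq h] at m
  · have u1 := Uf_int h i
    have a2 := qf_bl (eb p) (cc p i) (cc_symm h i) (bar p) k h ht hp
    have a4 : ∫ x, (qf (eb p) (cc p i) (bar p) x - k) ∂p = 0 := by
      rw [integral_sub (h.int (by fun_prop)) (h.int (by fun_prop))]; simp [k]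
    rw [a4] at a2
    have u2 : ∫ x, w x ∂p ≤ K * S := u1.trans (mul_le_mul_of_nonneg_right hK S0)
    have u3 : ∫ x, z x ^ 2 ∂p ≤ 4 / t * (K * S) := by
      have := mul_le_mul_of_nonneg_left u2 (by positivity : 0 ≤ 4 / t)
      linarith
    have v1 : α * ev p i ≤ 4 * K ^ 2 / (t + d) := by
      have := mul_le_mul_of_nonneg_left hK hα.le
      have e : α * K = 4 * K ^ 2 / (t + d) := by simp only [α]; ring
      linarith
    have v2 : 1 / (4 * α) * (4 / (t + d)) * ∫ x, w x ∂p ≤ S / 4 := by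
      have := mul_le_mul_of_nonneg_left u2 (by positivity : 0 ≤ 1 / (4 * α) * (4 / (t + d)))
      have e : 1 / (4 * α) * (4 / (t + d)) * (K * S) = S / 4 := by simp only [α]; field_simp
      linarith
    have v3 : 1 / (4 * β) * ∫ x, z x ^ 2 ∂p ≤ S / 4 := by
      have := mul_le_mul_of_nonneg_left u3 (by positivity : 0 ≤ 1 / (4 * β))
      have e : 1 / (4 * β) * (4 / t * (K * S)) = S / 4 := by simp only [β]; field_simp
      linarith
    have e1 : 8 * K ^ 2 / (t + d) = 2 * (4 * K ^ 2 / (t + d)) := by ring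
    have e2 : 8 * K / t = 2 * β := by simp only [β]; ring
    rw [e1, e2]
    linarith
  · exact hd

lemma wsum (h : BS p R) {p' : Measure E} [IsProbabilityMeasure p'] (h' : BS p' R) {D ψ : ℝ → ℝ} {K : ℝ}
    (D0 : ∀ x, 0 ≤ D x) (D1 : ∀ x, D x ≤ 1) (ψ0 : ∀ x, 0 ≤ ψ x) (hψ : ∀ x, 0 ≤ x → x ^ 2 ≤ K ^ 2 + 8 * ψ x) :
    ∑ i, D (ev p i) * ‖cov p' (eb p i)‖ ^ 2 ≤ K ^ 2 * trf D p + 8 * trf ψ p' := by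
  have e : ∀ i, ‖cov p' (eb p i)‖ ^ 2 = ∑ j, ev p' j ^ 2 * ⟪eb p i, eb p' j⟫ ^ 2 := fun i => by
    rw [← (eb p').sum_sq_norm_inner_right]
    refine sum_congr rfl fun j _ => ?_
    have : ⟪cov p' (eb p' j), eb p i⟫ = ⟪eb p' j, cov p' (eb p i)⟫ := cov_symm p' (eb p' j) (eb p i)
    rw [← this, cov_eb, inner_smul_left, real_inner_comm]
    simp [mul_pow]
  have n1 : ∀ i, ∑ j, ⟪eb p i, eb p' j⟫ ^ 2 = 1 := fun i => by
    have := (eb p').sum_sq_norm_inner_left (eb p i)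
    rw [(eb p).orthonormal.1 i] at this; simpa using this
  have n2 : ∀ j, ∑ i, ⟪eb p i, eb p' j⟫ ^ 2 = 1 := fun i => by
    have := (eb p).sum_sq_norm_inner_right (eb p' i)
    rw [(eb p').orthonormal.1 i] at this; simpa using this
  calc ∑ i, D (ev p i) * ‖cov p' (eb p i)‖ ^ 2 = ∑ i, ∑ j, D (ev p i) * (ev p' j ^ 2 * ⟪eb p i, eb p' j⟫ ^ 2) := by simp only [e, mul_sum]
    _ ≤ ∑ i, ∑ j, (K ^ 2 * (D (ev p i) * ⟪eb p i, eb p' j⟫ ^ 2) + 8 * (ψ (ev p' j) * ⟪eb p i, eb p' j⟫ ^ 2)) := by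
        refine sum_le_sum fun i _ => sum_le_sum fun j _ => ?_
        have a := hψ _ (ev_nonneg h' j)
        have b := D0 (ev p i); have b1 := D1 (ev p i); have c := ψ0 (ev p' j)
        have w := sq_nonneg ⟪eb p i, eb p' j⟫
        have : D (ev p i) * ev p' j ^ 2 ≤ K ^ 2 * D (ev p i) + 8 * ψ (ev p' j) := by nlinarith
        nlinarith
    _ = K ^ 2 * ∑ i, D (ev p i) * ∑ j, ⟪eb p i, eb p' j⟫ ^ 2 + 8 * ∑ j, ψ (ev p' j) * ∑ i, ⟪eb p i, eb p' j⟫ ^ 2 := by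
        simp only [Finset.sum_add_distrib]
        simp only [mul_sum]
        congr 1
        rw [Finset.sum_comm]
    _ = _ := by simp only [n1, n2, mul_one]; rfl

lemma EE_sum (h : BS p R) {ι : Type*} [Fintype ι] (c : ι → ℝ) {F : ι → ℝ × E → ℝ} (hF : ∀ i, ∃ D, ∀ q, |F i q| ≤ D) (cF : ∀ i, Continuous (F i))
    {s : ℝ} (hs : 0 ≤ s) : EE p s (fun q => ∑ i, c i * F i q) = ∑ i, c i * EE p s (F i) := by
  simp only [EE, mul_sum]
  choose D hD using hF
  rw [integral_finsetSum]
  · refine sum_congr rfl fun i _ => ?_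
    rw [← integral_const_mul]; congr 1; ext g; ring
  · intro i _
    have := (EE_int h (hD i) (cF i) hs).const_mul (c i)
    refine this.congr (of_forall fun g => ?_)
    simp only []; ring

lemma trf_bdd {μ : Measure E} [IsProbabilityMeasure μ] (h : BS μ R) {ψ : ℝ → ℝ} (cψ : Continuous ψ) : ∃ D, ∀ q, |trf ψ (tl μ q)| ≤ D := by
  obtain ⟨C, hC⟩ := (isCompact_Icc (a := (0:ℝ)) (b := R ^ 2)).exists_bound_of_continuousOn cψ.continuousOn
  refine ⟨∑ i : Fin (finrank ℝ E), C, fun q => (Finset.abs_sum_le_sum_abs _ _).trans (sum_le_sum fun i _ => ?_)⟩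
  have := h.tl_prob q
  exact hC _ ⟨ev_nonneg (h.tl q) i, ev_le (h.tl q) i⟩

lemma trf_cont {μ : Measure E} [IsProbabilityMeasure μ] (h : BS μ R) {ψ : ℝ → ℝ} (cψ : Continuous ψ) : Continuous (fun q => trf ψ (tl μ q)) := by
  refine continuous_of_uniform_approx_of_continuous fun u hu => ?_
  obtain ⟨ε, e0, he⟩ := Metric.mem_uniformity_dist.1 hu
  set n := finrank ℝ E
  obtain ⟨P, hP⟩ := exists_polynomial_near_of_continuousOn 0 (R ^ 2) ψ cψ.continuousOn (ε / (n + 1)) (by positivity)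
  refine ⟨fun q => trf (fun x => P.eval x) (tl μ q), ?_, fun q => he ?_⟩
  · have := (cd_Phi (E := E) P).continuous.comp (cont_MM h (φ := ph) cont_ph)
    exact (funext fun q => Phi_MM h P q) ▸ this
  · have := h.tl_prob q
    simp only [Real.dist_eq, trf]
    rw [← Finset.sum_sub_distrib]
    calc _ ≤ ∑ i : Fin n, ε / (n + 1) := (Finset.abs_sum_le_sum_abs _ _).trans (sum_le_sum fun i _ => by
            rw [abs_sub_comm]; exact (hP _ ⟨ev_nonneg (h.tl q) i, ev_le (h.tl q) i⟩).le)
      _ = n * (ε / (n + 1)) := by simp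
      _ < ε := by
        rw [mul_div, div_lt_iff₀ (by positivity)]; linarith

/-- main pointwise estimate -/
lemma total (h : BS p R) {t d K : ℝ} (ht : 0 < t) (hp : SLC t p) (hd : 0 ≤ d) (hK0 : 0 < K) {D ψ : ℝ → ℝ}
    (D0 : ∀ x, 0 ≤ D x) (D1 : ∀ x, D x ≤ 1) (ψ0 : ∀ x, 0 ≤ ψ x) (cψ : Continuous ψ) (hψ : ∀ x, 0 ≤ x → x ^ 2 ≤ K ^ 2 + 8 * ψ x)
    (hψ2 : ∀ x, K < x → x ^ 2 ≤ 8 * ψ x) :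
    ∑ i, D (ev p i) * SS p i ≤ (8 * K ^ 2 / (t + d) + 8 * K ^ 3 * d / t) * trf D p
      + 64 * K / t * (∫ s in (0:ℝ)..d, EE p s (fun q => trf ψ (tl p q))) + 32 / t * trf ψ p := by
  have pt : ∀ i, D (ev p i) * SS p i ≤ D (ev p i) * (8 * K ^ 2 / (t + d)) + 8 * K / t *
      (∫ s in (0:ℝ)..d, D (ev p i) * EE p s (fun q => ‖cov (tl p q) (eb p i)‖ ^ 2)) + 32 / t * ψ (ev p i) := fun i => by
    rw [intervalIntegral.integral_const_mul]
    have i0 : 0 ≤ ∫ s in (0:ℝ)..d, EE p s (fun q => ‖cov (tl p q) (eb p i)‖ ^ 2) :=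
      intervalIntegral.integral_nonneg hd fun s _ => EE_nonneg h fun θ => by positivity
    have d0 := D0 (ev p i); have d1 := D1 (ev p i); have p0 := ψ0 (ev p i)
    by_cases hi : ev p i ≤ K
    · have := mul_le_mul_of_nonneg_left (look h ht hp hd hK0 i hi) d0
      have : 0 ≤ 32 / t * ψ (ev p i) := by positivity
      linarith
    · have a := SS_le h ht hp i
      have b := hψ2 _ (not_le.1 hi)
      have c : SS p i ≤ 32 / t * ψ (ev p i) := a.trans (by
        have := mul_le_mul_of_nonneg_left b (by positivity : 0 ≤ 4 / t)
        calc _ = 4 / t * ev p i ^ 2 := by ring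
          _ ≤ _ := this
          _ = _ := by ring)
      have : D (ev p i) * SS p i ≤ SS p i := mul_le_of_le_one_left (SS_nonneg i) d1
      have : 0 ≤ D (ev p i) * (8 * K ^ 2 / (t + d)) := by positivity
      have : 0 ≤ 8 * K / t * (D (ev p i) * ∫ s in (0:ℝ)..d, EE p s (fun q => ‖cov (tl p q) (eb p i)‖ ^ 2)) := by positivity
      linarith
  refine (sum_le_sum fun i _ => pt i).trans ?_
  rw [Finset.sum_add_distrib, Finset.sum_add_distrib, ← Finset.sum_mul, ← mul_sum, ← mul_sum]
  have cE : ∀ i, ContinuousOn (fun s => EE p s (fun q => ‖cov (tl p q) (eb p i)‖ ^ 2)) (Icc 0 d) := fun i => by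
    obtain ⟨B, hB⟩ := covn_bdd h (eb p i)
    exact (EE_contOn h hB (covn_cont h _)).mono Icc_subset_Ici_self
  obtain ⟨B, hB⟩ := trf_bdd h cψ
  have cψ' := trf_cont h cψ
  have cψE := (EE_contOn h hB cψ').mono (Icc_subset_Ici_self (a := d))
  have key : ∑ i, (∫ s in (0:ℝ)..d, D (ev p i) * EE p s (fun q => ‖cov (tl p q) (eb p i)‖ ^ 2)) ≤
      d * (K ^ 2 * trf D p) + 8 * ∫ s in (0:ℝ)..d, EE p s (fun q => trf ψ (tl p q)) := by
    rw [← intervalIntegral.integral_finsetSum fun i _ => ((cE i).const_mul _).intervalIntegrable_of_Icc hd, ← intervalIntegral.integral_const_mul]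
    have : d * (K ^ 2 * trf D p) = ∫ s in (0:ℝ)..d, K ^ 2 * trf D p := by
      rw [intervalIntegral.integral_const]; simp
    rw [this, ← intervalIntegral.integral_add (by simp) ((cψE.const_mul _).intervalIntegrable_of_Icc hd)]
    refine intervalIntegral.integral_mono_on hd ((continuousOn_finsetSum _ fun i _ => (cE i).const_mul _).intervalIntegrable_of_Icc hd)
      ((cψE.const_mul 8).const_add (K ^ 2 * trf D p) |>.intervalIntegrable_of_Icc hd) fun s hs => ?_
    rw [← EE_sum h _ (fun i => covn_bdd h _) (fun i => covn_cont h _) hs.1]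
    have b8 : ∀ q, |8 * trf ψ (tl p q)| ≤ 8 * B := fun q => by
      rw [abs_mul]; norm_num; exact hB q
    rw [← EE_cmul, ← EE_const h (K ^ 2 * trf D p) hs.1, ← EE_add h (D := |K ^ 2 * trf D p|) (fun _ => le_rfl) continuous_const b8 (by fun_prop) hs.1]
    choose B' hB' using fun i => covn_bdd h (eb p i)
    refine EE_mono h (D := ∑ i, |D (ev p i)| * B' i) (D' := |K ^ 2 * trf D p| + 8 * B) (fun q => ?_) (continuous_finsetSum _ fun i _ => (covn_cont h _).const_mul _) (fun q => (abs_add_le _ _).trans (add_le_add le_rfl (b8 q)))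
      (by fun_prop) hs.1 fun θ => ?_
    · refine (Finset.abs_sum_le_sum_abs _ _).trans (sum_le_sum fun i _ => ?_)
      rw [abs_mul]; exact mul_le_mul_of_nonneg_left (hB' i q) (abs_nonneg _)
    · have := h.tl_prob (s, θ)
      exact wsum h (h.tl _) D0 D1 ψ0 hψ
  have := mul_le_mul_of_nonneg_left key (by positivity : 0 ≤ 8 * K / t)
  have e : trf D p = ∑ i, D (ev p i) := rfl
  have e' : trf ψ p = ∑ i, ψ (ev p i) := rfl
  rw [← e, ← e']
  calc _ ≤ trf D p * (8 * K ^ 2 / (t + d)) + 8 * K / t * (d * (K ^ 2 * trf D p) + 8 * ∫ s in (0:ℝ)..d, EE p s (fun q => trf ψ (tl p q))) + 32 / t * trf ψ p := by linarith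
    _ = _ := by ring
end

end

section


section
variable {p : Measure E} [IsProbabilityMeasure p] {R : ℝ}

lemma bar_le (h : BS p R) : ‖bar p‖ ≤ R := by
  have := norm_integral_le_of_norm_le_const (μ := p) (f := fun x : E => x) h
  simpa [probReal_univ, bar] using this

lemma u3_le (h : BS p R) {e v w : E} (he : ‖e‖ = 1) (hv : ‖v‖ = 1) (hw : ‖w‖ = 1) : |u3 p e v w| ≤ (2 * R) ^ 3 := by
  have hb := bar_le h
  have : ‖V3 p v w‖ ≤ (2 * R) ^ 3 := by
    have := norm_integral_le_of_norm_le_const (μ := p) (f := fun x => (inner ℝ (x - bar p) v * inner ℝ (x - bar p) w) • (x - bar p))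
      (C := (2 * R) ^ 3) ?_
    · simpa [probReal_univ, V3] using this
    · filter_upwards [h] with x hx
      have h1 : ‖x - bar p‖ ≤ 2 * R := (norm_sub_le _ _).trans (by linarith)
      have a := norm_inner_le_norm (𝕜 := ℝ) (x - bar p) v
      have b := norm_inner_le_norm (𝕜 := ℝ) (x - bar p) w
      rw [hv, mul_one] at a; rw [hw, mul_one] at b
      rw [norm_smul, norm_mul, pow_succ, pow_two]
      have := h1.trans' (norm_nonneg _)
      exact mul_le_mul (mul_le_mul (a.trans h1) (b.trans h1) (norm_nonneg _) this) h1 (norm_nonneg _) (by positivity)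
  have a := norm_inner_le_norm (𝕜 := ℝ) e (V3 p v w)
  rw [he, one_mul] at a
  exact a.trans this

lemma dd_le {P : Polynomial ℝ} {L dd} (hnc : NC E P L dd) {D : ℝ → ℝ} (mD : Monotone D) {ε B : ℝ}
    (hP : ∀ x ∈ Icc 0 B, |(Polynomial.derivative P).eval x - D x| ≤ ε) {x y : ℝ} (hx : x ∈ Icc 0 B) (hy : y ∈ Icc 0 B) :
    dd x y ≤ D (max x y) + ε := by
  have aux : ∀ a b, a ∈ Icc 0 B → b ∈ Icc 0 B → a < b → ∀ z, (b - a) * z = P.eval b - P.eval a → z ≤ D b + ε := by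
    intro a b ha hb hab z hz
    obtain ⟨c, hc, e⟩ := exists_hasDerivAt_eq_slope (fun x => P.eval x) (fun x => (Polynomial.derivative P).eval x) hab
      P.continuous.continuousOn (fun x _ => P.hasDerivAt x)
    have : z = (Polynomial.derivative P).eval c := by
      rw [e, eq_div_iff (by linarith)]; linarith
    have := abs_le.1 (hP c ⟨ha.1.trans hc.1.le, hc.2.le.trans hb.2⟩)
    have := mD hc.2.le
    linarith
  rcases lt_trichotomy x y with h | h | h
  · rw [max_eq_right h.le]; exact aux x y hx hy h _ (by have := hnc.dif x y; linarith)
  · subst h; rw [max_self, hnc.diag]; linarith [abs_le.1 (hP x hx)]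
  · rw [max_eq_left h.le]; exact aux y x hy hx h _ (hnc.dif x y)

lemma three (h : BS p R) {D : ℝ → ℝ} (mD : Monotone D) (D0 : ∀ x, 0 ≤ D x) :
    ∑ i, ∑ j, ∑ m, D (max (ev p i) (ev p j)) * u3 p (eb p m) (eb p i) (eb p j) ^ 2 ≤ 3 * ∑ i, D (ev p i) * SS p i := by
  have key : ∀ i j m, D (max (ev p i) (ev p j)) * u3 p (eb p m) (eb p i) (eb p j) ^ 2 ≤
      D (ev p i) * cc p i j m ^ 2 + D (ev p j) * cc p j i m ^ 2 + D (ev p m) * cc p m i j ^ 2 := by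
    intro i j m
    have e1 : u3 p (eb p i) (eb p j) (eb p m) = u3 p (eb p m) (eb p i) (eb p j) := by
      rw [(u3_perm h _ _ _).2, (u3_perm h _ _ _).1]
    have e2 : u3 p (eb p j) (eb p i) (eb p m) = u3 p (eb p m) (eb p i) (eb p j) := by
      rw [(u3_perm h _ _ _).1, e1]
    have n1 := D0 (ev p i); have n2 := D0 (ev p j); have n3 := D0 (ev p m)
    have q1 : 0 ≤ D (ev p i) * cc p i j m ^ 2 := by positivity
    have q2 : 0 ≤ D (ev p j) * cc p j i m ^ 2 := by positivity
    have q3 : 0 ≤ D (ev p m) * cc p m i j ^ 2 := by positivity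
    by_cases a : ev p j ≤ ev p i ∧ ev p m ≤ ev p i
    · have : cc p i j m = u3 p (eb p m) (eb p i) (eb p j) := by rw [cc, if_pos a, e1]
      rw [max_eq_left a.1, ← this]; linarith
    by_cases b : ev p i ≤ ev p j ∧ ev p m ≤ ev p j
    · have : cc p j i m = u3 p (eb p m) (eb p i) (eb p j) := by rw [cc, if_pos b, e2]
      rw [max_eq_right b.1, ← this]; linarith
    have c : ev p i ≤ ev p m ∧ ev p j ≤ ev p m := by
      rcases le_total (ev p i) (ev p j) with hh | hh
      · have : ¬ ev p m ≤ ev p j := fun x => b ⟨hh, x⟩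
        constructor <;> linarith
      · have : ¬ ev p m ≤ ev p i := fun x => a ⟨hh, x⟩
        constructor <;> linarith
    have e3 : cc p m i j = u3 p (eb p m) (eb p i) (eb p j) := by rw [cc, if_pos c]
    have l := mD (max_le c.1 c.2)
    have := mul_le_mul_of_nonneg_right l (sq_nonneg (cc p m i j))
    rw [← e3]; linarith
  refine (sum_le_sum fun i _ => sum_le_sum fun j _ => sum_le_sum fun m _ => key i j m).trans (le_of_eq ?_)
  simp only [Finset.sum_add_distrib]
  have s1 : ∑ i, ∑ j, ∑ m, D (ev p i) * cc p i j m ^ 2 = ∑ i, D (ev p i) * SS p i := by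
    simp only [SS, mul_sum]
  have s2 : ∑ i, ∑ j, ∑ m, D (ev p j) * cc p j i m ^ 2 = ∑ i, D (ev p i) * SS p i := by
    rw [Finset.sum_comm, ← s1]
  have s3 : ∑ i, ∑ j, ∑ m, D (ev p m) * cc p m i j ^ 2 = ∑ i, D (ev p i) * SS p i := by
    rw [← s1]
    calc _ = ∑ i, ∑ m, ∑ j, D (ev p m) * cc p m i j ^ 2 := sum_congr rfl fun i _ => Finset.sum_comm
      _ = _ := Finset.sum_comm
  rw [s1, s2, s3]; ring

end

section
variable {μ : Measure E} [IsProbabilityMeasure μ] {R : ℝ}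

lemma drift (h : BS μ R) : ∃ C, 0 ≤ C ∧ ∀ {ι : Type} [Fintype ι] (e : OrthonormalBasis ι ℝ E) (P : Polynomial ℝ) (D : ℝ → ℝ) (ε : ℝ), Monotone D →
    (∀ x, 0 ≤ D x) → 0 ≤ ε → (∀ x ∈ Icc 0 (R ^ 2), |(Polynomial.derivative (Polynomial.derivative P)).eval x - D x| ≤ ε) →
    (∀ x ∈ Icc 0 (R ^ 2), -(ε * R ^ 2) ≤ (Polynomial.derivative P).eval x) → ∀ q,
    itoD μ e ph (Phi P) q ≤ 3 / 2 * ∑ i, D (ev (tl μ q) i) * SS (tl μ q) i + ε * C := by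
  set n := finrank ℝ E
  refine ⟨1 / 2 * (∑ i : Fin n, ∑ j : Fin n, ∑ m : Fin n, ((2 * R) ^ 3) ^ 2) + ∑ i : Fin n, R ^ 2 * (R ^ 2) ^ 2, by positivity, ?_⟩
  intro ι _ e P D ε mD D0 ε0 h2 h1 q
  have := h.tl_prob q
  have hq := h.tl q
  obtain ⟨L, dd, hnc⟩ := NC.exists E (Polynomial.derivative P)
  rw [itoD_Phi h e P hnc q]
  set p := tl μ q
  have mem : ∀ i, ev p i ∈ Icc 0 (R ^ 2) := fun i => ⟨ev_nonneg hq i, ev_le hq i⟩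
  have A : ∑ i, ∑ j, ∑ m, dd (ev p i) (ev p j) * u3 p (eb p m) (eb p i) (eb p j) ^ 2 ≤
      ∑ i, ∑ j, ∑ m, D (max (ev p i) (ev p j)) * u3 p (eb p m) (eb p i) (eb p j) ^ 2 + ε * ∑ i : Fin n, ∑ j : Fin n, ∑ m : Fin n, ((2 * R) ^ 3) ^ 2 := by
    have : ∀ i j m, dd (ev p i) (ev p j) * u3 p (eb p m) (eb p i) (eb p j) ^ 2 ≤
        D (max (ev p i) (ev p j)) * u3 p (eb p m) (eb p i) (eb p j) ^ 2 + ε * ((2 * R) ^ 3) ^ 2 := ?_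
    · refine (sum_le_sum fun i _ => sum_le_sum fun j _ => sum_le_sum fun m _ => this i j m).trans (le_of_eq ?_)
      simp only [mul_sum, Finset.sum_add_distrib]; rfl
    intro i j m
    have a := dd_le hnc mD h2 (mem i) (mem j)
    have b := u3_le hq (OrthonormalBasis.norm_eq_one (eb p) m) (OrthonormalBasis.norm_eq_one (eb p) i) (OrthonormalBasis.norm_eq_one (eb p) j)
    have b2 : u3 p (eb p m) (eb p i) (eb p j) ^ 2 ≤ ((2 * R) ^ 3) ^ 2 := sq_le_sq' (by linarith [abs_le.1 b]) (abs_le.1 b).2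
    have := mul_le_mul_of_nonneg_right a (sq_nonneg (u3 p (eb p m) (eb p i) (eb p j)))
    have := mul_le_mul_of_nonneg_left b2 ε0
    linarith
  have B := three hq mD D0
  have Cc : -(ε * ∑ i : Fin n, R ^ 2 * (R ^ 2) ^ 2) ≤ ∑ i, (Polynomial.derivative P).eval (ev p i) * ev p i ^ 2 := by
    rw [mul_sum, ← Finset.sum_neg_distrib]
    refine sum_le_sum fun i _ => ?_
    have a := mul_le_mul_of_nonneg_right (h1 _ (mem i)) (sq_nonneg (ev p i))
    have b : ev p i ^ 2 ≤ (R ^ 2) ^ 2 := pow_le_pow_left₀ (mem i).1 (mem i).2 2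
    have := mul_le_mul_of_nonneg_left b (by positivity : 0 ≤ ε * R ^ 2)
    linarith
  linarith

/-- polynomial approximation -/
lemma papprox {D ψ ψ' : ℝ → ℝ} (cD : Continuous D) (d1 : ∀ x, HasDerivAt ψ (ψ' x) x) (d2 : ∀ x, HasDerivAt ψ' (D x) x)
    (z1 : ψ 0 = 0) (z2 : ψ' 0 = 0) (B : ℝ) (p0 : ∀ x, 0 ≤ ψ' x) {ε : ℝ} (e0 : 0 < ε) :
    ∃ P : Polynomial ℝ, (∀ x ∈ Icc 0 B, |(Polynomial.derivative (Polynomial.derivative P)).eval x - D x| ≤ ε) ∧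
      (∀ x ∈ Icc 0 B, -(ε * B) ≤ (Polynomial.derivative P).eval x) ∧ ∀ x ∈ Icc 0 B, |P.eval x - ψ x| ≤ ε * B * B := by
  obtain ⟨Q, hQ⟩ := exists_polynomial_near_of_continuousOn 0 B D cD.continuousOn ε e0
  have anti : ∀ Q : Polynomial ℝ, ∃ P : Polynomial ℝ, Polynomial.derivative P = Q ∧ P.eval 0 = 0 := by
    intro Q
    induction Q using Polynomial.induction_on' with
    | add a b ha hb =>
      obtain ⟨x, hx, hx'⟩ := ha; obtain ⟨y, hy, hy'⟩ := hb
      exact ⟨x + y, by simp [hx, hy], by simp [hx', hy']⟩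
    | monomial k c =>
      refine ⟨Polynomial.monomial (k + 1) (c / (k + 1)), ?_, by simp⟩
      rw [Polynomial.derivative_monomial]; congr 1
      push_cast; field_simp
  have mv : ∀ (f f' : ℝ → ℝ) (c : ℝ), (∀ x, HasDerivAt f (f' x) x) → (∀ x ∈ Icc 0 B, |f' x| ≤ c) → f 0 = 0 → ∀ x ∈ Icc 0 B, |f x| ≤ c * B := by
    intro f f' c hf hc h0 x hx
    have := (convex_Icc 0 B).norm_image_sub_le_of_norm_hasDerivWithin_le (f := f) (f' := f') (C := c) (fun x _ => (hf x).hasDerivWithinAt) hc (left_mem_Icc.2 (hx.1.trans hx.2)) hx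
    have c0 : 0 ≤ c := (abs_nonneg _).trans (hc x hx)
    rw [h0, sub_zero, sub_zero, Real.norm_eq_abs, Real.norm_eq_abs, abs_of_nonneg hx.1] at this
    exact this.trans (mul_le_mul_of_nonneg_left hx.2 c0)
  obtain ⟨P1, e1, z1'⟩ := anti Q
  obtain ⟨P, e2, z2'⟩ := anti P1
  have b0 : ∀ x ∈ Icc 0 B, |Q.eval x - D x| ≤ ε := fun x hx => (hQ x hx).le
  have b1 := mv (fun x => P1.eval x - ψ' x) (fun x => Q.eval x - D x) ε (fun x => by
    have := P1.hasDerivAt x; rw [e1] at this; exact this.sub (d2 x)) b0 (by simp [z1', z2])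
  have b2 := mv (fun x => P.eval x - ψ x) (fun x => P1.eval x - ψ' x) (ε * B) (fun x => by
    have := P.hasDerivAt x; rw [e2] at this; exact this.sub (d1 x)) b1 (by simp [z2', z1])
  refine ⟨P, by rw [e2, e1]; exact b0, fun x hx => ?_, b2⟩
  rw [e2]; have := abs_le.1 (b1 x hx); have := p0 x; linarith
end

end

section

def Dd (a : ℝ) (P : ℕ) (x : ℝ) : ℝ := (min 1 (max 0 (x - a))) ^ P
def ps1 (a : ℝ) (P : ℕ) (x : ℝ) : ℝ := ∫ s in (0:ℝ)..x, Dd a P s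
def ps (a : ℝ) (P : ℕ) (x : ℝ) : ℝ := ∫ s in (0:ℝ)..x, ps1 a P s

section
variable {a : ℝ} {P : ℕ}
lemma Dd_cont : Continuous (Dd a P) := by unfold Dd; fun_prop
lemma Dd0 (x : ℝ) : 0 ≤ Dd a P x := by unfold Dd; positivity
lemma Dd1 (x : ℝ) : Dd a P x ≤ 1 := pow_le_one₀ (by positivity) (min_le_left _ _)
lemma Dd_mono : Monotone (Dd a P) := fun x y h => by
  unfold Dd; gcongr
lemma Dd_z (hP : P ≠ 0) {x : ℝ} (h : x ≤ a) : Dd a P x = 0 := by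
  unfold Dd; rw [max_eq_left (by linarith)]; simp [hP]
lemma ps1_d (x : ℝ) : HasDerivAt (ps1 a P) (Dd a P x) x :=
  intervalIntegral.integral_hasDerivAt_right (Dd_cont.intervalIntegrable _ _) (Dd_cont.stronglyMeasurableAtFilter _ _) Dd_cont.continuousAt
lemma ps1_c : Continuous (ps1 a P) := continuous_iff_continuousAt.2 fun x => (ps1_d x).continuousAt
lemma ps_d (x : ℝ) : HasDerivAt (ps a P) (ps1 a P x) x :=
  intervalIntegral.integral_hasDerivAt_right (ps1_c.intervalIntegrable _ _) (ps1_c.stronglyMeasurableAtFilter _ _) ps1_c.continuousAt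
lemma ps_c : Continuous (ps a P) := continuous_iff_continuousAt.2 fun x => (ps_d x).continuousAt
lemma ps1_z (ha : 0 ≤ a) (hP : P ≠ 0) {x : ℝ} (h : x ≤ a) : ps1 a P x = 0 := by
  rw [ps1, intervalIntegral.integral_congr (g := fun _ => 0) (fun y hy => ?_)]
  · simp
  · exact Dd_z hP ((mem_uIcc.1 hy).elim (fun h' => h'.2.trans h) (fun h' => h'.2.trans ha))
lemma ps_z (ha : 0 ≤ a) (hP : P ≠ 0) {x : ℝ} (h : x ≤ a) : ps a P x = 0 := by
  rw [ps, intervalIntegral.integral_congr (g := fun _ => 0) (fun y hy => ?_)]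
  · simp
  · exact ps1_z ha hP ((mem_uIcc.1 hy).elim (fun h' => h'.2.trans h) (fun h' => h'.2.trans ha))
lemma ps1_mono : Monotone (ps1 a P) :=
  monotone_of_deriv_nonneg (fun x => (ps1_d x).differentiableAt) fun x => by rw [(ps1_d x).deriv]; exact Dd0 x
lemma ps1_0 (ha : 0 ≤ a) (hP : P ≠ 0) (x : ℝ) : 0 ≤ ps1 a P x := by
  rcases le_total x a with h | h
  · rw [ps1_z ha hP h]
  · rw [← ps1_z ha hP (le_refl a)]; exact ps1_mono h
lemma ps_0 (ha : 0 ≤ a) (hP : P ≠ 0) (x : ℝ) : 0 ≤ ps a P x := by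
  have : Monotone (ps a P) := monotone_of_deriv_nonneg (fun x => (ps_d x).differentiableAt) fun x => by
    rw [(ps_d x).deriv]; exact ps1_0 ha hP x
  rcases le_total x a with h | h
  · rw [ps_z ha hP h]
  · rw [← ps_z ha hP (le_refl a)]; exact this h
lemma ps_low (ha : 0 ≤ a) (hP : P ≠ 0) {w x : ℝ} (h : w ≤ x) : Dd a P w * (x - w) ^ 2 / 2 ≤ ps a P x := by
  have m1 : MonotoneOn (fun x => ps1 a P x - Dd a P w * (x - w)) (Icc w x) := by
    refine monotoneOn_of_hasDerivWithinAt_nonneg (f' := fun x => Dd a P x - Dd a P w) (convex_Icc w x) (by have := ps1_c (a := a) (P := P); fun_prop) ?_ ?_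
    · intro y _
      exact ((ps1_d y).sub ((((hasDerivAt_id y).sub_const w).const_mul (Dd a P w)).congr_deriv (by simp))).hasDerivWithinAt
    · intro y hy; rw [interior_Icc] at hy; linarith [Dd_mono (a := a) (P := P) hy.1.le]
  have m2 : MonotoneOn (fun x => ps a P x - Dd a P w * (x - w) ^ 2 / 2) (Icc w x) := by
    refine monotoneOn_of_hasDerivWithinAt_nonneg (f' := fun x => ps1 a P x - Dd a P w * (x - w)) (convex_Icc w x) (by have := ps_c (a := a) (P := P); fun_prop) ?_ ?_
    · intro y _
      refine ((ps_d y).sub ((((((hasDerivAt_id y).sub_const w).pow 2).const_mul (Dd a P w)).div_const 2).congr_deriv ?_)).hasDerivWithinAt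
      simp; ring
    · intro y hy; rw [interior_Icc] at hy
      have := m1 (left_mem_Icc.2 h) ⟨hy.1.le, hy.2.le⟩ hy.1.le
      simp only [sub_self, mul_zero, sub_zero] at this
      linarith [ps1_0 ha hP w]
  have := m2 (left_mem_Icc.2 h) (right_mem_Icc.2 h) h
  simp only [sub_self] at this
  have := ps_0 ha hP w
  norm_num at *; linarith
lemma ps_K (ha : 0 ≤ a) (ha2 : a ≤ 2) (hP : P ≠ 0) {x : ℝ} (h : 6 < x) : x ^ 2 ≤ 8 * ps a P x := by
  have := ps_low ha hP (w := a + 1) (x := x) (by linarith)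
  rw [Dd] at this; norm_num at this
  nlinarith
lemma ps_K' (ha : 0 ≤ a) (ha2 : a ≤ 2) (hP : P ≠ 0) {x : ℝ} (h0 : 0 ≤ x) : x ^ 2 ≤ 6 ^ 2 + 8 * ps a P x := by
  rcases le_or_gt x 6 with h | h
  · have := ps_0 ha hP x; nlinarith
  · linarith [ps_K ha ha2 hP h]
lemma ps_sq (ha : 0 ≤ a) (hP : P ≠ 0) {x : ℝ} (h : a ≤ x) : Dd a P x * (x - a) ^ 2 ≤ 2 ^ P * 8 * ps a P x := by
  have := ps_low ha hP (w := a + (x - a) / 2) (x := x) (by linarith)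
  have hD : Dd a P x ≤ 2 ^ P * Dd a P (a + (x - a) / 2) := by
    unfold Dd; rw [← mul_pow]
    refine pow_le_pow_left₀ (by positivity) ?_ P
    rw [max_eq_right (by linarith), max_eq_right (by linarith), mul_min_of_nonneg _ _ (by norm_num)]
    exact le_min ((min_le_left _ _).trans (by norm_num)) ((min_le_right _ _).trans (by linarith))
  have h2 := mul_le_mul_of_nonneg_right hD (sq_nonneg (x - a))
  have h3 := mul_le_mul_of_nonneg_left this (by positivity : (0:ℝ) ≤ 2 ^ P * 8)
  calc _ ≤ _ := h2
    _ = 2 ^ P * 8 * (Dd a P (a + (x - a) / 2) * (x - (a + (x - a) / 2)) ^ 2 / 2) := by ring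
    _ ≤ _ := h3
lemma D_split (ha : 0 ≤ a) (hP : P ≠ 0) {c : ℝ} (hc : 0 < c) : ∃ L, 0 ≤ L ∧ ∀ x : ℝ, ∀ δ : ℝ, 0 ≤ δ → δ ≤ 1 →
    δ ^ 2 * Dd a P x ≤ c * ps a P x + L * δ ^ P := by
  set l := √(2 ^ P * 8 / c)
  have l0 : 0 < l := Real.sqrt_pos.2 (by positivity)
  have l2 : l ^ 2 = 2 ^ P * 8 / c := sq_sqrt (by positivity)
  refine ⟨l ^ P, by positivity, fun x δ d0 d1 => ?_⟩
  have p0 := ps_0 ha hP x; have D0 := Dd0 (a := a) (P := P) x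
  rcases le_or_gt (x - a) (l * δ) with h | h
  · have : Dd a P x ≤ l ^ P * δ ^ P := by
      rw [← mul_pow]; refine pow_le_pow_left₀ (by positivity) ((min_le_right _ _).trans (max_le (by positivity) h)) P
    have : δ ^ 2 * Dd a P x ≤ Dd a P x := mul_le_of_le_one_left D0 (pow_le_one₀ d0 d1)
    have : 0 ≤ c * ps a P x := by positivity
    linarith
  · have := ps_sq ha hP (x := x) (by nlinarith)
    have s : (l * δ) ^ 2 ≤ (x - a) ^ 2 := pow_le_pow_left₀ (by positivity) h.le 2
    rw [mul_pow, l2] at s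
    have s2 := mul_le_mul_of_nonneg_left s (mul_nonneg D0 hc.le)
    have e : Dd a P x * c * (2 ^ P * 8 / c * δ ^ 2) = 2 ^ P * 8 * (δ ^ 2 * Dd a P x) := by field_simp
    have : 2 ^ P * 8 * (δ ^ 2 * Dd a P x) ≤ 2 ^ P * 8 * (c * ps a P x) := by
      rw [← e]; nlinarith
    have := le_of_mul_le_mul_left this (by positivity)
    have : 0 ≤ l ^ P * δ ^ P := by positivity
    linarith
lemma one_sub_sq {η : ℝ} (h0 : 0 < η) (h1 : η ≤ 1 / 2) (hP : P ≠ 0) : ∃ C, 0 ≤ C ∧ ∀ x, 0 ≤ x →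
    (1 - x) ^ 2 ≤ (1 - x) + 4 * η + C * ps (1 + η) P x := by
  refine ⟨(2 / η + 4) * (2 ^ P * 8 / η ^ P), by positivity, fun x hx => ?_⟩
  have p0 := ps_0 (a := 1 + η) (by linarith) hP x
  rcases le_or_gt x (1 + 2 * η) with h | h
  · have : 0 ≤ (2 / η + 4) * (2 ^ P * 8 / η ^ P) * ps (1 + η) P x := by positivity
    rcases le_total x 1 with h' | h' <;> nlinarith
  · have := ps_sq (a := 1 + η) (by linarith) hP (x := x) (by linarith)
    set y := x - (1 + η) with hy
    have d : η ^ P ≤ Dd (1 + η) P x := pow_le_pow_left₀ h0.le (le_min (by linarith) ((le_max_right _ _).trans' (by linarith))) P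
    have y2 : y ^ 2 ≤ 2 ^ P * 8 / η ^ P * ps (1 + η) P x := by
      rw [div_mul_eq_mul_div, le_div_iff₀ (by positivity)]
      have := mul_le_mul_of_nonneg_right d (sq_nonneg y)
      linarith
    have yη : η ≤ y := by linarith
    have y1 : y ≤ y ^ 2 / η := by rw [le_div_iff₀ h0]; nlinarith
    have := mul_le_mul_of_nonneg_left y2 (by positivity : 0 ≤ 2 / η + 4)
    have e : (2 / η + 4) * y ^ 2 = 2 * (y ^ 2 / η) + 4 * y ^ 2 := by ring
    nlinarith
end

end

section

variable {μ : Measure E} [IsProbabilityMeasure μ] {R : ℝ}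

lemma init_bd (h : BS μ R) {a' a : ℝ} (a0 : 0 ≤ a) (haa : a' < a) (hev : ∀ i, ev μ i ≤ a') {P : ℕ} (hP : P ≠ 0) (m : ℕ) :
    ∃ C, 0 ≤ C ∧ ∀ t, 0 < t → t ≤ 1 → EE μ t (fun q => trf (ps a P) (tl μ q)) ≤ C * t ^ m := by
  obtain ⟨B, hB⟩ := trf_bdd h (ps_c (a := a) (P := P))
  have B0 : 0 ≤ B := (abs_nonneg _).trans (hB 0)
  have c1 := trf_cont h (ψ := fun x => max 0 (x - a')) (by fun_prop)
  have z1 : trf (fun x => max 0 (x - a')) (tl μ 0) = 0 := by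
    rw [tl_zero]; exact Finset.sum_eq_zero fun i _ => max_eq_left (by linarith [hev i])
  obtain ⟨δ, d0, hδ⟩ := Metric.continuousAt_iff.1 (c1.continuousAt (x := 0)) (a - a') (sub_pos.2 haa)
  have near : ∀ q, ‖q‖ < δ → trf (ps a P) (tl μ q) = 0 := fun q hq => by
    have h1 := hδ (x := q) (by simpa using hq)
    rw [Real.dist_eq, z1, sub_zero] at h1
    refine Finset.sum_eq_zero fun i _ => ps_z a0 hP ?_
    have h2 : max 0 (ev (tl μ q) i - a') ≤ trf (fun x => max 0 (x - a')) (tl μ q) :=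
      Finset.single_le_sum (f := fun i => max 0 (ev (tl μ q) i - a')) (fun j _ => le_max_left _ _) (Finset.mem_univ i)
    have := le_max_right 0 (ev (tl μ q) i - a')
    linarith [(abs_lt.1 h1).2]
  have pt : ∀ q, trf (ps a P) (tl μ q) ≤ B * (‖q‖ / δ) ^ (2 * m) := fun q => by
    rcases lt_or_ge ‖q‖ δ with hq | hq
    · rw [near q hq]; positivity
    · have : 1 ≤ ‖q‖ / δ := (one_le_div d0).2 hq
      exact (le_abs_self _).trans ((hB q).trans (le_mul_of_one_le_right B0 (one_le_pow₀ this)))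
  obtain ⟨C, c, C0, c0, hC⟩ := (GB_Zq h).dom 1
  have I1 : Integrable (fun g : E => C * exp (c * ‖g‖) * (B * ((1 + ‖g‖) / δ) ^ (2 * m))) (ga E) := by
    refine EB.int ⟨C * (B / δ ^ (2 * m) * ((2 * m).factorial * exp 1)), c + 1, by positivity, by positivity, fun g => ?_⟩ (by fun_prop)
    rw [abs_of_nonneg (by positivity)]
    have := Real.pow_div_factorial_le_exp (1 + ‖g‖) (by positivity) (2 * m)
    rw [div_le_iff₀ (by positivity), exp_add] at this
    calc _ = C * exp (c * ‖g‖) * (B / δ ^ (2 * m) * (1 + ‖g‖) ^ (2 * m)) := by simp only [div_pow]; ring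
      _ ≤ C * exp (c * ‖g‖) * (B / δ ^ (2 * m) * (exp 1 * exp ‖g‖ * (2 * m).factorial)) := by gcongr
      _ = _ := by rw [add_mul, exp_add, one_mul]; ring
  refine ⟨∫ g : E, C * exp (c * ‖g‖) * (B * ((1 + ‖g‖) / δ) ^ (2 * m)) ∂ga E, integral_nonneg fun g => by positivity, fun t t0 t1 => ?_⟩
  rw [← integral_mul_const]
  refine integral_mono (EE_int h hB (trf_cont h ps_c) t0.le) (I1.mul_const _) fun g => ?_
  have hz := hC t t0.le t1 g
  rw [norm_of_nonneg (Zq_pos h _).le] at hz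
  have s1 : √t ≤ 1 := Real.sqrt_le_one.2 t1
  have ts : t = √t * √t := (Real.mul_self_sqrt t0.le).symm
  have nq : ‖((t, √t • g) : ℝ × E)‖ ≤ √t * (1 + ‖g‖) := by
    rw [Prod.norm_def, norm_smul, norm_of_nonneg t0.le, norm_of_nonneg (Real.sqrt_nonneg t)]
    have := Real.sqrt_nonneg t; have := norm_nonneg g
    exact max_le (by nlinarith [mul_nonneg ‹0 ≤ √t› this]) (by nlinarith)
  calc _ ≤ (C * exp (c * ‖g‖)) * (B * (√t * (1 + ‖g‖) / δ) ^ (2 * m)) := by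
        refine mul_le_mul hz ((pt _).trans (by gcongr)) (Finset.sum_nonneg fun i _ => ps_0 a0 hP _) (by positivity)
    _ = _ := by
      rw [mul_div_assoc, mul_pow, pow_mul (√t), sq_sqrt t0.le]; ring

lemma trf_sub_le (h : BS μ R) {f g : ℝ → ℝ} {c : ℝ} (hfg : ∀ x ∈ Icc 0 (R ^ 2), f x ≤ g x + c) (q : ℝ × E) :
    trf f (tl μ q) ≤ trf g (tl μ q) + finrank ℝ E * c := by
  have := h.tl_prob q
  have e : (finrank ℝ E : ℝ) * c = ∑ i : Fin (finrank ℝ E), c := by simp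
  rw [e, trf, trf, ← Finset.sum_add_distrib]
  exact sum_le_sum fun i _ => hfg _ ⟨ev_nonneg (h.tl q) i, ev_le (h.tl q) i⟩

lemma psi_cmp (h : BS μ R) {D ψ ψ' : ℝ → ℝ} (cD : Continuous D) (d1 : ∀ x, HasDerivAt ψ (ψ' x) x) (d2 : ∀ x, HasDerivAt ψ' (D x) x)
    (z1 : ψ 0 = 0) (z2 : ψ' 0 = 0) (p0 : ∀ x, 0 ≤ ψ' x) (mD : Monotone D) (D0 : ∀ x, 0 ≤ D x) {t : ℝ} (ht : 0 ≤ t)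
    {H H' : ℝ → ℝ} (cH : ContinuousOn H (Icc 0 t)) (dH : ∀ s ∈ Ioo 0 t, HasDerivAt H (H' s) s)
    (le : ∀ s ∈ Ioo 0 t, ∃ G : ℝ × E → ℝ, Integrable (fun g => Zq μ (s, √s • g) * G (s, √s • g)) (ga E) ∧
      (∀ θ, 3 / 2 * ∑ i, D (ev (tl μ (s, θ)) i) * SS (tl μ (s, θ)) i ≤ G (s, θ)) ∧ EE μ s G ≤ H' s) :
    EE μ t (fun q => trf ψ (tl μ q)) ≤ trf ψ μ + (H t - H 0) := by
  obtain ⟨C, C0, hC⟩ := drift h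
  set n : ℝ := (finrank ℝ E : ℝ)
  have n0 : 0 ≤ n := Nat.cast_nonneg _
  have cψ : Continuous ψ := continuous_iff_continuousAt.2 fun x => (d1 x).continuousAt
  refine le_of_forall_pos_le_add fun κ κ0 => ?_
  set ε := κ / (C * t + 2 * n * (R ^ 2 * R ^ 2) + 1) with hε
  have ε0 : 0 < ε := by positivity
  have εκ : ε * (C * t + 2 * n * (R ^ 2 * R ^ 2)) ≤ κ := by
    rw [hε, div_mul_eq_mul_div, div_le_iff₀ (by positivity)]; linarith
  obtain ⟨P, h2, h1, h0⟩ := papprox cD d1 d2 z1 z2 (R ^ 2) p0 ε0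
  have key := itoD_add_aux h (φ := ph) cont_ph (cd_Phi P) ht (H := fun s => H s + ε * C * s) (H' := fun s => H' s + ε * C)
    (by fun_prop) (fun s hs => (dH s hs).add (((hasDerivAt_id s).const_mul (ε * C)).congr_deriv (by simp))) (stdOrthonormalBasis ℝ E) (fun s hs => by
      obtain ⟨G, iG, hG, hG'⟩ := le s hs
      obtain ⟨B, _, hB⟩ := itoD_bdd h (stdOrthonormalBasis ℝ E) (φ := ph) cont_ph (cd_Phi P)
      have iZ := EE_int h (F := fun _ => ε * C) (D := |ε * C|) (fun _ => le_rfl) continuous_const hs.1.le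
      have a1 : EE μ s (itoD μ (stdOrthonormalBasis ℝ E) ph (Phi P)) ≤ EE μ s (fun q => G q + ε * C) := by
        refine EE_mono' h hs.1.le (EE_int h hB (itoD_cont h _ cont_ph (cd_Phi P)) hs.1.le) ?_ fun θ => ?_
        · have := iG.add iZ
          refine this.congr (of_forall fun g => ?_)
          simp only [Pi.add_apply, mul_add]
        · exact (hC _ P D ε mD D0 ε0.le h2 h1 (s, θ)).trans (by linarith [hG θ])
      have a2 : EE μ s (fun q => G q + ε * C) = EE μ s G + ε * C := by
        have e := EE_const h (ε * C) hs.1.le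
        rw [show EE μ s G + ε * C = EE μ s G + EE μ s (fun _ => ε * C) by rw [e]]
        simp only [EE, mul_add]
        exact integral_add iG iZ
      rw [a2] at a1; linarith)
  simp only [Phi_MM h] at key
  rw [tl_zero] at key
  obtain ⟨B1, hB1⟩ := trf_bdd h cψ
  obtain ⟨B2, hB2⟩ := trf_bdd h (ψ := fun x => P.eval x) P.continuous
  set c := ε * R ^ 2 * R ^ 2
  have u1 : EE μ t (fun q => trf ψ (tl μ q)) ≤ EE μ t (fun q => trf (fun x => P.eval x) (tl μ q)) + n * c := by
    rw [← EE_const h (n * c) ht, ← EE_add h hB2 (trf_cont h P.continuous) (D' := |n * c|) (fun _ => le_rfl) continuous_const ht]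
    refine EE_mono h hB1 (trf_cont h cψ) (D' := B2 + |n * c|) (fun q => (abs_add_le _ _).trans (add_le_add (hB2 q) le_rfl)) ((trf_cont h P.continuous).add_const _) ht fun θ => ?_
    exact trf_sub_le h (fun x hx => by linarith [abs_le.1 (h0 x hx)]) _
  have u2 := trf_sub_le h (f := fun x => P.eval x) (g := ψ) (c := c) (fun x hx => by linarith [abs_le.1 (h0 x hx)]) 0
  rw [tl_zero] at u2
  simp only [mul_zero, add_zero] at key
  have e : ε * (C * t + 2 * n * (R ^ 2 * R ^ 2)) = ε * C * t + 2 * (n * c) := by ring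
  linarith

end

section

variable {μ : Measure E} [IsProbabilityMeasure μ] {R : ℝ}

lemma nums (r : ℕ) (hr : 1 ≤ r) {s : ℝ} (s0 : 0 < s) (s1 : s < 1) : ∃ T δ : ℝ, s ≤ T ∧ T ≤ 1 ∧ 0 < δ ∧ δ ≤ 1 ∧
    T ^ (r + 1) = s ^ r ∧ δ ^ (2 * r * (r + 1)) = s ^ r ∧ T * δ ^ 2 = s ∧ T ≤ δ ^ 2 := by
  set e : ℝ := 1 / ((r:ℝ) + 1)
  have hr' : (1:ℝ) ≤ r := by exact_mod_cast hr
  have e0 : 0 < e := by positivity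
  have e1 : e ≤ 1 / 2 := one_div_le_one_div_of_le (by norm_num) (by linarith)
  have er : e * (r + 1) = 1 := by simp only [e]; field_simp
  have d2 : (s ^ (e / 2)) ^ 2 = s ^ e := by rw [← Real.rpow_natCast, ← Real.rpow_mul s0.le]; norm_num
  refine ⟨s ^ (1 - e), s ^ (e / 2), ?_, ?_, by positivity, ?_, ?_, ?_, ?_, ?_⟩
  · conv_lhs => rw [← Real.rpow_one s]
    exact Real.rpow_le_rpow_of_exponent_ge s0 s1.le (by linarith)
  · exact Real.rpow_le_one s0.le s1.le (by linarith)
  · exact Real.rpow_le_one s0.le s1.le (by linarith)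
  · rw [← Real.rpow_natCast, ← Real.rpow_mul s0.le, ← Real.rpow_natCast]; congr 1; push_cast; linarith
  · rw [← Real.rpow_natCast, ← Real.rpow_mul s0.le, ← Real.rpow_natCast]; congr 1; push_cast
    linear_combination (r:ℝ) * er
  · rw [d2, ← Real.rpow_add s0]; simp
  · rw [d2]; exact Real.rpow_le_rpow_of_exponent_ge s0 s1.le (by linarith)

lemma step (h : BS μ R) (hμ : SLC 0 μ) {a : ℝ} (a0 : 0 ≤ a) (a2 : a ≤ 2) {r : ℕ} (hr : 1 ≤ r) (hz : trf (ps a (2 * r * (r + 1))) μ = 0)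
    {L : ℝ} (L0 : 0 ≤ L)
    (hL : ∀ x : ℝ, ∀ δ : ℝ, 0 ≤ δ → δ ≤ 1 →
      δ ^ 2 * Dd a (2 * r * (r + 1)) x ≤ 1 / 2016 * ps a (2 * r * (r + 1)) x + L * δ ^ (2 * r * (r + 1))) {N : ℝ} (N0 : 0 ≤ N)
    (hN : ∀ t, 0 < t → t ≤ 1 → EE μ t (fun q => trf (ps a (2 * r * (r + 1))) (tl μ q)) ≤ N * t ^ r) {t : ℝ} (t0 : 0 < t) (t1 : t ≤ 1) :
    EE μ t (fun q => trf (ps a (2 * r * (r + 1))) (tl μ q)) ≤ (626 * N + 3024 * L * finrank ℝ E) / r * t ^ r := by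
  set P := 2 * r * (r + 1) with hPdef
  have hP : P ≠ 0 := by rw [hPdef]; positivity
  clear_value P
  set n : ℝ := (finrank ℝ E : ℝ) with hn
  have n0 : 0 ≤ n := Nat.cast_nonneg _
  have r0 : (0:ℝ) < r := by exact_mod_cast hr
  obtain ⟨B, hB⟩ := trf_bdd h (ps_c (a := a) (P := P))
  have cψ := trf_cont h (ps_c (a := a) (P := P))
  have main := psi_cmp h (D := Dd a P) (ψ := ps a P) (ψ' := ps1 a P) Dd_cont ps_d ps1_d (ps_z a0 hP a0) (ps1_z a0 hP a0) (ps1_0 a0 hP)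
    Dd_mono Dd0 t0.le (H := fun s => (626 * N + 3024 * L * n) / r * s ^ r) (H' := fun s => (626 * N + 3024 * L * n) * s ^ (r - 1))
    (by fun_prop) (fun s hs => ((hasDerivAt_pow r s).const_mul _).congr_deriv (by field_simp)) ?_
  · rw [hz] at main
    simpa [zero_pow (by omega : r ≠ 0)] using main
  intro s hs
  have s0 := hs.1
  obtain ⟨T, δ, sT, T1, δ0, δ1, eT, eδ, eTδ, Tδ⟩ := nums r hr s0 (hs.2.trans_le t1)
  rw [← hPdef] at eδ
  have T0 : 0 < T := s0.trans_le sT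
  set d := T - s with hd
  have d0 : 0 ≤ d := by linarith
  obtain ⟨tI, tE⟩ := tower_int h (F := fun q => trf (ps a P) (tl μ q)) hB cψ s0.le d0
  set J : ℝ × E → ℝ := fun q => ∫ s' in (0:ℝ)..d, EE (tl μ q) s' fun q' => trf (ps a P) (tl μ (q + q')) with hJ
  have i1 := EE_int h hB cψ s0.le
  have i2 := EE_int h (F := fun _ => 2016 * n * L * s ^ r) (D := |2016 * n * L * s ^ r|) (fun _ => le_rfl) continuous_const s0.le
  have e2 := EE_const h (2016 * n * L * s ^ r) s0.le
  have i12 := ((i1.const_mul 33).add i2).add (tI.const_mul 384)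
  have eqf : (fun g => Zq μ (s, √s • g) * (3 / 2 / s * (33 * trf (ps a P) (tl μ (s, √s • g)) + 2016 * n * L * s ^ r + 384 * J (s, √s • g)))) =
      fun g => 3 / 2 / s * ((33 * (Zq μ (s, √s • g) * trf (ps a P) (tl μ (s, √s • g))) + Zq μ (s, √s • g) * (2016 * n * L * s ^ r)) + 384 * (Zq μ (s, √s • g) * J (s, √s • g))) := by
    funext g; ring
  refine ⟨fun q => 3 / 2 / s * (33 * trf (ps a P) (tl μ q) + 2016 * n * L * s ^ r + 384 * J q), ?_, fun θ => ?_, ?_⟩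
  · rw [eqf]; exact i12.const_mul _
  · have := h.tl_prob (s, θ)
    have hq := h.tl (s, θ)
    have sl : SLC s (tl μ (s, θ)) := by simpa using LC.tl_slc h hμ (s, θ)
    have tot := total hq s0 sl d0 (K := 6) (by norm_num) (D := Dd a P) (ψ := ps a P) Dd0 Dd1 (ps_0 a0 hP) ps_c
      (fun x hx => ps_K' a0 a2 hP hx) (fun x hx => ps_K a0 a2 hP hx)
    simp only [h.tl_tl] at tot
    set I := ∫ s' in (0:ℝ)..d, EE (tl μ (s, θ)) s' fun q' => trf (ps a P) (tl μ ((s, θ) + q'))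
    have eI : J (s, θ) = I := rfl
    simp only [eI]
    set p := tl μ (s, θ)
    have tD0 : 0 ≤ trf (Dd a P) p := Finset.sum_nonneg fun i _ => Dd0 _
    have c1 : 8 * (6:ℝ) ^ 2 / (s + d) + 8 * 6 ^ 3 * d / s ≤ 2016 * δ ^ 2 / s := by
      have : s + d = T := by rw [hd]; ring
      rw [this]
      have x1 : 8 * (6:ℝ) ^ 2 / T = 288 * δ ^ 2 / s := by
        rw [div_eq_div_iff T0.ne' s0.ne', ← eTδ]; ring
      have x2 : 8 * (6:ℝ) ^ 3 * d / s ≤ 1728 * δ ^ 2 / s := by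
        rw [show (8 * 6 ^ 3 : ℝ) = 1728 by norm_num]; gcongr; linarith
      rw [x1]
      have : 2016 * δ ^ 2 / s = 288 * δ ^ 2 / s + 1728 * δ ^ 2 / s := by ring
      linarith
    have c2 : δ ^ 2 * trf (Dd a P) p ≤ 1 / 2016 * trf (ps a P) p + n * (L * s ^ r) := by
      have e : n * (L * s ^ r) = ∑ i : Fin (finrank ℝ E), (L * s ^ r) := by simp [hn]
      rw [e, trf, trf, mul_sum, mul_sum, ← Finset.sum_add_distrib]
      refine sum_le_sum fun i _ => ?_
      rw [← eδ]; exact hL _ δ δ0.le δ1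
    have c3 := mul_le_mul_of_nonneg_right c1 tD0
    have c4 : 2016 * δ ^ 2 / s * trf (Dd a P) p ≤ 1 / s * (trf (ps a P) p + 2016 * n * L * s ^ r) := by
      calc _ = 1 / s * (2016 * (δ ^ 2 * trf (Dd a P) p)) := by ring
        _ ≤ _ := by gcongr; linarith
    calc _ ≤ 3 / 2 * (1 / s * (trf (ps a P) p + 2016 * n * L * s ^ r) + 64 * 6 / s * I + 32 / s * trf (ps a P) p) := by
          gcongr; linarith
      _ = _ := by ring
  · have e3 : EE μ s (fun q => 3 / 2 / s * (33 * trf (ps a P) (tl μ q) + 2016 * n * L * s ^ r + 384 * J q)) =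
        3 / 2 / s * (33 * EE μ s (fun q => trf (ps a P) (tl μ q)) + 2016 * n * L * s ^ r + 384 * EE μ s J) := by
      have e2' := e2
      unfold EE at e2' ⊢
      have hh : ∫ g, (33 * (Zq μ (s, √s • g) * trf (ps a P) (tl μ (s, √s • g))) + Zq μ (s, √s • g) * (2016 * n * L * s ^ r)) + 384 * (Zq μ (s, √s • g) * J (s, √s • g)) ∂ga E =
          33 * (∫ g, Zq μ (s, √s • g) * trf (ps a P) (tl μ (s, √s • g)) ∂ga E) + 2016 * n * L * s ^ r + 384 * ∫ g, Zq μ (s, √s • g) * J (s, √s • g) ∂ga E := by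
        have i3 : Integrable (fun g => Zq μ (s, √s • g) * J (s, √s • g)) (ga E) := tI
        have i33 : Integrable (fun g => 33 * (Zq μ (s, √s • g) * trf (ps a P) (tl μ (s, √s • g))) + Zq μ (s, √s • g) * (2016 * n * L * s ^ r)) (ga E) := (i1.const_mul 33).add i2
        rw [integral_add i33 (i3.const_mul 384), integral_add (i1.const_mul 33) i2, integral_const_mul, integral_const_mul, e2']
      rw [eqf, integral_const_mul, hh]
    rw [e3, tE]
    have cE := EE_contOn h hB cψ
    have b1 := hN s s0 (hs.2.le.trans t1)
    have b2 : ∫ s' in (0:ℝ)..d, EE μ (s + s') (fun q => trf (ps a P) (tl μ q)) ≤ N * s ^ r := by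
      have ci : IntervalIntegrable (fun s' => EE μ (s + s') (fun q => trf (ps a P) (tl μ q))) volume 0 d := by
        refine ContinuousOn.intervalIntegrable_of_Icc d0 (cE.comp (by fun_prop) fun x hx => ?_)
        exact add_nonneg s0.le hx.1
      calc _ ≤ ∫ s' in (0:ℝ)..d, N * T ^ r := by
            refine intervalIntegral.integral_mono_on d0 ci (by simp) fun x hx => ?_
            refine (hN (s + x) (by linarith [hx.1]) (by linarith [hx.2])).trans ?_
            gcongr; · linarith [hx.1]
            · linarith [hx.2]
        _ = d * (N * T ^ r) := by simp; ring
        _ ≤ T * (N * T ^ r) := by gcongr; linarith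
        _ = N * T ^ (r + 1) := by ring
        _ = _ := by rw [eT]
    have es : s ^ r = s * s ^ (r - 1) := by rw [← pow_succ', Nat.sub_add_cancel hr]
    calc _ ≤ 3 / 2 / s * (33 * (N * s ^ r) + 2016 * n * L * s ^ r + 384 * (N * s ^ r)) := by gcongr
      _ = (3 / 2 * 417 * N + 3024 * L * n) * s ^ (r - 1) := by rw [es]; field_simp; ring
      _ ≤ _ := by
        gcongr; norm_num

lemma boot (h : BS μ R) (hμ : SLC 0 μ) {a' a : ℝ} (a0 : 0 ≤ a) (a2 : a ≤ 2) (haa : a' < a) (hev : ∀ i, ev μ i ≤ a') {r : ℕ} (hr : r = 1252)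
    {L : ℝ} (L0 : 0 ≤ L)
    (hL : ∀ x : ℝ, ∀ δ : ℝ, 0 ≤ δ → δ ≤ 1 →
      δ ^ 2 * Dd a (2 * r * (r + 1)) x ≤ 1 / 2016 * ps a (2 * r * (r + 1)) x + L * δ ^ (2 * r * (r + 1)))
    {t : ℝ} (t0 : 0 < t) (t1 : t ≤ 1) :
    EE μ t (fun q => trf (ps a (2 * r * (r + 1))) (tl μ q)) ≤ 6 * L * finrank ℝ E * t ^ r := by
  have hr1 : 1 ≤ r := by omega
  have hP : 2 * r * (r + 1) ≠ 0 := by positivity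
  have hz : trf (ps a (2 * r * (r + 1))) μ = 0 := Finset.sum_eq_zero fun i _ => ps_z a0 hP ((hev i).trans haa.le)
  obtain ⟨C, C0, hC⟩ := init_bd h a0 haa hev hP r
  set Ψ := fun t => EE μ t (fun q => trf (ps a (2 * r * (r + 1))) (tl μ q)) with hΨ
  set n : ℝ := (finrank ℝ E : ℝ) with hn
  have n0 : 0 ≤ n := Nat.cast_nonneg _
  set N := sSup ((fun t => Ψ t / t ^ r) '' Ioc 0 1)
  have ne : ((fun t => Ψ t / t ^ r) '' Ioc 0 1).Nonempty := ⟨_, 1, by simp, rfl⟩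
  have bd : BddAbove ((fun t => Ψ t / t ^ r) '' Ioc 0 1) := by
    refine ⟨C, ?_⟩
    rintro _ ⟨t, ht, rfl⟩
    have := ht.1
    exact (div_le_iff₀ (by positivity)).2 (hC t ht.1 ht.2)
  have hN : ∀ t, 0 < t → t ≤ 1 → Ψ t ≤ N * t ^ r := fun t h0 h1 =>
    (div_le_iff₀ (by positivity)).1 (le_csSup bd ⟨t, ⟨h0, h1⟩, rfl⟩)
  have N0 : 0 ≤ N := by
    have := hN 1 one_pos le_rfl
    simp only [one_pow, mul_one] at this
    exact this.trans' (EE_nonneg h fun θ => Finset.sum_nonneg fun i _ => ps_0 a0 hP _)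
  have hs : N ≤ (626 * N + 3024 * L * n) / r := csSup_le ne (by
    rintro _ ⟨t, ht, rfl⟩
    have := ht.1
    exact (div_le_iff₀ (by positivity)).2 (step h hμ a0 a2 hr1 hz L0 hL N0 hN ht.1 ht.2))
  have er : (r:ℝ) = 1252 := by rw [hr]; norm_num
  rw [er, le_div_iff₀ (by norm_num)] at hs
  have Ln : 0 ≤ L * n := by positivity
  calc _ ≤ N * t ^ r := hN t t0 t1
    _ ≤ _ := by gcongr; linarith

end

section

variable {μ : Measure E} [IsProbabilityMeasure μ] {R : ℝ}

lemma EE_trf_le (h : BS μ R) {f g : ℝ → ℝ} (cf : Continuous f) (cg : Continuous g) {c κ : ℝ} (hfg : ∀ x, 0 ≤ x → f x ≤ κ * g x + c)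
    {t : ℝ} (ht : 0 ≤ t) : EE μ t (fun q => trf f (tl μ q)) ≤ κ * EE μ t (fun q => trf g (tl μ q)) + finrank ℝ E * c := by
  obtain ⟨B1, hB1⟩ := trf_bdd h cf
  obtain ⟨B2, hB2⟩ := trf_bdd h (ψ := fun x => κ * g x) (by fun_prop)
  have c2 := trf_cont h (ψ := fun x => κ * g x) (by fun_prop)
  set k := finrank ℝ E * c
  rw [← EE_const h k ht, ← EE_cmul]
  have : ∀ q, κ * trf g (tl μ q) = trf (fun x => κ * g x) (tl μ q) := fun q => by simp only [trf, mul_sum]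
  simp only [this]
  rw [← EE_add h hB2 c2 (D' := |k|) (fun _ => le_rfl) continuous_const ht]
  exact EE_mono h hB1 (trf_cont h cf) (D' := B2 + |k|) (fun q => (abs_add_le _ _).trans (add_le_add (hB2 q) le_rfl)) (c2.add_const _) ht
    fun θ => trf_sub_le h (fun x hx => hfg x hx.1) _

lemma tr_drift (h : BS μ R) {C : ℝ} {t : ℝ} (ht : 0 ≤ t) (hC : ∀ s ∈ Ioo 0 t, EE μ s (fun q => trf (fun x => x ^ 2) (tl μ q)) ≤ C) :
    EE μ t (fun q => trf (fun x => -x) (tl μ q)) ≤ trf (fun x => -x) μ + C * t := by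
  obtain ⟨L, dd, nc⟩ := NC.exists E (Polynomial.derivative (-Polynomial.X : Polynomial ℝ))
  have hdd : ∀ x y, dd x y = 0 := fun x y => by
    rcases eq_or_ne x y with rfl | hxy
    · simpa using nc.diag x
    · have := nc.dif x y
      simpa [sub_ne_zero.2 hxy] using this
  have e := itoD_Phi h (stdOrthonormalBasis ℝ E) _ nc
  have key := itoD_add_aux h (φ := ph) cont_ph (cd_Phi (-Polynomial.X)) ht (H := fun s => C * s) (H' := fun s => C) (by fun_prop)
    (fun s hs => ((hasDerivAt_id s).const_mul C).congr_deriv (by simp)) (stdOrthonormalBasis ℝ E) (fun s hs => by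
      refine le_of_eq_of_le ?_ (hC s hs)
      congr 1; ext q
      rw [e]; simp [hdd, trf])
  simp only [Phi_MM h] at key
  rw [tl_zero] at key
  simpa using key

lemma thmG {η : ℝ} (h0 : 0 < η) (h1 : η ≤ 1 / 2) : ∃ t : ℝ, 0 < t ∧ t ≤ 1 ∧ ∀ (E : Type) [NormedAddCommGroup E] [InnerProductSpace ℝ E] [FiniteDimensional ℝ E]
    [MeasurableSpace E] [BorelSpace E] (μ : Measure E) [IsProbabilityMeasure μ] (R a' : ℝ), BS μ R → SLC 0 μ → a' < 1 + η → (∀ i, ev μ i ≤ a') →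
    (1 - η) * finrank ℝ E ≤ trf (fun x => x) μ →
    EE μ t (fun q => trf (fun x => (1 - x) ^ 2) (tl μ q)) ≤ 7 * η * finrank ℝ E := by
  set r : ℕ := 1252 with hr
  clear_value r
  set P := 2 * r * (r + 1) with hPd
  have hP : P ≠ 0 := by subst hr; omega
  have a0 : (0:ℝ) ≤ 1 + η := by linarith
  have a2 : 1 + η ≤ 2 := by linarith
  obtain ⟨L, L0, hL⟩ := D_split (a := 1 + η) (P := P) a0 hP (c := 1 / 2016) (by norm_num)
  obtain ⟨C, C0, hC⟩ := one_sub_sq h0 h1 hP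
  set A := 36 + 48 * L + 6 * L * C with hA
  have A0 : 1 < A := by have := mul_nonneg L0 C0; linarith
  set t := η / A with htd
  have tA : t * A = η := by rw [htd]; field_simp
  have t0 : 0 < t := by positivity
  have t1 : t ≤ 1 := by nlinarith
  refine ⟨t, t0, t1, fun E _ _ _ _ _ μ _ R a' h hμ ha hev htr => ?_⟩
  set n : ℝ := (finrank ℝ E : ℝ)
  have n0 : 0 ≤ n := Nat.cast_nonneg _
  have bt : ∀ s, 0 < s → s ≤ 1 → EE μ s (fun q => trf (ps (1 + η) P) (tl μ q)) ≤ 6 * L * n * s := fun s s0 s1 =>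
    (boot h hμ a0 a2 ha hev hr L0 hL s0 s1).trans (mul_le_mul_of_nonneg_left (pow_le_of_le_one s0.le s1 (by omega)) (by positivity))
  have d := tr_drift h (C := (36 + 48 * L) * n) t0.le fun s hs => by
    have s1 := hs.2.le.trans t1
    have := EE_trf_le h (f := fun x => x ^ 2) (by fun_prop) (ps_c (a := 1 + η) (P := P)) (κ := 8) (c := 6 ^ 2)
      (fun x hx => by linarith [ps_K' a0 a2 hP hx]) hs.1.le
    have b2 := bt s hs.1 s1
    have : 6 * L * n * s ≤ 6 * L * n := mul_le_of_le_one_right (by positivity) s1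
    linarith
  have u := EE_trf_le h (f := fun x => (1 - x) ^ 2) (g := fun x => -x + C * ps (1 + η) P x) (by fun_prop) (by have := ps_c (a := 1 + η) (P := P); fun_prop)
    (κ := 1) (c := 1 + 4 * η) (fun x hx => by linarith [hC x hx]) t0.le
  have e : EE μ t (fun q => trf (fun x => -x + C * ps (1 + η) P x) (tl μ q)) =
      EE μ t (fun q => trf (fun x => -x) (tl μ q)) + C * EE μ t (fun q => trf (ps (1 + η) P) (tl μ q)) := by
    have : ∀ q, trf (fun x => -x + C * ps (1 + η) P x) (tl μ q) = trf (fun x => -x) (tl μ q) + trf (fun x => C * ps (1 + η) P x) (tl μ q) := fun q => by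
      simp only [trf, Finset.sum_add_distrib]
    have c2 : Continuous fun x => C * ps (1 + η) P x := by have := ps_c (a := 1 + η) (P := P); fun_prop
    simp only [this]
    obtain ⟨B1, hB1⟩ := trf_bdd h (ψ := fun x => -x) (by fun_prop)
    obtain ⟨B2, hB2⟩ := trf_bdd h c2
    rw [EE_add h hB1 (trf_cont h (by fun_prop)) hB2 (trf_cont h c2) t0.le, ← EE_cmul]
    simp only [trf, mul_sum]
  have e2 : trf (fun x => -x) μ = - trf (fun x => x) μ := by simp [trf]
  rw [e] at u; rw [e2] at d
  have b3 := mul_le_mul_of_nonneg_left (bt t t0 t1) C0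
  have : (36 + 48 * L) * n * t + C * (6 * L * n * t) = n * η := by rw [← tA, hA]; ring
  linarith [mul_nonneg n0 h0.le]

end

section

variable {μ : Measure E} [IsProbabilityMeasure μ] {R : ℝ}

/-- gaussian average -/
def KK (p : Measure E) (s : ℝ) (y : E) : ℝ := exp (-(s / 2) * ‖y‖ ^ 2) * Zq p (s, s • y)

lemma KK_pos (h : BS μ R) (s : ℝ) (y : E) : 0 < KK μ s y := mul_pos (Real.exp_pos _) (Zq_pos h _)

lemma KK_l (h : BS μ R) (s : ℝ) (y : E) : ofReal (KK μ s y) = ∫⁻ x, ofReal (exp (-(s / 2) * ‖y - x‖ ^ 2)) ∂μ := by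
  rw [← ofReal_integral_eq_lintegral_ofReal (h.int (by fun_prop)) (of_forall fun x => (Real.exp_pos _).le), KK, Zq, ← integral_const_mul]
  congr 2; ext x
  rw [← exp_add, exL_apply, norm_sub_sq_real, real_inner_smul_left]; congr 1; ring

lemma KK_mid (h : BS μ R) (hμ : SLC 0 μ) {s : ℝ} (hs : 0 < s) (y w : E) : KK μ s y * KK μ s w ≤ KK μ s ((1/2:ℝ) • (y + w)) ^ 2 := by
  rw [← ENNReal.ofReal_le_ofReal_iff (by positivity), ofReal_mul (KK_pos h s y).le, ENNReal.ofReal_pow (KK_pos h s _).le, KK_l h, KK_l h, KK_l h]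
  refine hμ.lc _ _ _ (by fun_prop) (by fun_prop) (by fun_prop) fun x x' => ?_
  rw [← ofReal_mul (Real.exp_pos _).le, ← ENNReal.ofReal_pow (Real.exp_pos _).le, ← exp_add, ← Real.exp_nat_mul]
  refine ofReal_le_ofReal (Real.exp_le_exp.2 ?_)
  have e : (1/2:ℝ) • (y + w) - (1/2:ℝ) • (x + x') = (1/2:ℝ) • ((y - x) + (w - x')) := by rw [← smul_sub]; congr 1; abel
  have := parallelogram_law_with_norm ℝ (y - x) (w - x')
  rw [e, norm_smul, norm_of_nonneg (by norm_num)]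
  push_cast
  nlinarith [sq_nonneg ‖(y - x) - (w - x')‖]

lemma tang {f : E → ℝ} {b : E} {l : E →L[ℝ] ℝ} (hl : HasFDerivAt f l b) (hm : ∀ y, f b + f y ≤ 2 * f ((1/2:ℝ) • (b + y))) (y : E) :
    f y ≤ f b + l (y - b) := by
  have key : ∀ k : ℕ, f y - f b ≤ (2:ℝ) ^ k * (f (b + ((2:ℝ) ^ k)⁻¹ • (y - b)) - f b) := fun k => by
    induction k with
    | zero => simp
    | succ k ih =>
      have h1 := hm (b + ((2:ℝ) ^ k)⁻¹ • (y - b))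
      have e : (1/2:ℝ) • (b + (b + ((2:ℝ) ^ k)⁻¹ • (y - b))) = b + ((2:ℝ) ^ (k + 1))⁻¹ • (y - b) := by
        rw [pow_succ, mul_inv, mul_comm, mul_smul, ← add_assoc, smul_add, ← two_smul ℝ b, smul_smul]; norm_num
      rw [e] at h1
      have := mul_le_mul_of_nonneg_left h1 (by positivity : (0:ℝ) ≤ 2 ^ k)
      generalize f (b + ((2:ℝ) ^ (k + 1))⁻¹ • (y - b)) = u at *
      rw [pow_succ]; linarith
  have lim := hl.lim (y - b) (c := fun k : ℕ => (2:ℝ) ^ k) (l := Filter.atTop) (by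
    simpa using tendsto_pow_atTop_atTop_of_one_lt (one_lt_two (α := ℝ)))
  have := ge_of_tendsto lim (of_forall key)
  linarith

lemma gauss_fin {s : ℝ} (hs : 0 < s) : ∫⁻ y : E, ofReal (exp (-(s / 2) * ‖y‖ ^ 2)) =
    ofReal ((Real.pi / (s / 2)) ^ (finrank ℝ E / 2 : ℝ)) := by
  rw [← GaussianFourier.integral_rexp_neg_mul_sq_norm (by positivity), ofReal_integral_eq_lintegral_ofReal (int_gauss (by positivity))
    (of_forall fun x => (Real.exp_pos _).le)]

lemma cont_KK (h : BS μ R) (s : ℝ) : Continuous (KK μ s) := by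
  have := cont_Zq h
  unfold KK; fun_prop

lemma KK_int (h : BS μ R) (s : ℝ) {u : E → ℝ≥0∞} (hu : Measurable u) : ∫⁻ y, ofReal (KK μ s y) * u y =
    ∫⁻ x, ∫⁻ y, ofReal (exp (-(s / 2) * ‖y‖ ^ 2)) * u (y + x) ∂volume ∂μ := by
  have e : ∀ y, ofReal (KK μ s y) * u y = ∫⁻ x, ofReal (exp (-(s / 2) * ‖y - x‖ ^ 2)) * u y ∂μ := fun y => by
    rw [KK_l h, lintegral_mul_const _ (by fun_prop)]
  simp only [e]
  rw [lintegral_lintegral_swap (by fun_prop)]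
  refine lintegral_congr fun x => ?_
  rw [← lintegral_add_right_eq_self _ x]
  simp

lemma lemJ (h : BS μ R) (hμ : SLC 0 μ) {s : ℝ} (hs : 0 < s) (w : E) : KK μ s w ≤ 4 ^ finrank ℝ E * KK μ s (bar μ) := by
  set b := bar μ
  set n := finrank ℝ E
  set c := ∫⁻ y : E, ofReal (exp (-(s / 2) * ‖y‖ ^ 2)) with hc
  have c0 : c ≠ 0 := by rw [hc, gauss_fin hs]; simp; positivity
  have ct : c ≠ ⊤ := by rw [hc, gauss_fin hs]; simp
  have dK : DifferentiableAt ℝ (fun y => Real.log (KK μ s y)) b := by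
    refine DifferentiableAt.log ?_ (KK_pos h s b).ne'
    have d1 : DifferentiableAt ℝ (Zq μ) (s, s • b) := by
      have := (hasFDerivAt_N h (φ := fun _ => (1:ℝ)) continuous_const (s, s • b)).differentiableAt
      have e : Zq μ = fun q => ∫ x, exp (exL x q) • (1:ℝ) ∂μ := by ext q; simp [Zq]
      rw [e]; exact this
    have d2 : DifferentiableAt ℝ (fun y : E => Zq μ (s, s • y)) b := d1.comp (f := fun y : E => (s, s • y)) b (by fun_prop)
    have d3 : DifferentiableAt ℝ (fun y : E => ‖y‖ ^ 2) b := (contDiff_norm_sq ℝ (n := 1)).differentiable (by norm_num) b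
    unfold KK; fun_prop
  obtain ⟨l, hl⟩ := dK
  have ht : ∀ y, KK μ s y ≤ KK μ s b * exp (l (y - b)) := fun y => by
    have := tang hl (fun y => by
      rw [← Real.log_mul (KK_pos h s _).ne' (KK_pos h s _).ne', show (2:ℝ) = (2:ℕ) by norm_num, ← Real.log_pow]
      exact Real.log_le_log (mul_pos (KK_pos h s _) (KK_pos h s _)) (KK_mid h hμ hs _ _)) y
    rwa [← Real.exp_le_exp, exp_add, Real.exp_log (KK_pos h s _), Real.exp_log (KK_pos h s _)] at this
  have pt : ∀ y, √(KK μ s w) * (KK μ s y * exp (-(l (y - b)) / 2)) ≤ √(KK μ s b) * KK μ s ((1/2:ℝ) • (y + w)) := fun y => by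
    refine le_of_sq_le_sq ?_ (mul_nonneg (Real.sqrt_nonneg _) (KK_pos h s _).le)
    have e : exp (-(l (y - b)) / 2) ^ 2 * exp (l (y - b)) = 1 := by
      rw [← Real.exp_nat_mul, ← exp_add]; simp; ring
    rw [mul_pow, mul_pow, mul_pow, sq_sqrt (KK_pos h s _).le, sq_sqrt (KK_pos h s _).le]
    calc _ = KK μ s y * KK μ s w * (KK μ s y * exp (-(l (y - b)) / 2) ^ 2) := by ring
      _ ≤ KK μ s ((1/2:ℝ) • (y + w)) ^ 2 * (KK μ s b * exp (l (y - b)) * exp (-(l (y - b)) / 2) ^ 2) := by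
          gcongr
          · exact mul_nonneg (KK_pos h s _).le (by positivity)
          · exact KK_mid h hμ hs _ _
          · exact ht y
      _ = KK μ s ((1/2:ℝ) • (y + w)) ^ 2 * (KK μ s b * (exp (-(l (y - b)) / 2) ^ 2 * exp (l (y - b)))) := by ring
      _ = _ := by rw [e]; ring
  have cK := cont_KK h s
  have i1 : ∫⁻ y, ofReal (KK μ s ((1/2:ℝ) • (y + w))) = 2 ^ n * c := by
    rw [lintegral_add_right_eq_self (fun y => ofReal (KK μ s ((1/2:ℝ) • y))) w]
    have := lintegral_map (μ := (volume : Measure E)) (f := fun y => ofReal (KK μ s y)) (g := fun y => (1/2:ℝ) • y) (by fun_prop) (by fun_prop)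
    rw [← this, Measure.map_addHaar_smul _ (by norm_num), lintegral_smul_measure, smul_eq_mul]
    congr 1
    · rw [← ENNReal.ofReal_ofNat, ← ENNReal.ofReal_pow (by norm_num)]; congr 1
      rw [abs_of_pos (by positivity)]; simp [n]
    · have := KK_int h s (u := fun _ => 1) measurable_const
      simpa [hc] using this
  have i2 : c ≤ ∫⁻ y, ofReal (KK μ s y) * ofReal (exp (-(l (y - b)) / 2)) := by
    rw [KK_int h s (by fun_prop)]
    have in1 : ∀ x, c * ofReal (exp (-(l (x - b)) / 2)) ≤
        ∫⁻ y, ofReal (exp (-(s / 2) * ‖y‖ ^ 2)) * ofReal (exp (-(l (y + x - b)) / 2)) := fun x => by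
      have e : ∀ y, ofReal (exp (-(s / 2) * ‖y‖ ^ 2)) * ofReal (exp (-(l (y + x - b)) / 2)) =
          ofReal (exp (-(s / 2) * ‖y‖ ^ 2)) * ofReal (exp (-(l y) / 2)) * ofReal (exp (-(l (x - b)) / 2)) := fun y => by
        rw [mul_assoc, ← ofReal_mul (Real.exp_pos (-(l y) / 2)).le, ← exp_add, add_sub_assoc, map_add]; congr 3; ring
      simp only [e]
      rw [lintegral_mul_const _ (by fun_prop)]
      gcongr
      set A := ∫⁻ y : E, ofReal (exp (-(s / 2) * ‖y‖ ^ 2)) * ofReal (exp (-(l y) / 2)) with hA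
      have hA' : A = ∫⁻ y : E, ofReal (exp (-(s / 2) * ‖y‖ ^ 2)) * ofReal (exp ((l y) / 2)) := by
        rw [hA, ← lintegral_neg_eq_self]; simp
      have : c + c ≤ A + A := by
        nth_rw 2 [hA']
        rw [hA, hc, ← lintegral_add_left (by fun_prop), ← lintegral_add_left (by fun_prop)]
        refine lintegral_mono fun y => ?_
        simp only
        rw [← mul_add, ← mul_two]
        gcongr
        rw [← ENNReal.ofReal_add (Real.exp_pos _).le (Real.exp_pos _).le, ← ENNReal.ofReal_ofNat]
        refine ofReal_le_ofReal ?_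
        linarith [Real.add_one_le_exp (-(l y) / 2), Real.add_one_le_exp (l y / 2)]
      rw [← two_mul, ← two_mul] at this
      exact (ENNReal.mul_le_mul_iff_right (by norm_num) (by norm_num)).1 this
    refine le_trans ?_ (lintegral_mono in1)
    rw [lintegral_const_mul _ (by fun_prop)]
    refine le_mul_of_one_le_right' ?_
    rw [← ofReal_integral_eq_lintegral_ofReal (h.int (by fun_prop)) (of_forall fun x => (Real.exp_pos _).le), ENNReal.one_le_ofReal]
    have e : ∫ x, (1 + -(l (x - b)) / 2) ∂μ = 1 := by
      rw [integral_add (integrable_const _) (h.int (by fun_prop)), integral_div, integral_neg, ContinuousLinearMap.integral_comp_comm l (h.int (by fun_prop)),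
        integral_sub (h.int (by fun_prop)) (h.int (by fun_prop))]
      simp [b, bar]
    rw [← e]
    exact integral_mono (h.int (by fun_prop)) (h.int (by fun_prop)) fun x => by linarith [Real.add_one_le_exp (-(l (x - b)) / 2)]
  have fin : ofReal (√(KK μ s w)) * c ≤ ofReal (√(KK μ s b) * 2 ^ n) * c := by
    calc _ ≤ ofReal (√(KK μ s w)) * ∫⁻ y, ofReal (KK μ s y) * ofReal (exp (-(l (y - b)) / 2)) := by gcongr
      _ = ∫⁻ y, ofReal (√(KK μ s w) * (KK μ s y * exp (-(l (y - b)) / 2))) := by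
        rw [← lintegral_const_mul _ (by fun_prop)]
        refine lintegral_congr fun y => ?_
        rw [ofReal_mul (Real.sqrt_nonneg _), ofReal_mul (KK_pos h s _).le]
      _ ≤ ∫⁻ y, ofReal (√(KK μ s b)) * ofReal (KK μ s ((1/2:ℝ) • (y + w))) := by
        refine lintegral_mono fun y => ?_
        rw [← ofReal_mul (Real.sqrt_nonneg _)]; exact ofReal_le_ofReal (pt y)
      _ = _ := by
        rw [lintegral_const_mul _ (by fun_prop), i1, ofReal_mul (Real.sqrt_nonneg _), ENNReal.ofReal_pow (by norm_num)]; simp [mul_assoc]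
  have f2 := (ENNReal.ofReal_le_ofReal_iff (by positivity)).1 ((ENNReal.mul_le_mul_iff_left c0 ct).1 fin)
  have := pow_le_pow_left₀ (Real.sqrt_nonneg _) f2 2
  rw [mul_pow, sq_sqrt (KK_pos h s _).le, sq_sqrt (KK_pos h s _).le, ← pow_mul, mul_comm n 2, pow_mul] at this
  norm_num at this; linarith

end

section

variable {μ : Measure E} [IsProbabilityMeasure μ] {R : ℝ}

lemma ga_cm (c : E) {F : E → ℝ≥0∞} : ∫⁻ g, ofReal (exp (⟪g, c⟫ - ‖c‖ ^ 2 / 2)) * F g ∂ga E = ∫⁻ g, F (g + c) ∂ga E := by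
  rw [ga, lintegral_tilted, lintegral_tilted, ← lintegral_add_right_eq_self _ c]
  refine lintegral_congr fun g => ?_
  rw [← mul_assoc, ← ofReal_mul (by positivity), div_mul_eq_mul_div, ← exp_add]
  congr 4
  rw [norm_add_sq_real, inner_add_left, real_inner_self_eq_norm_sq]; ring

lemma ga_sq : Integrable (fun g : E => ‖g‖ ^ 2) (ga E) ∧ ∫ g, ‖g‖ ^ 2 ∂ga E = finrank ℝ E := by
  set e := stdOrthonormalBasis ℝ E
  have e1 : ∀ g : E, ‖g‖ ^ 2 = ∑ i, ⟪g, e i⟫ * ⟪g, e i⟫ := fun g => by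
    rw [← e.sum_sq_norm_inner_left g]; simp [sq]
  have i1 : ∀ i ∈ Finset.univ, Integrable (fun g : E => ⟪g, e i⟫ * ⟪g, e i⟫) (ga E) := fun i _ => ((EB.inner (e i)).mul (EB.inner (e i))).int (by fun_prop)
  simp only [e1]
  refine ⟨integrable_finsetSum _ i1, ?_⟩
  rw [integral_finsetSum _ i1]
  have : ∀ i, ∫ g, ⟪g, e i⟫ * ⟪g, e i⟫ ∂ga E = 1 := fun i => by
    rw [← ga_ibp (H := fun g => ⟪g, e i⟫) (H' := fun _ => 1) (v := e i) (EB.inner _) ⟨1, 0, by norm_num, le_rfl, by simp⟩ (by fun_prop) (by fun_prop) fun x => ?_]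
    · simp
    · have : HasFDerivAt (fun g : E => ⟪g, e i⟫) ((innerSL ℝ).flip (e i)) x := ((innerSL ℝ).flip (e i)).hasFDerivAt
      have := this.hasLineDerivAt (e i)
      have e2 : ((innerSL ℝ).flip (e i)) (e i) = (1:ℝ) := by
        change ⟪e i, e i⟫ = 1
        simp
      rw [e2] at this; exact this
  simp [this]

lemma th2 (h : BS μ R) {t : ℝ} (t0 : 0 ≤ t) : Integrable (fun g => Zq μ (t, √t • g) * ‖g‖ ^ 2) (ga E) ∧
    ∫ g, Zq μ (t, √t • g) * ‖g‖ ^ 2 ∂ga E ≤ 2 * finrank ℝ E + 2 * t * ∫ x, ‖x‖ ^ 2 ∂μ := by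
  set n : ℝ := (finrank ℝ E : ℝ)
  have cZ := cont_Zq h
  have p0 : ∀ g, 0 ≤ Zq μ (t, √t • g) * ‖g‖ ^ 2 := fun g => mul_nonneg (Zq_pos h _).le (by positivity)
  have key : ∫⁻ g, ofReal (Zq μ (t, √t • g) * ‖g‖ ^ 2) ∂ga E ≤ ofReal (2 * n + 2 * t * ∫ x, ‖x‖ ^ 2 ∂μ) := by
    have e : ∀ g, ofReal (Zq μ (t, √t • g) * ‖g‖ ^ 2) =
        ∫⁻ x, ofReal (exp (⟪g, √t • x⟫ - ‖√t • x‖ ^ 2 / 2)) * ofReal (‖g‖ ^ 2) ∂μ := fun g => by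
      rw [lintegral_mul_const _ (by fun_prop), ofReal_mul (Zq_pos h _).le, Zq, ofReal_integral_eq_lintegral_ofReal (h.int_exp _)
        (of_forall fun x => (Real.exp_pos _).le)]
      congr 2; ext x
      rw [exL_apply, norm_smul, norm_of_nonneg (Real.sqrt_nonneg t), mul_pow, sq_sqrt t0, real_inner_smul_left, real_inner_smul_right]
      congr 3; ring
    simp only [e]
    rw [lintegral_lintegral_swap (by fun_prop)]
    simp only [ga_cm]
    calc _ ≤ ∫⁻ x, ofReal (2 * n + 2 * t * ‖x‖ ^ 2) ∂μ := by
          refine lintegral_mono fun x => ?_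
          have e2 : ∫ g, (2 * ‖g‖ ^ 2 + 2 * t * ‖x‖ ^ 2) ∂ga E = 2 * n + 2 * t * ‖x‖ ^ 2 := by
            rw [integral_add (ga_sq.1.const_mul 2) (integrable_const _), integral_const_mul, ga_sq.2]; simp [n]
          have ii : Integrable (fun g : E => 2 * ‖g‖ ^ 2 + 2 * t * ‖x‖ ^ 2) (ga E) := (ga_sq.1.const_mul 2).add (integrable_const _)
          simp only
          rw [← e2, ofReal_integral_eq_lintegral_ofReal ii (of_forall fun g => by positivity)]
          refine lintegral_mono fun g => ofReal_le_ofReal ?_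
          have := parallelogram_law_with_norm ℝ g (√t • x)
          have e3 : ‖√t • x‖ * ‖√t • x‖ = t * ‖x‖ ^ 2 := by
            rw [norm_smul, norm_of_nonneg (Real.sqrt_nonneg t), ← sq, mul_pow, sq_sqrt t0]
          linarith [sq_nonneg ‖g - √t • x‖]
      _ = _ := by
          rw [← ofReal_integral_eq_lintegral_ofReal (h.int (by fun_prop)) (of_forall fun g => by positivity),
            integral_add (integrable_const _) (h.int (by fun_prop))]; simp [integral_const_mul]
  have mm : AEStronglyMeasurable (fun g => Zq μ (t, √t • g) * ‖g‖ ^ 2) (ga E) := by fun_prop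
  refine ⟨⟨mm, ?_⟩, ?_⟩
  · rw [hasFiniteIntegral_iff_ofReal (of_forall p0)]
    exact key.trans_lt ENNReal.ofReal_lt_top
  · rw [integral_eq_lintegral_of_nonneg_ae (of_forall p0) mm]
    exact ENNReal.toReal_le_of_le_ofReal (by positivity) key

lemma good (h : BS μ R) {t κ n : ℝ} (t0 : 0 < t) (t1 : t ≤ 1) (hn : n = finrank ℝ E) (n0 : 0 < n) (κ0 : 0 < κ)
    (hk : EE μ t (fun q => trf (fun x => (1 - x) ^ 2) (tl μ q)) ≤ κ * n) (m2 : ∫ x, ‖x‖ ^ 2 ∂μ ≤ 2 * n) :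
    ofReal (1 / 2 * (2 * Real.pi) ^ (n / 2)) ≤ volume {g : E | trf (fun x => (1 - x) ^ 2) (tl μ (t, √t • g)) ≤ 8 * κ * n ∧
      MM μ (fun x => ‖x‖ ^ 2) (t, √t • g) ≤ 16 * n ∧ ‖g‖ ^ 2 ≤ 48 * n} := by
  set G := {g : E | trf (fun x => (1 - x) ^ 2) (tl μ (t, √t • g)) ≤ 8 * κ * n ∧
      MM μ (fun x => ‖x‖ ^ 2) (t, √t • g) ≤ 16 * n ∧ ‖g‖ ^ 2 ≤ 48 * n} with hG
  have cT := trf_cont h (ψ := fun x => (1 - x) ^ 2) (by fun_prop)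
  have cM := cont_MM h (φ := fun x => ‖x‖ ^ 2) (by fun_prop)
  have cZ := cont_Zq h
  obtain ⟨B1, hB1⟩ := trf_bdd h (ψ := fun x => (1 - x) ^ 2) (by fun_prop)
  obtain ⟨B2, -, hB2⟩ := bdd_MM h (φ := fun x => ‖x‖ ^ 2) (by fun_prop)
  have mG : MeasurableSet G := by
    refine IsClosed.measurableSet ?_
    refine IsClosed.inter (s₁ := {g : E | (_:ℝ) ≤ _}) (isClosed_le (cT.comp (g := fun q : ℝ × E => trf (fun x => (1 - x) ^ 2) (tl μ q)) (f := fun g => (t, √t • g)) (by fun_prop)) continuous_const) (IsClosed.inter (s₁ := {g : E | (_:ℝ) ≤ _}) (s₂ := {g : E | (_:ℝ) ≤ _}) (isClosed_le ?_ ?_) (isClosed_le ?_ ?_)) <;> fun_prop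
  have T0 : ∀ g : E, 0 ≤ trf (fun x => (1 - x) ^ 2) (tl μ (t, √t • g)) := fun g => Finset.sum_nonneg fun i _ => sq_nonneg _
  have M0 : ∀ g : E, 0 ≤ MM μ (fun x => ‖x‖ ^ 2) (t, √t • g) := fun g => integral_nonneg fun x => by positivity
  obtain ⟨i3, h3⟩ := th2 h t0.le
  have i0 := EE_int h (F := fun _ => 1) (D := 1) (by simp) continuous_const t0.le
  have i1 := EE_int h hB1 cT t0.le
  have i2 := EE_int h hB2 cM t0.le
  have e0 : ∫ g, Zq μ (t, √t • g) * 1 ∂ga E = 1 := EE_one h t0.le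
  have e2 : ∫ g, Zq μ (t, √t • g) * MM μ (fun x => ‖x‖ ^ 2) (t, √t • g) ∂ga E = ∫ x, ‖x‖ ^ 2 ∂μ := EE_M h (by fun_prop) t0.le
  set a := (8 * κ * n)⁻¹
  set b := (16 * n)⁻¹
  set c := (48 * n)⁻¹
  have a0 : 0 < a := by positivity
  have b0 : 0 < b := by positivity
  have c0 : 0 < c := by positivity
  set f : E → ℝ := fun g => Zq μ (t, √t • g) * 1 - a * (Zq μ (t, √t • g) * trf (fun x => (1 - x) ^ 2) (tl μ (t, √t • g)))
    - b * (Zq μ (t, √t • g) * MM μ (fun x => ‖x‖ ^ 2) (t, √t • g)) - c * (Zq μ (t, √t • g) * ‖g‖ ^ 2) with hf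
  have if_ : Integrable f (ga E) := ((i0.sub (i1.const_mul a)).sub (i2.const_mul b)).sub (i3.const_mul c)
  have k1 : Integrable (fun g => Zq μ (t, √t • g) * 1 - a * (Zq μ (t, √t • g) * trf (fun x => (1 - x) ^ 2) (tl μ (t, √t • g)))) (ga E) := i0.sub (i1.const_mul a)
  have k2 : Integrable (fun g => Zq μ (t, √t • g) * 1 - a * (Zq μ (t, √t • g) * trf (fun x => (1 - x) ^ 2) (tl μ (t, √t • g)))
    - b * (Zq μ (t, √t • g) * MM μ (fun x => ‖x‖ ^ 2) (t, √t • g))) (ga E) := k1.sub (i2.const_mul b)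
  have vf : 1 / 2 ≤ ∫ g, f g ∂ga E := by
    rw [hf, integral_sub k2 (i3.const_mul c), integral_sub k1 (i2.const_mul b),
      integral_sub i0 (i1.const_mul a), integral_const_mul, integral_const_mul, integral_const_mul, e0, e2]
    have q1 : a * (∫ g, Zq μ (t, √t • g) * trf (fun x => (1 - x) ^ 2) (tl μ (t, √t • g)) ∂ga E) ≤ 1 / 8 :=
      (mul_le_mul_of_nonneg_left hk a0.le).trans (by simp only [a]; field_simp; norm_num)
    have q2 : b * ∫ x, ‖x‖ ^ 2 ∂μ ≤ 1 / 8 := (mul_le_mul_of_nonneg_left m2 b0.le).trans (by simp only [b]; field_simp; norm_num)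
    have q3 : c * (∫ g, Zq μ (t, √t • g) * ‖g‖ ^ 2 ∂ga E) ≤ 1 / 8 := by
      have : 2 * n + 2 * t * ∫ x, ‖x‖ ^ 2 ∂μ ≤ 6 * n := by
        have : 0 ≤ ∫ x, ‖x‖ ^ 2 ∂μ := by positivity
        linarith [mul_le_of_le_one_left this t1]
      refine (mul_le_mul_of_nonneg_left ((h3.trans (by rw [← hn])).trans this) c0.le).trans (by simp only [c]; field_simp; norm_num)
    linarith
  have pt : ∀ g, ofReal (f g) ≤ G.indicator (fun g => ofReal (exp (‖g‖ ^ 2 / 2))) g := fun g => by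
    have z0 := Zq_pos h (t, √t • g)
    have ef : f g = Zq μ (t, √t • g) * (1 - a * trf (fun x => (1 - x) ^ 2) (tl μ (t, √t • g)) - b * MM μ (fun x => ‖x‖ ^ 2) (t, √t • g) - c * ‖g‖ ^ 2) := by
      rw [hf]; ring
    have s1 := mul_nonneg a0.le (T0 g)
    have s2 := mul_nonneg b0.le (M0 g)
    have s3 := mul_nonneg c0.le (sq_nonneg ‖g‖)
    by_cases hg : g ∈ G
    · rw [indicator_of_mem hg]
      refine ofReal_le_ofReal ?_
      have : f g ≤ Zq μ (t, √t • g) := by rw [ef]; exact mul_le_of_le_one_right z0.le (by linarith)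
      refine this.trans ?_
      have : ∫ x, exp (exL x (t, √t • g)) ∂μ ≤ ∫ x, exp (‖g‖ ^ 2 / 2) ∂μ := by
        refine integral_mono (h.int_exp _) (integrable_const _) fun x => Real.exp_le_exp.2 ?_
        rw [exL_apply, real_inner_smul_left]
        have := real_inner_le_norm g x
        have s4 : √t * √t = t := Real.mul_self_sqrt t0.le
        have s5 : (√t * ‖x‖) ^ 2 = t * ‖x‖ ^ 2 := by rw [mul_pow, sq_sqrt t0.le]
        linarith [sq_nonneg (‖g‖ - √t * ‖x‖), mul_le_mul_of_nonneg_left this (Real.sqrt_nonneg t)]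
      simpa [Zq] using this
    · rw [indicator_of_notMem hg, ENNReal.ofReal_of_nonpos]
      rw [ef]
      refine mul_nonpos_of_nonneg_of_nonpos z0.le ?_
      have cl : ∀ {u v : ℝ}, 0 < v → ¬ u ≤ v → 1 ≤ v⁻¹ * u := fun hv hu => by
        rw [← div_eq_inv_mul, one_le_div hv]; linarith
      by_contra! hc
      refine hg ⟨?_, ?_, ?_⟩ <;> by_contra hh
      · have := cl (by positivity) hh; linarith
      · have := cl (by positivity) hh; linarith
      · have := cl (by positivity) hh; linarith
  have l1 : ofReal (1 / 2) ≤ ∫⁻ g, G.indicator (fun g => ofReal (exp (‖g‖ ^ 2 / 2))) g ∂ga E := by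
    refine le_trans ?_ (lintegral_mono pt)
    refine ENNReal.ofReal_le_of_le_toReal (vf.trans ?_)
    rw [integral_eq_lintegral_pos_part_sub_lintegral_neg_part if_]
    linarith [ENNReal.toReal_nonneg (a := ∫⁻ g, ofReal (-f g) ∂ga E)]
  have eI : ∫ x : E, exp (-(1/2:ℝ) * ‖x‖ ^ 2) = (2 * Real.pi) ^ (n / 2) := by
    rw [GaussianFourier.integral_rexp_neg_mul_sq_norm (by norm_num), ← hn]; congr 1; ring
  have P0 : 0 < (2 * Real.pi) ^ (n / 2) := by positivity
  rw [ga, lintegral_tilted, eI] at l1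
  have e5 : ∀ g : E, ofReal (exp (-(1/2:ℝ) * ‖g‖ ^ 2) / (2 * Real.pi) ^ (n / 2)) * G.indicator (fun g => ofReal (exp (‖g‖ ^ 2 / 2))) g
      = G.indicator (fun _ => ofReal ((2 * Real.pi) ^ (n / 2))⁻¹) g := fun g => by
    by_cases hg : g ∈ G
    · rw [indicator_of_mem hg, indicator_of_mem hg, ← ofReal_mul (by positivity), div_mul_eq_mul_div, ← exp_add]
      congr 1
      rw [show -(1/2:ℝ) * ‖g‖ ^ 2 + ‖g‖ ^ 2 / 2 = 0 by ring, Real.exp_zero, one_div]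
    · simp [hg]
  simp only [e5] at l1
  rw [lintegral_indicator_const mG, ENNReal.ofReal_inv_of_pos P0] at l1
  rw [ofReal_mul (by norm_num)]
  calc _ ≤ (ofReal ((2 * Real.pi) ^ (n / 2)))⁻¹ * volume G * ofReal ((2 * Real.pi) ^ (n / 2)) := by gcongr
    _ = volume G := by
      rw [mul_comm, ← mul_assoc, ENNReal.mul_inv_cancel (by simpa using P0) ENNReal.ofReal_ne_top, one_mul]

end

section

variable {μ : Measure E} [IsProbabilityMeasure μ] {R : ℝ}

lemma bar_sq (h : BS μ R) : ‖bar μ‖ ^ 2 ≤ ∫ x, ‖x‖ ^ 2 ∂μ := by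
  have i1 : Integrable (fun x => 2 * ⟪x, bar μ⟫) μ := h.int (by fun_prop)
  have : ∫ x, (2 * ⟪x, bar μ⟫ - ‖bar μ‖ ^ 2) ∂μ ≤ ∫ x, ‖x‖ ^ 2 ∂μ := by
    refine integral_mono (i1.sub (integrable_const _)) (h.int (by fun_prop)) fun x => ?_
    have := norm_sub_sq_real x (bar μ)
    simp only
    linarith [sq_nonneg ‖x - bar μ‖]
  rw [integral_sub i1 (integrable_const _), integral_const_mul, ← inner_bar h, real_inner_self_eq_norm_sq] at this
  simp at this; linarith

lemma bar_deriv (h : BS μ R) (t δ : ℝ) (g : E) : HasFDerivAt (fun g : E => bar (tl μ (t, √t • g)) + (δ * √t) • g)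
    (√t • (cov (tl μ (t, √t • g)) + δ • ContinuousLinearMap.id ℝ E)) g := by
  set q : ℝ × E := (t, √t • g) with hq
  obtain ⟨L, hL, hv⟩ := hasFDerivAt_MM h (φ := fun x => x) continuous_id q
  have := h.tl_prob q
  have eL : ∀ e, L (0, e) = cov (tl μ q) e := fun e => by
    rw [hv]
    refine ext_inner_left ℝ fun v => ?_
    rw [cov_raw (h.tl q), cv, MM, MM, inner_sub_right, real_inner_smul_right, ← integral_inner ((h.tl q).int (by fun_prop))]
    simp only [exL_apply, real_inner_smul_right]
    congr 1
    · refine integral_congr_ae (of_forall fun x => ?_)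
      simp only [zero_div, zero_mul, sub_zero, real_inner_comm]; rw [mul_comm]
    · simp only [zero_div, zero_mul, sub_zero]
      rw [inner_bar (h.tl q) e, real_inner_comm v, mul_comm]
      congr 1
      exact integral_congr_ae (of_forall fun x => real_inner_comm _ _)
  have d1 : HasFDerivAt (fun g : E => (t, √t • g)) ((0 : E →L[ℝ] ℝ).prod (√t • ContinuousLinearMap.id ℝ E)) g :=
    (hasFDerivAt_const t g).prodMk ((hasFDerivAt_id g).const_smul √t)
  have d2 := (hL.comp g d1).add ((hasFDerivAt_id (𝕜 := ℝ) g).const_smul (δ * √t))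
  refine d2.congr_fderiv ?_
  ext v
  simp only [ContinuousLinearMap.comp_apply, ContinuousLinearMap.prod_apply, _root_.add_apply, _root_.smul_apply, _root_.zero_apply, ContinuousLinearMap.id_apply, eL, map_smul, smul_add, smul_smul, mul_comm]

lemma bar_det (p : Measure E) (c δ : ℝ) : (c • (cov p + δ • ContinuousLinearMap.id ℝ E)).det = ∏ i, (c * (ev p i + δ)) := by
  rw [ContinuousLinearMap.det, ← LinearMap.det_toMatrix (eb p).toBasis]
  rw [← Matrix.det_diagonal]
  congr 1
  ext i j
  rw [LinearMap.toMatrix_apply]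
  simp only [OrthonormalBasis.coe_toBasis, OrthonormalBasis.coe_toBasis_repr_apply, ContinuousLinearMap.coe_coe, _root_.add_apply, _root_.smul_apply, ContinuousLinearMap.id_apply, cov_eb, ← add_smul, smul_smul]
  rw [OrthonormalBasis.repr_apply_apply, real_inner_smul_right, orthonormal_iff_ite.1 (eb p).orthonormal i j, Matrix.diagonal_apply]
  split_ifs with hh
  · subst hh; ring
  · ring

lemma bar_inj (h : BS μ R) {t δ : ℝ} (t0 : 0 < t) (δ0 : 0 < δ) : Function.Injective (fun g : E => bar (tl μ (t, √t • g)) + (δ * √t) • g) := by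
  intro g1 g2 he
  by_contra hne
  set v := g2 - g1
  have v0 : 0 < ‖v‖ := norm_pos_iff.2 (sub_ne_zero.2 (Ne.symm hne))
  set Y := fun g : E => bar (tl μ (t, √t • g)) + (δ * √t) • g with hY
  have hd : ∀ r : ℝ, HasDerivAt (fun r : ℝ => ⟪v, Y (g1 + r • v)⟫) ⟪v, (√t • (cov (tl μ (t, √t • (g1 + r • v))) + δ • ContinuousLinearMap.id ℝ E)) v⟫ r := fun r => by
    have d0 : HasDerivAt (fun r : ℝ => g1 + r • v) v r := by simpa using ((hasDerivAt_id r).smul_const v).const_add g1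
    have d1 := (bar_deriv h t δ (g1 + r • v)).comp_hasDerivAt r d0
    simpa only [Function.comp, inner_zero_left, add_zero] using (hasDerivAt_const r v).inner ℝ d1
  have sm : StrictMono (fun r : ℝ => ⟪v, Y (g1 + r • v)⟫) := by
    refine strictMono_of_deriv_pos fun r => ?_
    rw [(hd r).deriv]
    have := h.tl_prob (t, √t • (g1 + r • v))
    have c0 : 0 ≤ ⟪v, cov (tl μ (t, √t • (g1 + r • v))) v⟫ := by
      rw [cov_inner (h.tl _)]; exact integral_nonneg fun x => mul_self_nonneg _
    simp only [_root_.add_apply, _root_.smul_apply, ContinuousLinearMap.id_apply, inner_add_right, real_inner_smul_right, real_inner_self_eq_norm_sq]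
    have := Real.sqrt_pos.2 t0
    positivity
  have := sm (zero_lt_one)
  simp only [zero_smul, one_smul, add_zero, v, add_sub_cancel] at this
  rw [show Y g1 = Y g2 from he] at this
  exact lt_irrefl _ this

lemma det_low {k : ℕ} {a : Fin k → ℝ} {δ : ℝ} (ha : ∀ i, 0 ≤ a i) (d0 : 0 < δ) (d1 : δ ≤ 1) {B : ℝ} (hB : ∑ i, (1 - a i) ^ 2 ≤ B) :
    (1 / 2 : ℝ) ^ k * δ ^ (4 * B) ≤ ∏ i, (a i + δ) := by
  have : ∀ i ∈ Finset.univ, 1 / 2 * δ ^ (4 * (1 - a i) ^ 2) ≤ a i + δ := fun i _ => by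
    by_cases hi : 1 / 2 ≤ a i
    · have := Real.rpow_le_one d0.le d1 (show 0 ≤ 4 * (1 - a i) ^ 2 by positivity)
      linarith
    · have : δ ^ (4 * (1 - a i) ^ 2) ≤ δ ^ (1:ℝ) := Real.rpow_le_rpow_of_exponent_ge d0 d1 (by nlinarith)
      rw [Real.rpow_one] at this
      linarith [ha i]
  have := Finset.prod_le_prod (fun i _ => by positivity) this
  refine le_trans ?_ this
  rw [Finset.prod_mul_distrib, Finset.prod_const, ← Real.rpow_sum_of_pos d0, ← mul_sum]
  simp only [Finset.card_univ, Fintype.card_fin]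
  gcongr ?_ * ?_
  exact Real.rpow_le_rpow_of_exponent_ge d0 d1 (by linarith)

lemma KK_tl (h : BS μ R) (t s : ℝ) (θ y : E) : KK (tl μ (t, θ)) s y = exp (-(s / 2) * ‖y‖ ^ 2) * (Zq μ (t + s, θ + s • y) / Zq μ (t, θ)) := by
  rw [KK, Zq_tl h]; rfl

lemma KK_cmp (h : BS μ R) (hμ : SLC 0 μ) {t δ N : ℝ} (t0 : 0 < t) (t1 : t ≤ 1) (d0 : 0 < δ) (d1 : δ ≤ 1 / 2) {θ z : E}
    (hz : ‖z‖ ^ 2 ≤ 2 * N) (hθ : ‖θ‖ ^ 2 ≤ 48 * N) (hb : MM μ (fun x => ‖x‖ ^ 2) (t, θ) ≤ 16 * N) :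
    KK μ (t + δ⁻¹) z ≤ 4 ^ finrank ℝ E * exp (164 * N) * KK (tl μ (t, 0)) δ⁻¹ (bar (tl μ (t, θ)) + δ • θ) := by
  have := h.tl_prob (t, θ)
  set b := bar (tl μ (t, θ)) with hbd
  have hb2 : ‖b‖ ^ 2 ≤ 16 * N := (bar_sq (h.tl (t, θ))).trans hb
  set s := δ⁻¹ with hs
  have s0 : 0 < s := by positivity
  have sd : s * δ = 1 := inv_mul_cancel₀ d0.ne'
  have sl : SLC 0 (tl μ (t, θ)) := fun f g k hf hg hk hh => LC.tl_slc h hμ (t, θ) f g k hf hg hk fun x y => (hh x y).trans (by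
    gcongr; simp only; linarith)
  have J := lemJ (h.tl (t, θ)) sl s0 (δ • ((t + s) • z - θ))
  rw [KK_tl h, KK_tl h, smul_smul, sd, one_smul, add_sub_cancel, ← hbd] at J
  have zθ := Zq_pos h (t, θ)
  have z0 := Zq_pos h (t, (0:E))
  have z1 : Zq μ (t, (0:E)) ≤ 1 := by
    have : ∫ x, exp (exL x (t, (0:E))) ∂μ ≤ ∫ x, 1 ∂μ := by
      refine integral_mono (h.int_exp _) (integrable_const _) fun x => ?_
      simp only [exL_apply, inner_zero_left, zero_sub]
      rw [Real.exp_le_one_iff]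
      have : 0 ≤ t / 2 * ‖x‖ ^ 2 := by positivity
      linarith
    simpa [Zq] using this
  rw [KK_tl h, smul_add, smul_smul, sd, one_smul, zero_add, add_comm (s • b) θ, KK]
  set A := Zq μ (t + s, (t + s) • z)
  set B := Zq μ (t + s, θ + s • b)
  have B0 : 0 < B := Zq_pos h _
  set w := δ • ((t + s) • z - θ)
  have J' : exp (-(s / 2) * ‖w‖ ^ 2) * A ≤ 4 ^ finrank ℝ E * (exp (-(s / 2) * ‖b‖ ^ 2) * B) := by
    rw [← mul_div_assoc, ← mul_div_assoc, ← mul_div_assoc] at J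
    exact (div_le_div_iff_of_pos_right zθ).1 J
  have X : -((t + s) / 2) * ‖z‖ ^ 2 + s / 2 * ‖w‖ ^ 2 - s / 2 * ‖b‖ ^ 2 + s / 2 * ‖b + δ • θ‖ ^ 2 ≤ 164 * N := by
    have ew : ‖w‖ ^ 2 = δ ^ 2 * ((t + s) ^ 2 * ‖z‖ ^ 2 - 2 * ((t + s) * ⟪z, θ⟫) + ‖θ‖ ^ 2) := by
      rw [norm_smul, mul_pow, norm_sub_sq_real, norm_smul, mul_pow, real_inner_smul_left, Real.norm_eq_abs, Real.norm_eq_abs, sq_abs, sq_abs]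
    have eb : ‖b + δ • θ‖ ^ 2 = ‖b‖ ^ 2 + 2 * (δ * ⟪b, θ⟫) + δ ^ 2 * ‖θ‖ ^ 2 := by
      rw [norm_add_sq_real, norm_smul, mul_pow, real_inner_smul_right, Real.norm_eq_abs, sq_abs]
    have e : -((t + s) / 2) * ‖z‖ ^ 2 + s / 2 * ‖w‖ ^ 2 - s / 2 * ‖b‖ ^ 2 + s / 2 * ‖b + δ • θ‖ ^ 2
        = (1 + δ * t) * t / 2 * ‖z‖ ^ 2 - (1 + δ * t) * ⟪z, θ⟫ + δ * ‖θ‖ ^ 2 + ⟪b, θ⟫ := by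
      rw [ew, eb, hs]; field_simp; ring
    rw [e]
    have dt : δ * t ≤ 1 / 2 := (mul_le_mul d1 t1 t0.le (by norm_num)).trans (by norm_num)
    have dt0 : 0 < δ * t := by positivity
    have i1 := neg_le_of_abs_le (abs_real_inner_le_norm z θ)
    have i2 := real_inner_le_norm b θ
    have n1 : (1 + δ * t) * t / 2 * ‖z‖ ^ 2 ≤ 1 * ‖z‖ ^ 2 := by
      refine mul_le_mul_of_nonneg_right ?_ (sq_nonneg _)
      linarith [mul_le_mul (show 1 + δ * t ≤ 3 / 2 by linarith) t1 t0.le (by norm_num)]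
    have n2 : -((1 + δ * t) * ⟪z, θ⟫) ≤ 3 / 2 * (‖z‖ * ‖θ‖) := by
      have : 0 ≤ ‖z‖ * ‖θ‖ := by positivity
      linarith [mul_le_mul_of_nonneg_left i1 (show 0 ≤ 1 + δ * t by linarith), mul_le_mul_of_nonneg_right dt this]
    have n3 : δ * ‖θ‖ ^ 2 ≤ 1 / 2 * ‖θ‖ ^ 2 := by gcongr
    have n4 := two_mul_le_add_sq ‖z‖ ‖θ‖
    have n5 := two_mul_le_add_sq ‖b‖ ‖θ‖
    rw [mul_assoc] at n4 n5
    linarith [sq_nonneg ‖z‖, sq_nonneg ‖b‖]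
  calc exp (-((t + s) / 2) * ‖z‖ ^ 2) * A = exp (-((t + s) / 2) * ‖z‖ ^ 2 + s / 2 * ‖w‖ ^ 2) * (exp (-(s / 2) * ‖w‖ ^ 2) * A) := by
        rw [← mul_assoc, ← exp_add]; congr 2; ring
    _ ≤ exp (-((t + s) / 2) * ‖z‖ ^ 2 + s / 2 * ‖w‖ ^ 2) * (4 ^ finrank ℝ E * (exp (-(s / 2) * ‖b‖ ^ 2) * B)) := by gcongr
    _ = 4 ^ finrank ℝ E * (exp (-((t + s) / 2) * ‖z‖ ^ 2 + s / 2 * ‖w‖ ^ 2 - s / 2 * ‖b‖ ^ 2 + s / 2 * ‖b + δ • θ‖ ^ 2) *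
          (exp (-(s / 2) * ‖b + δ • θ‖ ^ 2) * B)) := by
        rw [show ∀ a b c d : ℝ, a * (b * (c * d)) = b * ((a * c) * d) by intros; ring, ← mul_assoc (exp _) (exp _) B, ← exp_add, ← exp_add]
        congr 3; ring_nf
    _ ≤ 4 ^ finrank ℝ E * (exp (164 * N) * (exp (-(s / 2) * ‖b + δ • θ‖ ^ 2) * (B / Zq μ (t, 0)))) := by
        gcongr
        rw [le_div_iff₀ z0]; exact mul_le_of_le_one_right B0.le z1
    _ = _ := by ring

lemma volb (h : BS μ R) (hμ : SLC 0 μ) {t δ n : ℝ} (t0 : 0 < t) (t1 : t ≤ 1) (d0 : 0 < δ) (d1 : δ ≤ 1 / 2) (hn : n = finrank ℝ E) (n0 : 0 < n)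
    (hk : EE μ t (fun q => trf (fun x => (1 - x) ^ 2) (tl μ q)) ≤ 1 / 128 * n) (m2 : ∫ x, ‖x‖ ^ 2 ∂μ ≤ 2 * n) {z : E} (hz : ‖z‖ ^ 2 ≤ 2 * n) :
    KK μ (t + δ⁻¹) z ≤ 2 * (8 * exp 164 / √t) ^ n * δ ^ (n / 4) := by
  set k := finrank ℝ E with hkd
  have G1 := good h t0 t1 hn n0 (by norm_num) hk m2
  set G := {g : E | trf (fun x => (1 - x) ^ 2) (tl μ (t, √t • g)) ≤ 8 * (1 / 128) * n ∧
      MM μ (fun x => ‖x‖ ^ 2) (t, √t • g) ≤ 16 * n ∧ ‖g‖ ^ 2 ≤ 48 * n} with hG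
  have mG : MeasurableSet G := by
    have cT := trf_cont h (ψ := fun x => (1 - x) ^ 2) (by fun_prop)
    have cM := cont_MM h (φ := fun x => ‖x‖ ^ 2) (by fun_prop)
    refine IsClosed.measurableSet ?_
    refine IsClosed.inter (s₁ := {g : E | (_:ℝ) ≤ _}) (isClosed_le (cT.comp (g := fun q : ℝ × E => trf (fun x => (1 - x) ^ 2) (tl μ q)) (f := fun g => (t, √t • g)) (by fun_prop)) continuous_const) (IsClosed.inter (s₁ := {g : E | (_:ℝ) ≤ _}) (s₂ := {g : E | (_:ℝ) ≤ _}) (isClosed_le ?_ ?_) (isClosed_le ?_ ?_)) <;> fun_prop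
  have st : 0 < √t := Real.sqrt_pos.2 t0
  have := h.tl_prob (t, (0:E))
  set Y := fun g : E => bar (tl μ (t, √t • g)) + (δ * √t) • g with hY
  set c : ℝ := √t ^ k * ((1 / 2) ^ k * δ ^ (n / 4)) with hc
  have c0 : 0 < c := by positivity
  set C : ℝ := 4 ^ k * exp (164 * n) with hC
  have C0 : 0 < C := by positivity
  set K := KK μ (t + δ⁻¹) z
  have K0 : 0 < K := KK_pos h _ _
  have s0 : 0 < δ⁻¹ := by positivity
  have e1 : ofReal ((Real.pi / (δ⁻¹ / 2)) ^ (n / 2)) = ∫⁻ y, ofReal (KK (tl μ (t, (0:E))) δ⁻¹ y) := by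
    have := KK_int (h.tl (t, (0:E))) δ⁻¹ (u := fun _ => 1) measurable_const
    simp only [mul_one] at this
    rw [this, gauss_fin s0, ← hkd, hn]; simp
  have e2 := lintegral_image_eq_lintegral_abs_det_fderiv_mul volume mG (fun g _ => (bar_deriv h t δ g).hasFDerivWithinAt) (bar_inj h t0 d0).injOn
    (fun y => ofReal (KK (tl μ (t, (0:E))) δ⁻¹ y))
  have e3 : ofReal (c * (K / C)) * volume G ≤ ofReal ((Real.pi / (δ⁻¹ / 2)) ^ (n / 2)) := by
    rw [e1]
    refine le_trans ?_ (setLIntegral_le_lintegral (Y '' G) _)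
    rw [e2, ← setLIntegral_const]
    refine setLIntegral_mono' mG fun g hg => ?_
    rw [← ofReal_mul (abs_nonneg _)]
    refine ofReal_le_ofReal ?_
    have pp := h.tl_prob (t, √t • g)
    refine mul_le_mul ?_ ?_ (by positivity) (abs_nonneg _)
    · refine le_trans ?_ (le_abs_self _)
      rw [bar_det, Finset.prod_mul_distrib, Finset.prod_const, hc]
      simp only [Finset.card_univ, Fintype.card_fin, ← hkd]
      gcongr
      have := det_low (fun i => ev_nonneg (h.tl (t, √t • g)) i) d0 (d1.trans (by norm_num)) hg.1
      rwa [show 4 * (8 * (1 / 128) * n) = n / 4 by ring] at this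
    · rw [div_le_iff₀ C0, mul_comm]
      have := KK_cmp h hμ t0 t1 d0 d1 (θ := √t • g) hz ?_ hg.2.1
      · rwa [smul_smul] at this
      · rw [norm_smul, norm_of_nonneg st.le, mul_pow, sq_sqrt t0.le]
        nlinarith [hg.2.2, sq_nonneg ‖g‖]
  have e4 : c * (K / C) * (1 / 2 * (2 * Real.pi) ^ (n / 2)) ≤ (Real.pi / (δ⁻¹ / 2)) ^ (n / 2) := by
    rw [← ENNReal.ofReal_le_ofReal_iff (by positivity), ofReal_mul (by positivity)]
    exact (mul_le_mul_right G1 _).trans e3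
  rw [show Real.pi / (δ⁻¹ / 2) = (2 * Real.pi) * δ by field_simp, Real.mul_rpow (by positivity) d0.le] at e4
  have P0 : 0 < (2 * Real.pi) ^ (n / 2) := by positivity
  have e5 : c * (K / C) * (1 / 2) ≤ δ ^ (n / 2) := by
    refine le_of_mul_le_mul_right ?_ P0
    linarith
  have ed : δ ^ (n / 2) = δ ^ (n / 4) * δ ^ (n / 4) := by rw [← Real.rpow_add d0]; congr 1; ring
  rw [ed] at e5
  have D0 : 0 < δ ^ (n / 4) := by positivity
  have e6 : √t ^ k * (1 / 2) ^ k * (K / C) * (1 / 2) ≤ δ ^ (n / 4) := by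
    refine le_of_mul_le_mul_right ?_ D0
    rw [hc] at e5; linarith
  have eC : (8 * exp 164 / √t) ^ n = C / (√t ^ k * (1 / 2) ^ k) := by
    rw [hn, Real.rpow_natCast, hC, hn, show (164:ℝ) * (k:ℝ) = k * 164 by ring, Real.exp_nat_mul, ← mul_pow, ← mul_pow, ← div_pow]
    congr 1
    field_simp; norm_num
  rw [eC]
  have u0 : 0 < √t ^ k * (1 / 2) ^ k := by positivity
  have : √t ^ k * (1 / 2) ^ k * (K / C) * (1 / 2) = K / (2 * (C / (√t ^ k * (1 / 2) ^ k))) := by field_simp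
  rw [this, div_le_iff₀ (by positivity)] at e6
  linarith

lemma sball (h : BS μ R) (hμ : SLC 0 μ) {t δ n : ℝ} (t0 : 0 < t) (t1 : t ≤ 1) (d0 : 0 < δ) (d1 : δ ≤ 1 / 2) (hn : n = finrank ℝ E) (n0 : 0 < n)
    (hk : EE μ t (fun q => trf (fun x => (1 - x) ^ 2) (tl μ q)) ≤ 1 / 128 * n) (m2 : ∫ x, ‖x‖ ^ 2 ∂μ ≤ 2 * n) (y : E) :
    μ (Metric.closedBall y √(δ * n)) ≤ ofReal (2 * (32 * exp 165 / √t) ^ n * δ ^ (n / 4)) := by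
  have z2 := (bar_sq h).trans m2
  have K1 := volb h hμ t0 t1 d0 d1 hn n0 hk m2 z2
  have K2 := lemJ h hμ (show 0 < t + δ⁻¹ by positivity) y
  set τ := t + δ⁻¹
  have hτ : τ * δ ≤ 2 := by
    rw [add_mul, inv_mul_cancel₀ d0.ne']; nlinarith
  have st : 0 < √t := Real.sqrt_pos.2 t0
  calc μ (Metric.closedBall y √(δ * n)) = ∫⁻ x in Metric.closedBall y √(δ * n), 1 ∂μ := by simp
    _ ≤ ∫⁻ x in Metric.closedBall y √(δ * n), ofReal (exp n) * ofReal (exp (-(τ / 2) * ‖y - x‖ ^ 2)) ∂μ := by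
        refine setLIntegral_mono' Metric.isClosed_closedBall.measurableSet fun x hx => ?_
        rw [← ofReal_mul (by positivity), ← exp_add, ← ENNReal.ofReal_one]
        refine ofReal_le_ofReal (Real.one_le_exp ?_)
        rw [Metric.mem_closedBall, dist_comm, dist_eq_norm] at hx
        have : ‖y - x‖ ^ 2 ≤ δ * n := by
          rw [← sq_sqrt (show 0 ≤ δ * n by positivity)]; gcongr
        have τ0 : 0 < τ := by positivity
        nlinarith
    _ ≤ ofReal (exp n) * ofReal (KK μ τ y) := by
        rw [KK_l h, ← lintegral_const_mul' _ _ ENNReal.ofReal_ne_top]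
        exact setLIntegral_le_lintegral _ _
    _ = ofReal (exp n * KK μ τ y) := (ofReal_mul (by positivity)).symm
    _ ≤ _ := by
        refine ofReal_le_ofReal ?_
        refine (mul_le_mul_of_nonneg_left (K2.trans (mul_le_mul_of_nonneg_left K1 (by positivity))) (by positivity)).trans_eq ?_
        rw [show 32 * exp 165 / √t = exp 1 * (4 * (8 * exp 164 / √t)) by
          rw [show (165:ℝ) = 1 + 164 by norm_num, exp_add]; ring, Real.mul_rpow (by positivity) (by positivity), Real.mul_rpow (by positivity) (by positivity), ← Real.exp_mul, one_mul, show (4:ℝ) ^ n = 4 ^ finrank ℝ E by rw [hn, Real.rpow_natCast]]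
        ring

end

end

section

lemma tr_le {E : Type*} [NormedAddCommGroup E] [InnerProductSpace ℝ E] [FiniteDimensional ℝ E]
    [MeasurableSpace E] [BorelSpace E] {μ : Measure E} [IsProbabilityMeasure μ] {R : ℝ} (h : BS μ R) :
    trf (fun x => x) μ = ∫ x, ‖x‖ ^ 2 ∂μ - ‖bar μ‖ ^ 2 := by
  set e := eb μ
  have e1 : ∀ g : E, ‖g‖ ^ 2 = ∑ i, ⟪g, e i⟫ * ⟪g, e i⟫ := fun g => by
    rw [← e.sum_sq_norm_inner_left g]; simp [sq]
  simp only [e1]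
  rw [integral_finsetSum _ fun i _ => h.int (by fun_prop), ← Finset.sum_sub_distrib, trf]
  refine sum_congr rfl fun i _ => ?_
  rw [← cov_raw h, cov_eb, real_inner_smul_right, real_inner_self_eq_norm_sq, e.orthonormal.1 i]; simp

lemma iso_sb : ∃ A : ℝ, 1 ≤ A ∧ ∀ (E : Type) [NormedAddCommGroup E] [InnerProductSpace ℝ E] [FiniteDimensional ℝ E]
    [MeasurableSpace E] [BorelSpace E] (μ : Measure E) [IsProbabilityMeasure μ] (n δ : ℝ), n = finrank ℝ E → 0 < n → SLC 0 μ →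
    Integrable (fun x => ‖x‖ ^ 2) μ → Integrable (fun x => x) μ → ∫ x, x ∂μ = 0 → (∀ v, ∫ x, ⟪x, v⟫ * ⟪x, v⟫ ∂μ = ‖v‖ ^ 2) → 0 < δ → δ ≤ 1 / 2 →
    ∀ y, μ (Metric.closedBall y √(δ * n)) ≤ ofReal (2 * A ^ n * δ ^ (n / 4)) := by
  obtain ⟨t, t0, t1, H⟩ := thmG (η := 1 / 896) (by norm_num) (by norm_num)
  have st : 0 < √t := Real.sqrt_pos.2 t0
  refine ⟨32 * exp 165 / √t, ?_, ?_⟩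
  · rw [one_le_div st]
    have := Real.sqrt_le_one.2 t1
    linarith [Real.add_one_le_exp (165:ℝ)]
  intro E _ _ _ _ _ μ _ n δ hn n0 hμ i2 i1 hb hc d0 d1 y
  have tot : ∫ x, ‖x‖ ^ 2 ∂μ = n := by
    set e := stdOrthonormalBasis ℝ E
    have e1 : ∀ g : E, ‖g‖ ^ 2 = ∑ i, ⟪g, e i⟫ * ⟪g, e i⟫ := fun g => by
      rw [← e.sum_sq_norm_inner_left g]; simp [sq]
    simp only [e1]
    rw [integral_finsetSum _ fun i _ => ?_]
    · simp [hc, hn]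
    · refine i2.mono' (by fun_prop) (of_forall fun x => ?_)
      have := abs_real_inner_le_norm x (e i)
      rw [e.orthonormal.1 i, mul_one] at this
      rw [Real.norm_eq_abs, abs_mul, sq]; gcongr
  set s : ℕ → Set E := fun N => Metric.closedBall 0 N with hs
  have ms : ∀ N, MeasurableSet (s N) := fun N => Metric.isClosed_closedBall.measurableSet
  have mono : Monotone s := fun a b hab => Metric.closedBall_subset_closedBall (by exact_mod_cast hab)
  have un : ⋃ N, s N = univ := Metric.iUnion_closedBall_nat 0
  have L0 := tendsto_setIntegral_of_monotone (μ := μ) (f := fun _ => (1:ℝ)) ms mono (integrable_const _).integrableOn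
  have L1 := tendsto_setIntegral_of_monotone (μ := μ) ms mono i1.integrableOn
  have L2 := tendsto_setIntegral_of_monotone (μ := μ) ms mono i2.integrableOn
  simp only [un, Measure.restrict_univ, hb, tot] at L0 L1 L2
  simp only [integral_const, smul_eq_mul, mul_one, probReal_univ, measureReal_restrict_apply_univ] at L0
  have L3 := L1.norm
  rw [norm_zero] at L3
  obtain ⟨N, hN0, hN2, hN3, hNy⟩ := ((L0.eventually (lt_mem_nhds (show 1 - 1 / 2000 < (1:ℝ) by norm_num))).and ((L2.eventually (lt_mem_nhds (show (1 - 1 / 2000) * n < n by linarith))).and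
    ((L3.eventually (gt_mem_nhds (show 0 < √n / 2000 by positivity))).and (Filter.eventually_ge_atTop ⌈‖y‖ + √(δ * n)⌉₊)))).exists
  set K := s N
  set m := μ.real K with hm
  have m0 : 0 < m := by linarith
  have m1 : m ≤ 1 := measureReal_le_one
  have mK : μ K ≠ 0 := fun h0 => by rw [hm, measureReal_def, h0] at m0; simp at m0
  set ν : Measure E := (μ K)⁻¹ • μ.restrict K with hν
  have iν : ∀ {F : Type} [NormedAddCommGroup F] [NormedSpace ℝ F] (f : E → F), ∫ x, f x ∂ν = m⁻¹ • ∫ x in K, f x ∂μ := fun f => by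
    rw [hν, integral_smul_measure, ENNReal.toReal_inv]; rfl
  have pν : IsProbabilityMeasure ν := ⟨by simp [hν, ENNReal.inv_mul_cancel mK (measure_ne_top μ K)]⟩
  have bs : BS ν N := by
    have : ∀ᵐ x ∂μ.restrict K, ‖x‖ ≤ N := by
      filter_upwards [ae_restrict_mem (ms N)] with x hx
      exact mem_closedBall_zero_iff.1 hx
    exact Measure.ae_smul_measure this _
  have sl : SLC 0 ν := (hμ.restrict (convex_closedBall 0 _) (ms N)).smul _
  have mi : m⁻¹ ≤ 1 + 1 / 1000 := by
    rw [inv_le_comm₀ m0 (by norm_num)]; refine le_trans ?_ hN0.le; norm_num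
  have mi1 : 1 ≤ m⁻¹ := (one_le_inv₀ m0).2 m1
  have hev : ∀ i, ev ν i ≤ 1 + 1 / 1000 := fun i => by
    have := cov_raw bs (eb ν i) (eb ν i)
    rw [cov_eb, inner_smul_right] at this
    simp only [real_inner_self_eq_norm_sq, (eb ν).orthonormal.1 i] at this
    have h2 : ∫ x, ⟪x, eb ν i⟫ * ⟪x, eb ν i⟫ ∂ν ≤ m⁻¹ := by
      rw [iν, smul_eq_mul]
      refine mul_le_of_le_one_right (by positivity) ?_
      have := hc (eb ν i)
      rw [(eb ν).orthonormal.1 i, one_pow] at this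
      rw [← this]
      refine setIntegral_le_integral ?_ (of_forall fun x => mul_self_nonneg _)
      exact Integrable.of_integral_ne_zero (by rw [this]; norm_num)
    linarith [mul_self_nonneg ⟪bar ν, eb ν i⟫]
  have s2 : ∫ x, ‖x‖ ^ 2 ∂ν ≤ 2 * n := by
    rw [iν, smul_eq_mul]
    have : ∫ x in K, ‖x‖ ^ 2 ∂μ ≤ n := tot ▸ setIntegral_le_integral i2 (of_forall fun x => by positivity)
    nlinarith
  have tr : (1 - 1 / 896) * (finrank ℝ E : ℝ) ≤ trf (fun x => x) ν := by
    rw [tr_le bs, ← hn, iν, bar, iν, norm_smul, smul_eq_mul, norm_of_nonneg (by positivity)]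
    have e1 : (m⁻¹ * ‖∫ x in K, x ∂μ‖) ^ 2 ≤ (√n / 1000) ^ 2 := by
      gcongr
      nlinarith [norm_nonneg (∫ x in K, x ∂μ)]
    rw [div_pow, sq_sqrt n0.le] at e1
    nlinarith
  have key := H E ν N (1 + 1 / 1000) bs sl (by norm_num) hev tr
  rw [← hn, show (7:ℝ) * (1 / 896) = 1 / 128 by norm_num] at key
  have := sball bs sl t0 t1 d0 d1 hn n0 key s2 y
  refine le_trans ?_ this
  have sub : Metric.closedBall y √(δ * n) ⊆ K := by
    refine Metric.closedBall_subset_closedBall' ?_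
    rw [dist_zero_right]
    have := Nat.ceil_le.1 hNy
    linarith
  rw [hν, Measure.smul_apply, Measure.restrict_apply Metric.isClosed_closedBall.measurableSet, inter_eq_left.2 sub, smul_eq_mul]
  exact le_mul_of_one_le_left' (ENNReal.one_le_inv.2 prob_le_one)

end

section

lemma ms_pos {n : ℕ} {μ : Measure (Euc n)} {f : Euc n → ℝ} (h : IsIsotropicDensity n μ f) : SLC 0 μ := by
  obtain ⟨f0, lc, rfl, -, -, -⟩ := h
  set S := {x | 0 < f x} with hS
  have cS : Convex ℝ S := fun x hx y hy a b ha hb hab =>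
    (mul_pos (Real.rpow_pos_of_pos hx a) (Real.rpow_pos_of_pos hy b)).trans_le (lc x y a b ha hb hab)
  have cc : ConcaveOn ℝ S (fun x => Real.log (f x)) := ⟨cS, fun x hx y hy a b ha hb hab => by
    have := Real.log_le_log (mul_pos (Real.rpow_pos_of_pos hx _) (Real.rpow_pos_of_pos hy _)) (lc _ _ _ _ ha hb hab)
    rwa [Real.log_mul (Real.rpow_pos_of_pos hx _).ne' (Real.rpow_pos_of_pos hy _).ne', Real.log_rpow hx, Real.log_rpow hy] at this⟩
  have co : ContinuousOn f (interior S) := by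
    refine (Real.continuous_exp.comp_continuousOn cc.continuousOn_interior).congr fun x hx => ?_
    have h1 : x ∈ S := interior_subset hx
    exact (Real.exp_log h1).symm
  set w : Euc n → ℝ≥0∞ := (interior S).indicator fun x => ofReal (f x) with hw
  have mw : Measurable w := by
    refine measurable_of_restrict_of_restrict_compl (s := interior S) isOpen_interior.measurableSet ?_ ?_
    · have e : (interior S).domRestrict w = fun x : interior S => ofReal (f x) :=
        funext fun x => (by show w x = _; rw [hw]; exact Set.indicator_of_mem x.2 _)
      rw [e]
      exact ENNReal.measurable_ofReal.comp (continuousOn_iff_continuous_domRestrict.1 co).measurable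
    · have e : (interior S)ᶜ.domRestrict w = fun _ => 0 := funext fun x => (by show w x = 0; rw [hw]; exact Set.indicator_of_notMem x.2 _)
      rw [e]; exact measurable_const
  have ae : (fun x => ofReal (f x)) =ᵐ[volume] w := by
    have : ∀ᵐ x, x ∉ frontier S := measure_eq_zero_iff_ae_notMem.1 (cS.addHaar_frontier volume)
    filter_upwards [this] with x hx
    by_cases hi : x ∈ interior S
    · rw [hw, indicator_of_mem hi]
    · rw [hw, indicator_of_notMem hi, ENNReal.ofReal_of_nonpos]
      by_contra! hp
      exact hx ⟨subset_closure hp, hi⟩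
  rw [withDensity_congr_ae ae]
  have := (LC_volume (Euc n)).slc.withDensity (r := 0) mw fun x y => ?_
  · simpa using this
  simp only [zero_div, zero_mul, neg_zero, Real.exp_zero, ENNReal.ofReal_one, mul_one]
  by_cases hx : x ∈ interior S
  · by_cases hy : y ∈ interior S
    · have hm : (1 / 2 : ℝ) • (x + y) ∈ interior S := by
        rw [smul_add]; exact cS.interior hx hy (by norm_num) (by norm_num) (by norm_num)
      rw [hw, indicator_of_mem hx, indicator_of_mem hy, indicator_of_mem hm, ← ofReal_mul (f0 x), ← ENNReal.ofReal_pow (f0 _)]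
      refine ofReal_le_ofReal ?_
      have := lc x y (1/2) (1/2) (by norm_num) (by norm_num) (by norm_num)
      rw [← smul_add, ← Real.mul_rpow (f0 x) (f0 y), ← Real.sqrt_eq_rpow] at this
      exact (Real.sqrt_le_left (f0 _)).1 this
    · simp [hw, hy]
  · simp [hw, hx]

lemma maurey {n : ℕ} {ι : Type} (a : ι → Euc n) {ρ : ℝ} (ha : ∀ i, ‖a i‖ ≤ ρ) {x : Euc n} (hx : x ∈ convexHull ℝ (range a)) (l : ℕ) :
    ∃ s : Sym ι l, ‖((s : Multiset ι).map a).sum - (l : ℝ) • x‖ ^ 2 ≤ l * (2 * ρ) ^ 2 := by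
  have hxρ : ‖x‖ ≤ ρ := by
    have : convexHull ℝ (range a) ⊆ Metric.closedBall 0 ρ := convexHull_min (by rintro _ ⟨i, rfl⟩; simpa using ha i) (convex_closedBall _ _)
    simpa using this hx
  induction l with
  | zero => exact ⟨Sym.nil, by simp⟩
  | succ l ih =>
    obtain ⟨s, hs⟩ := ih
    set u := ((s : Multiset ι).map a).sum - (l : ℝ) • x
    obtain ⟨i, hi⟩ : ∃ i, ⟪u, a i - x⟫ ≤ 0 := by
      by_contra! hc
      have : convexHull ℝ (range a) ⊆ {y | ⟪u, x⟫ < ⟪u, y⟫} := by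
        refine convexHull_min ?_ (convex_halfSpace_gt (innerₛₗ ℝ u).isLinear _)
        rintro _ ⟨i, rfl⟩
        have := hc i
        rw [inner_sub_right] at this
        simpa using this
      exact lt_irrefl ⟪u, x⟫ (this hx)
    refine ⟨i ::ₛ s, ?_⟩
    have e : (((i ::ₛ s : Sym ι (l + 1)) : Multiset ι).map a).sum - ((l + 1 : ℕ) : ℝ) • x = u + (a i - x) := by
      rw [Sym.coe_cons, Multiset.map_cons, Multiset.sum_cons]
      push_cast
      simp only [u, add_smul, one_smul]; abel
    rw [e, norm_add_sq_real]
    have : ‖a i - x‖ ≤ 2 * ρ := (norm_sub_le _ _).trans (by linarith [ha i])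
    have : ‖a i - x‖ ^ 2 ≤ (2 * ρ) ^ 2 := by gcongr
    push_cast; linarith

lemma proj_ex {n : ℕ} {T : Euc n →ₗ[ℝ] Euc n} {k : ℕ} (h : SingValGe n T k) : ∃ V : Submodule ℝ (Euc n), k ≤ finrank ℝ V ∧
    ∀ x, ‖V.orthogonalProjectionOnto x‖ ≤ ‖T x‖ := by
  obtain ⟨F, hk, hF⟩ := h
  set A := T.adjoint ∘ₗ T with hA
  have key : ∀ f ∈ F, ‖T f‖ ≤ ‖A f‖ := fun f hf => by
    have e : ⟪A f, f⟫ = ‖T f‖ ^ 2 := by rw [hA, LinearMap.comp_apply, LinearMap.adjoint_inner_left, real_inner_self_eq_norm_sq]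
    have := real_inner_le_norm (A f) f
    have h1 := hF f hf
    by_cases h0 : ‖T f‖ = 0
    · rw [h0]; positivity
    · have : 0 < ‖T f‖ := lt_of_le_of_ne (norm_nonneg _) (Ne.symm h0)
      nlinarith [norm_nonneg (A f)]
  refine ⟨F.map A, ?_, fun x => ?_⟩
  · have inj : Function.Injective (A.domRestrict F) := by
      rw [injective_iff_map_eq_zero]
      intro f hf
      have h1 := (hF f f.2).trans (key f f.2)
      rw [show A f = 0 from hf, norm_zero] at h1
      exact Subtype.ext (norm_le_zero_iff.1 h1)
    have := (LinearEquiv.ofInjective _ inj).finrank_eq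
    rw [LinearMap.range_domRestrict] at this
    omega
  · set V := F.map A
    obtain ⟨f, hf, e⟩ := (V.orthogonalProjectionOnto x).2
    have e2 : ‖V.orthogonalProjectionOnto x‖ ^ 2 = ⟪T x, T f⟫ := by
      rw [← real_inner_self_eq_norm_sq, Submodule.inner_orthogonalProjectionOnto_eq_of_mem_right, ← e, hA, LinearMap.comp_apply, LinearMap.adjoint_inner_right]
    have e3 : ‖V.orthogonalProjectionOnto x‖ = ‖A f‖ := by rw [e]; rfl
    have := real_inner_le_norm (T x) (T f)
    have h4 := key f hf
    by_contra! hc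
    nlinarith [norm_nonneg (T x)]

end

lemma cnt {m n l : ℕ} (hn : 0 < n) (hnm : n ≤ m) (hl : 1 ≤ l) {L : ℝ} (hL : L = Real.log (1 + (m:ℝ) / n)) (L0 : 1 / 2 ≤ L) (hlL : l * L ≤ n / 2) :
    (((m + m).multichoose l : ℕ) : ℝ) ≤ exp (6 * n) := by
  have n0 : (0:ℝ) < n := by exact_mod_cast hn
  have l0 : (1:ℝ) ≤ l := by exact_mod_cast hl
  have m0 : (n:ℝ) ≤ m := by exact_mod_cast hnm
  have ln : (l:ℝ) ≤ n := by nlinarith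
  rw [Nat.multichoose_eq]
  refine (Nat.choose_le_pow_div _ _).trans ?_
  have h1 : ((m + m + l - 1 : ℕ) : ℝ) ≤ 3 * m := by
    have : m + m + l - 1 ≤ 3 * m := by have : l ≤ n := by exact_mod_cast ln
                                       omega
    exact_mod_cast this
  have h2 : (m:ℝ) / n ≤ exp L := by
    rw [hL, Real.exp_log (by positivity)]; linarith
  have h3 : (n:ℝ) / l ≤ exp (n / l) := by linarith [Real.add_one_le_exp ((n:ℝ) / l)]
  have h4 : 3 * (m:ℝ) ≤ exp (2 + L + n / l) * l := by
    have : (3:ℝ) * m = 3 * (m / n) * (n / l) * l := by field_simp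
    rw [this, exp_add, exp_add]
    gcongr
    linarith [Real.add_one_le_exp (2:ℝ)]
  calc _ ≤ (exp (2 + L + n / l) * l) ^ l / (l.factorial : ℝ) := by gcongr; exact h1.trans h4
    _ = exp (2 + L + n / l) ^ l * ((l:ℝ) ^ l / l.factorial) := by rw [mul_pow, mul_div_assoc]
    _ ≤ exp (2 + L + n / l) ^ l * exp l := by
        gcongr; exact Real.pow_div_factorial_le_exp _ (by positivity) _
    _ = exp (l * (2 + L + n / l) + l) := by rw [← Real.exp_nat_mul, ← exp_add]
    _ ≤ _ := by
        refine Real.exp_le_exp.2 ?_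
        have : (l:ℝ) * (n / l) = n := by field_simp
        linarith

lemma core {A : ℝ} (hA : 1 ≤ A) (H : ∀ (E : Type) [NormedAddCommGroup E] [InnerProductSpace ℝ E] [FiniteDimensional ℝ E]
    [MeasurableSpace E] [BorelSpace E] (μ : Measure E) [IsProbabilityMeasure μ] (n δ : ℝ), n = finrank ℝ E → 0 < n → SLC 0 μ →
    Integrable (fun x => ‖x‖ ^ 2) μ → Integrable (fun x => x) μ → ∫ x, x ∂μ = 0 → (∀ v, ∫ x, ⟪x, v⟫ * ⟪x, v⟫ ∂μ = ‖v‖ ^ 2) → 0 < δ → δ ≤ 1 / 2 →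
    ∀ y, μ (Metric.closedBall y √(δ * n)) ≤ ofReal (2 * A ^ n * δ ^ (n / 4)))
    {n k : ℕ} (hn : 0 < n) (hk : (n:ℝ) / 4 ≤ k) {μ : Measure (Euc n)} (hμ : IsIsotropicLogConcave n μ) {T : Euc n →ₗ[ℝ] Euc n} (hT : SingValGe n T k)
    (w : Euc n) {r : ℝ} (r0 : 0 ≤ r) (hr : 16 * r ^ 2 ≤ ((A * exp 32) ^ 4)⁻¹ * n) :
    μ {x | ‖T x - w‖ ≤ r} ≤ ofReal (exp (-(7 * n))) := by
  set δ := ((A * exp 32) ^ 4)⁻¹ with hδ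
  obtain ⟨f, hf⟩ := hμ
  have sl := ms_pos hf
  obtain ⟨-, -, -, pr, b0, c0⟩ := hf
  have n0 : (1:ℝ) ≤ n := by exact_mod_cast hn
  obtain ⟨V, hV, hP⟩ := proj_ex hT
  set P := V.orthogonalProjectionOnto
  set k' : ℝ := (finrank ℝ V : ℝ) with hk'
  have kk : (n:ℝ) / 4 ≤ k' := hk.trans (by rw [hk']; exact_mod_cast hV)
  have B1 : 2 ≤ A * exp 32 := by nlinarith [Real.add_one_le_exp (32:ℝ)]
  have i2 : Integrable (fun x => ‖x‖ ^ 2) μ := by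
    set e := stdOrthonormalBasis ℝ (Euc n)
    have e1 : ∀ g : Euc n, ‖g‖ ^ 2 = ∑ i, ⟪g, e i⟫ * ⟪g, e i⟫ := fun g => by
      rw [← e.sum_sq_norm_inner_left g]; simp [sq]
    simp only [e1]
    refine integrable_finsetSum _ fun i _ => Integrable.of_integral_ne_zero ?_
    rw [c0, real_inner_self_eq_norm_sq, e.orthonormal.1 i]; norm_num
  have i1 : Integrable (fun x : Euc n => x) μ := by
    refine ((integrable_const 1).add i2).mono' (by fun_prop) (of_forall fun x => ?_)
    simp only [Pi.add_apply]
    nlinarith [sq_nonneg (‖x‖ - 1)]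
  have Pn : ∀ x, ‖P x‖ ≤ ‖x‖ := fun x => V.norm_orthogonalProjectionOnto_apply_le x
  have pν : IsProbabilityMeasure (μ.map P) := Measure.isProbabilityMeasure_map P.measurable.aemeasurable
  have key := H V (μ.map P) k' δ rfl (by linarith) (sl.map le_rfl P Pn) ?_ ?_ ?_ ?_ (by positivity) ?_
  · rcases ({x | ‖T x - w‖ ≤ r}).eq_empty_or_nonempty with he | ⟨x0, hx0⟩
    · rw [he]; simp
    refine (measure_mono (t := P ⁻¹' Metric.closedBall (P x0) √(δ * k')) fun x hx => ?_).trans ?_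
    · rw [mem_preimage, Metric.mem_closedBall, dist_eq_norm, ← map_sub]
      refine (hP _).trans (Real.le_sqrt_of_sq_le ?_)
      have : ‖T (x - x0)‖ ≤ r + r := by
        rw [map_sub, ← sub_sub_sub_cancel_right _ _ w]
        exact (norm_sub_le _ _).trans (add_le_add hx hx0)
      have d0 : 0 < δ := by positivity
      calc ‖T (x - x0)‖ ^ 2 ≤ (r + r) ^ 2 := by gcongr
        _ ≤ δ * (n / 4) := by linarith
        _ ≤ _ := by gcongr
    · rw [← Measure.map_apply P.measurable Metric.isClosed_closedBall.measurableSet]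
      refine (key _).trans (ofReal_le_ofReal ?_)
      have e1 : A ^ k' * δ ^ (k' / 4) = exp (-(32 * k')) := by
        have : δ ^ (k' / 4) = ((A * exp 32) ^ k')⁻¹ := by
          rw [hδ, Real.inv_rpow (by positivity), ← Real.rpow_natCast, ← Real.rpow_mul (by positivity)]
          congr 2; push_cast; ring
        rw [this, Real.mul_rpow (by positivity) (by positivity), ← Real.exp_mul, Real.exp_neg]
        field_simp
      rw [mul_assoc, e1]
      calc 2 * exp (-(32 * k')) ≤ exp 1 * exp (-(8 * n)) := by
            refine mul_le_mul ?_ (Real.exp_le_exp.2 (by linarith)) (by positivity) (by positivity)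
            linarith [Real.add_one_le_exp (1:ℝ)]
        _ ≤ _ := by rw [← exp_add]; exact Real.exp_le_exp.2 (by linarith)
  · rw [integrable_map_measure (by fun_prop) P.measurable.aemeasurable]
    refine i2.mono' (by fun_prop) (of_forall fun x => ?_)
    simp only [Function.comp]
    rw [norm_of_nonneg (by positivity)]; gcongr; exact Pn x
  · rw [integrable_map_measure (by fun_prop) P.measurable.aemeasurable]
    exact P.integrable_comp i1
  · rw [integral_map P.measurable.aemeasurable (by fun_prop), P.integral_comp_comm i1, b0, map_zero]
  · intro v
    rw [integral_map P.measurable.aemeasurable (by fun_prop)]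
    have : ∀ x, ⟪P x, v⟫ = ⟪x, (v : Euc n)⟫ := fun x => V.inner_orthogonalProjectionOnto_eq_of_mem_right v x
    simp only [this, c0, real_inner_self_eq_norm_sq]; rfl
  · have : (2:ℝ) ≤ (A * exp 32) ^ 4 := B1.trans (le_self_pow₀ (by linarith) (by norm_num))
    rw [hδ, one_div]; gcongr

theorem statement_11 :
    ∃ C₅ : ℝ, 0 < C₅ ∧
      ∀ (n m : ℕ), n ≤ m → ∀ b : ℝ, 1 ≤ b →
      ∀ z : Fin m → Euc n,
        absConv n (Set.range z) ⊆ Metric.closedBall (0 : Euc n) (b * Real.sqrt n) →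
      ∀ (μ : Measure (Euc n)), IsIsotropicLogConcave n μ →
      ∀ k : ℕ, (n : ℝ) / 4 ≤ k → k ≤ n →
      ∀ T : Euc n →ₗ[ℝ] Euc n, SingValGe n T k →
      ∀ γ : ℝ, 0 < γ → γ ≤ (C₅ * b * Real.sqrt (Real.log (1 + (m : ℝ) / n)))⁻¹ →
      μ {x : Euc n | T x ∈ (γ * Real.sqrt n) • absConv n (Set.range z)} ≤
        ENNReal.ofReal (Real.exp (-(k : ℝ))) := by
  obtain ⟨A, hA, H⟩ := iso_sb
  set B := A * exp 32 with hB
  have B0 : 0 < B := by positivity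
  refine ⟨16 * B ^ 2, by positivity, ?_⟩
  intro n m hnm b hb z hz μ hμ k hk hkn T hT γ γ0 hγ
  rcases Nat.eq_zero_or_pos n with rfl | hn
  · simp at hγ; linarith
  have n0 : (1:ℝ) ≤ n := by exact_mod_cast hn
  have m0 : (n:ℝ) ≤ m := by exact_mod_cast hnm
  set L := Real.log (1 + (m : ℝ) / n) with hL
  have L0 : 1 / 2 ≤ L := by
    have : (1:ℝ) ≤ m / n := (one_le_div (by linarith)).2 m0
    have := Real.log_le_log (by norm_num) (show (2:ℝ) ≤ 1 + m / n by linarith)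
    linarith [Real.log_two_gt_d9]
  have sL : 0 < √L := Real.sqrt_pos.2 (by linarith)
  have g1 : (γ * b) ^ 2 * (256 * L) ≤ (B ^ 4)⁻¹ := by
    have h1 : γ * (16 * B ^ 2 * b * √L) ≤ 1 := by
      rwa [← one_div, le_div_iff₀ (by positivity)] at hγ
    have h2 : (γ * (16 * B ^ 2 * b * √L)) ^ 2 ≤ 1 := pow_le_one₀ (by positivity) h1
    have h3 : (γ * (16 * B ^ 2 * b * √L)) ^ 2 = (γ * b) ^ 2 * (256 * L) * B ^ 4 := by
      rw [mul_pow, mul_pow _ √L, sq_sqrt (by linarith)]; ring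
    rw [← one_div, le_div_iff₀ (by positivity)]; linarith
  have hkn' : (k:ℝ) ≤ n := by exact_mod_cast hkn
  set a : Fin m ⊕ Fin m → Euc n := Sum.elim z (-z) with ha
  have ra : absConv n (range z) = convexHull ℝ (range a) := by
    rw [absConv, ha, Sum.elim_range]
    congr 2
    ext x; simp [neg_eq_iff_eq_neg]
  have na : ∀ i, ‖a i‖ ≤ b * √n := fun i => by
    have := hz (ra ▸ subset_convexHull ℝ _ (mem_range_self i))
    simpa using this
  have co := core hA H hn hk hμ hT
  have sn : √(n:ℝ) * √n = n := Real.mul_self_sqrt (by linarith)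
  set l := ⌊n / (2 * L)⌋₊ with hl
  have l1 : (l:ℝ) * (2 * L) ≤ n := (le_div_iff₀ (by linarith)).1 (Nat.floor_le (by positivity))
  have l2 : (n:ℝ) < (l + 1) * (2 * L) := (div_lt_iff₀ (by linarith)).1 (Nat.lt_floor_add_one _)
  rcases Nat.eq_zero_or_pos l with h0 | h0
  · have := co 0 (r := γ * b * n) (by positivity) (by
      rw [h0] at l2
      have : (γ * b) ^ 2 * n ≤ (γ * b) ^ 2 * (2 * L) := by gcongr; simpa using l2.le
      linarith [mul_le_mul_of_nonneg_left this (show (0:ℝ) ≤ n by linarith), mul_le_mul_of_nonneg_left g1 (show (0:ℝ) ≤ n by linarith), mul_nonneg (inv_pos.2 (pow_pos B0 4)).le (show (0:ℝ) ≤ n by linarith)])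
    refine (measure_mono fun x hx => ?_).trans (this.trans (ofReal_le_ofReal (Real.exp_le_exp.2 (by linarith))))
    obtain ⟨y, hy, e⟩ := hx
    have hy := hz hy
    rw [mem_closedBall_zero_iff] at hy
    simp only [mem_setOf_eq, sub_zero, ← e]
    rw [norm_smul, norm_of_nonneg (by positivity)]
    calc _ ≤ γ * √n * (b * √n) := by gcongr
      _ = γ * b * (√n * √n) := by ring
      _ = _ := by rw [sn]
  · have l0 : (1:ℝ) ≤ l := by exact_mod_cast h0
    have sl : √(l:ℝ) * √l = l := Real.mul_self_sqrt (by linarith)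
    have sl0 : 0 < √(l:ℝ) := Real.sqrt_pos.2 (by linarith)
    set r := 2 * (γ * b) * n / √l with hr
    set c : Sym (Fin m ⊕ Fin m) l → Euc n := fun s => (γ * √n) • (l:ℝ)⁻¹ • ((s : Multiset _).map a).sum
    have hc : ∀ s, μ {x | ‖T x - c s‖ ≤ r} ≤ ofReal (exp (-(7 * n))) := fun s => co _ (by positivity) (by
      rw [hr, div_pow, sq_sqrt (by linarith), ← mul_div_assoc, div_le_iff₀ (by linarith)]
      have : (γ * b) ^ 2 * n ≤ (γ * b) ^ 2 * (4 * l * L) := by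
        refine mul_le_mul_of_nonneg_left ?_ (sq_nonneg _)
        linarith [mul_le_mul_of_nonneg_right l0 (show 0 ≤ L by linarith)]
      calc _ = 64 * n * ((γ * b) ^ 2 * n) := by ring
        _ ≤ 64 * n * ((γ * b) ^ 2 * (4 * l * L)) := by gcongr
        _ = n * l * ((γ * b) ^ 2 * (256 * L)) := by ring
        _ ≤ n * l * (B ^ 4)⁻¹ := by gcongr
        _ = _ := by ring)
    have sub : {x : Euc n | T x ∈ (γ * √n) • absConv n (range z)} ⊆ ⋃ s, {x | ‖T x - c s‖ ≤ r} := by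
      rintro x ⟨y, hy, e⟩
      rw [ra] at hy
      obtain ⟨s, hs⟩ := maurey a na hy l
      refine mem_iUnion.2 ⟨s, ?_⟩
      simp only [mem_setOf_eq, ← e, c]
      set S := ((s : Multiset _).map a).sum
      have e2 : y - (l:ℝ)⁻¹ • S = -((l:ℝ)⁻¹ • (S - (l:ℝ) • y)) := by
        rw [smul_sub, smul_smul, inv_mul_cancel₀ (by linarith), one_smul]; abel
      rw [← smul_sub, norm_smul, norm_of_nonneg (by positivity), e2, norm_neg, norm_smul, norm_of_nonneg (by positivity)]
      have : ‖S - (l:ℝ) • y‖ ≤ √l * (2 * (b * √n)) := by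
        refine le_of_sq_le_sq ?_ (by positivity)
        rw [mul_pow, sq_sqrt (by linarith)]; exact hs
      calc _ ≤ γ * √n * ((l:ℝ)⁻¹ * (√l * (2 * (b * √n)))) := by gcongr
        _ = 2 * (γ * b) * (√n * √n) * √l / l := by ring
        _ = r := by
          rw [sn, hr, div_eq_div_iff (by linarith) sl0.ne', mul_assoc, sl]
    calc _ ≤ ∑ s, μ {x | ‖T x - c s‖ ≤ r} := (measure_mono sub).trans (measure_iUnion_fintype_le _ _)
      _ ≤ ∑ s : Sym (Fin m ⊕ Fin m) l, ofReal (exp (-(7 * n))) := sum_le_sum fun s _ => hc s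
      _ = ofReal ((((m + m).multichoose l : ℕ) : ℝ) * exp (-(7 * n))) := by
        rw [Finset.sum_const, Finset.card_univ, Sym.card_sym_eq_multichoose, ofReal_mul (by positivity), ENNReal.ofReal_natCast, nsmul_eq_mul]
        simp
      _ ≤ _ := by
        refine ofReal_le_ofReal ?_
        calc _ ≤ exp (6 * n) * exp (-(7 * n)) := by gcongr; exact cnt hn hnm h0 hL L0 (by linarith)
          _ ≤ _ := by rw [← exp_add]; exact Real.exp_le_exp.2 (by linarith)

end
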